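/- arXiv:1705.09224 — 8 statements merged into one kernel-verified Lean document; each statement's English description precedes it below -/
import Mathlib

section
/- Let R be a complete noetherian local ring (a noetherian local ring complete in the topology defined by its maximal ideal) whose residue field is countable, and let M be a finitely generated R-module. Then the set of R-submodules of M is countable if and only if: (B2) the Krull dimension of M is at most one, i.e. the Krull dimension of R/Ann_R(M) is at most 1; and (B3) for every prime ideal P of R with Krull dimension of R/P equal to 1, the module (R/P)^2 is not isomorphic to a subquotient of M. Otherwise, M has exactly 2^ℵ₀ submodules. -/
def IsSubquotientOf (R : Type u) [CommRing R]
    (X : Type x) [AddCommGroup X] [Module R X]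
    (M : Type v) [AddCommGroup M] [Module R M] : Prop :=
  ∃ (N : Submodule R M) (P : Submodule R (M ⧸ N)), Nonempty (X ≃ₗ[R] P)

open IsLocalRing

/-- In a noetherian domain with a chain of primes of length two, there are two elements
which do not both lie in the radical of a principal ideal. -/
lemma exists_pair_of_chain {D : Type*} [CommRing D] [IsDomain D] [IsNoetherianRing D]
    {Q₁ Q₂ : Ideal D} [Q₁.IsPrime] [Q₂.IsPrime] (h₁ : ⊥ < Q₁) (h₂ : Q₁ < Q₂) :
    ∃ x ∈ Q₂, ∃ y ∈ Q₂, ∀ z ∈ Q₂, x ∈ (Ideal.span {z}).radical →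
      y ∈ (Ideal.span {z}).radical → False := by
  have hh : ∀ (q q' : Ideal D), q.IsPrime → q'.IsPrime → ⊥ < q → q < q' → ¬ q'.height ≤ 1 := by
    intro q q' hq hq' h1 h2 h3
    have a1 := Ideal.height_add_one_le_of_lt_of_isPrime h1
    have a2 := Ideal.height_add_one_le_of_lt_of_isPrime h2
    rw [Ideal.height_bot, zero_add] at a1
    have : (1 : ℕ∞) + 1 ≤ 1 := (add_le_add_left a1 1).trans (a2.trans h3)
    exact absurd this (by decide)
  obtain ⟨x, hx, hx0⟩ := Submodule.exists_mem_ne_zero_of_ne_bot h₁.ne'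
  have hfin := Ideal.finite_minimalPrimes_of_isNoetherianRing D (Ideal.span {x})
  have hmin : ∀ q ∈ (Ideal.span {x}).minimalPrimes, ⊥ < q := by
    intro q hq
    refine bot_lt_iff_ne_bot.2 fun h => hx0 ?_
    have : x ∈ q := hq.1.2 (Ideal.mem_span_singleton_self x)
    simpa [h] using this
  obtain ⟨y, hy, hy'⟩ : ∃ y ∈ Q₂, ∀ q ∈ (Ideal.span {x}).minimalPrimes, y ∉ q := by
    by_contra! hcon
    have hsub : (Q₂ : Set D) ⊆ ⋃ i ∈ (hfin.toFinset : Set (Ideal D)), ((id i : Ideal D) : Set D) := by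
      intro y hy
      obtain ⟨q, hq, hyq⟩ := hcon y hy
      simp only [Set.mem_iUnion]
      exact ⟨q, by simpa using hq, hyq⟩
    rw [Ideal.subset_union_prime ⊥ ⊥ (by
      intro i hi _ _
      exact ((hfin.mem_toFinset).1 hi).1.1)] at hsub
    obtain ⟨q, hq, hle⟩ := hsub
    have hq' := (hfin.mem_toFinset).1 hq
    have := hq'.1.1
    exact hh Q₁ q inferInstance this h₁ (h₂.trans_le hle)
      (Ideal.height_le_one_of_isPrincipal_of_mem_minimalPrimes _ _ hq')
  refine ⟨x, h₂.le hx, y, hy, fun z hz hxz hyz => ?_⟩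
  obtain ⟨q, hq, hqQ⟩ := Ideal.exists_minimalPrimes_le (I := Ideal.span {z}) (J := Q₂)
    ((Ideal.span_singleton_le_iff_mem _).2 hz)
  have hqp := hq.1.1
  have hrad : (Ideal.span {z}).radical ≤ q := hqp.radical_le_iff.2 hq.1.2
  obtain ⟨q', hq', hle⟩ := Ideal.exists_minimalPrimes_le (I := Ideal.span {x}) (J := q)
    ((Ideal.span_singleton_le_iff_mem _).2 (hrad hxz))
  refine hh q' q hq'.1.1 hqp (hmin _ hq') (lt_of_le_of_ne hle ?_)
    (Ideal.height_le_one_of_isPrincipal_of_mem_minimalPrimes _ _ hq)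
  rintro rfl
  exact hy' _ hq' (hrad hyz)

/-- 0-1 power series in `y`, evaluated in a complete ring. -/
lemma exists_series (R : Type*) [CommRing R] [IsLocalRing R]
    [IsAdicComplete (maximalIdeal R) R] (y : R) (hy : y ∈ maximalIdeal R) :
    ∃ a : (ℕ → Bool) → R, ∀ ε ε', ε ≠ ε' → ∃ (n : ℕ) (u : R), IsUnit u ∧
      a ε - a ε' = y ^ n * u := by
  have key : ∀ ε : ℕ → Bool, ∃ L : R, ∀ n,
      (∑ i ∈ Finset.range n, (if ε i then 1 else 0) * y ^ i) - L ∈ maximalIdeal R ^ n := by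
    intro ε
    have := IsPrecomplete.prec (I := maximalIdeal R) (M := R) inferInstance
      (f := fun n => ∑ i ∈ Finset.range n, (if ε i then 1 else 0) * y ^ i) (by
        intro m n hmn
        rw [SModEq.sub_mem, smul_eq_mul, Ideal.mul_top, ← neg_mem_iff, neg_sub,
          ← Finset.sum_Ico_eq_sub _ hmn]
        refine Ideal.sum_mem _ fun i hi => Ideal.mul_mem_left _ _ ?_
        exact Ideal.pow_le_pow_right (Finset.mem_Ico.1 hi).1 (Ideal.pow_mem_pow hy i))
    obtain ⟨L, hL⟩ := this
    refine ⟨L, fun n => ?_⟩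
    have := hL n
    rwa [SModEq.sub_mem, smul_eq_mul, Ideal.mul_top] at this
  choose a ha using key
  have hrec : ∀ ε : ℕ → Bool, a ε = (if ε 0 then 1 else 0) + y * a (fun n => ε (n + 1)) := by
    intro ε
    rw [← sub_eq_zero]
    refine IsHausdorff.haus (I := maximalIdeal R) (M := R) inferInstance _ fun n => ?_
    rw [SModEq.sub_mem, smul_eq_mul, Ideal.mul_top, sub_zero]
    have h1 := Ideal.pow_le_pow_right (Nat.le_succ n) (ha ε (n + 1))
    have h2 := Ideal.mul_mem_left _ y (ha (fun n => ε (n + 1)) n)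
    rw [Finset.sum_range_succ'] at h1
    have := sub_mem h2 h1
    convert this using 1
    have : ∑ k ∈ Finset.range n, (if ε (k+1) = true then 1 else 0) * y ^ (k+1) =
        y * ∑ k ∈ Finset.range n, (if ε (k+1) = true then 1 else 0) * y ^ k := by
      rw [Finset.mul_sum]
      exact Finset.sum_congr rfl fun i _ => by ring
    rw [this]
    ring
  refine ⟨a, ?_⟩
  have base : ∀ (ε ε' : ℕ → Bool), ε 0 ≠ ε' 0 → IsUnit (a ε - a ε') := by
    intro ε ε' h
    rw [hrec ε, hrec ε']
    have hm : ∀ b : R, y * b ∈ maximalIdeal R := fun b => Ideal.mul_mem_right _ _ hy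
    by_contra hu
    have hu' : _ ∈ maximalIdeal R := hu
    have h3 := sub_mem (sub_mem hu' (hm (a fun n => ε (n+1)))) (neg_mem (hm (a fun n => ε' (n+1))))
    have h1 : (1 : R) ∉ maximalIdeal R :=
      (Ideal.ne_top_iff_one _).1 (maximalIdeal.isMaximal R).ne_top
    apply h1
    cases h0 : ε 0 <;> cases h0' : ε' 0 <;> rw [h0, h0'] at h h3
    · exact absurd rfl h
    · convert neg_mem h3 using 1; simp
    · convert h3 using 1; simp; ring
    · exact absurd rfl h
  have main : ∀ (n : ℕ) (ε ε' : ℕ → Bool), ε n ≠ ε' n → ∃ (n : ℕ) (u : R), IsUnit u ∧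
      a ε - a ε' = y ^ n * u := by
    intro n
    induction n with
    | zero =>
      intro ε ε' h
      exact ⟨0, a ε - a ε', base ε ε' h, by simp⟩
    | succ n ih =>
      intro ε ε' h
      by_cases h0 : ε 0 = ε' 0
      · obtain ⟨k, u, hu, hk⟩ := ih (fun n => ε (n+1)) (fun n => ε' (n+1)) h
        refine ⟨k + 1, u, hu, ?_⟩
        rw [hrec ε, hrec ε', h0, pow_succ', mul_assoc, ← hk]
        ring
      · exact ⟨0, a ε - a ε', base ε ε' h0, by simp⟩
  intro ε ε' h
  obtain ⟨n, hn⟩ := Function.ne_iff.1 h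
  exact main n ε ε' hn

lemma IsSubquotientOf.continuum_le {R : Type u} [CommRing R]
    {X : Type x} [AddCommGroup X] [Module R X]
    {M : Type v} [AddCommGroup M] [Module R M] (h : IsSubquotientOf R X M)
    (f : (ℕ → Bool) → Submodule R X) (hf : Function.Injective f) :
    Cardinal.continuum ≤ Cardinal.mk (Submodule R M) := by
  obtain ⟨N, P, ⟨e⟩⟩ := h
  let g : (ℕ → Bool) → Submodule R M := fun ε =>
    (((f ε).map e.toLinearMap).map P.subtype).comap N.mkQ
  have hg : Function.Injective g := by
    intro ε ε' h
    apply hf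
    have h1 := Submodule.comap_injective_of_surjective N.mkQ_surjective h
    have h2 := Submodule.map_injective_of_injective P.injective_subtype h1
    exact Submodule.map_injective_of_injective (f := e.toLinearMap) e.injective h2
  have := Cardinal.lift_mk_le_lift_mk_of_injective hg
  simpa using this

/-- two elements independent modulo `P` -/
lemma isSubquotientOf_of_pair {R : Type u} [CommRing R] (P : Ideal R)
    {M : Type v} [AddCommGroup M] [Module R M] (W : Submodule R M) (n x : M)
    (h : ∀ s t : R, s • n + t • x ∈ W ↔ s ∈ P ∧ t ∈ P) :
    IsSubquotientOf R ((R ⧸ P) × (R ⧸ P)) M := by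
  let φ : R × R →ₗ[R] M ⧸ W :=
    (LinearMap.toSpanSingleton R _ (W.mkQ n)).coprod (LinearMap.toSpanSingleton R _ (W.mkQ x))
  let ψ : R × R →ₗ[R] (R ⧸ P) × (R ⧸ P) := (Submodule.mkQ P).prodMap (Submodule.mkQ P)
  have hψ : Function.Surjective ψ :=
    Function.Surjective.prodMap (Submodule.mkQ_surjective P) (Submodule.mkQ_surjective P)
  have hker : φ.ker = ψ.ker := by
    ext ⟨s, t⟩
    have h1 : φ (s, t) = W.mkQ (s • n + t • x) := by simp [φ]
    have h2 : ψ (s, t) = (Submodule.mkQ P s, Submodule.mkQ P t) := rfl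
    rw [LinearMap.mem_ker, LinearMap.mem_ker, h1, h2, Prod.mk_eq_zero]
    simp only [Submodule.mkQ_apply, Submodule.Quotient.mk_eq_zero]
    exact h s t
  exact ⟨W, φ.range, ⟨(ψ.quotKerEquivOfSurjective hψ).symm.trans
    ((Submodule.quotEquivOfEq _ _ hker.symm).trans φ.quotKerEquivRange)⟩⟩

lemma isSubquotientOf_of_mem_associatedPrimes {R : Type u} [CommRing R] [IsNoetherianRing R]
    {M : Type v} [AddCommGroup M] [Module R M] (P : Ideal R)
    (x : M) (h : ∀ r : R, r • x = 0 ↔ r ∈ P) :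
    IsSubquotientOf R (R ⧸ P) M := by
  let φ : R →ₗ[R] M ⧸ (⊥ : Submodule R M) := LinearMap.toSpanSingleton R _ (Submodule.mkQ ⊥ x)
  have hker : φ.ker = P := by
    ext s
    rw [← h, LinearMap.mem_ker]
    have : φ s = Submodule.mkQ ⊥ (s • x) := by simp [φ]
    rw [this, Submodule.mkQ_apply, Submodule.Quotient.mk_eq_zero, Submodule.mem_bot]
  exact ⟨⊥, φ.range, ⟨(Submodule.quotEquivOfEq _ _ hker.symm).trans φ.quotKerEquivRange⟩⟩

/-- `(R/P)²` has continuum many submodules. -/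
lemma exists_inj_square (R : Type u) [CommRing R] [IsLocalRing R]
    [IsAdicComplete (maximalIdeal R) R] (P : Ideal R) [P.IsPrime] (hP : P ≠ maximalIdeal R) :
    ∃ f : (ℕ → Bool) → Submodule R ((R ⧸ P) × (R ⧸ P)), Function.Injective f := by
  obtain ⟨y, hy, hyP⟩ := Set.exists_of_ssubset
    (lt_of_le_of_ne (le_maximalIdeal (Ideal.IsPrime.ne_top ‹_›)) hP : P < maximalIdeal R)
  obtain ⟨a, ha⟩ := exists_series R y hy
  refine ⟨fun ε => Submodule.span R {((1 : R ⧸ P), Ideal.Quotient.mk P (a ε))}, ?_⟩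
  intro ε ε' h
  by_contra hne
  obtain ⟨n, u, hu, hn⟩ := ha ε ε' hne
  have h1 : ((1 : R ⧸ P), Ideal.Quotient.mk P (a ε)) ∈
      Submodule.span R {((1 : R ⧸ P), Ideal.Quotient.mk P (a ε'))} := by
    have h' := h.le
    exact h' (Submodule.mem_span_singleton_self _)
  obtain ⟨r, hr⟩ := Submodule.mem_span_singleton.1 h1
  have hr1 : Ideal.Quotient.mk P r = 1 := by
    have := congrArg Prod.fst hr
    simpa [Algebra.smul_def] using this
  have hr2 : Ideal.Quotient.mk P r * Ideal.Quotient.mk P (a ε') = Ideal.Quotient.mk P (a ε) := by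
    have := congrArg Prod.snd hr
    simpa [Algebra.smul_def] using this
  rw [hr1, one_mul] at hr2
  have h3 : a ε - a ε' ∈ P := Ideal.Quotient.eq.1 hr2.symm
  rw [hn] at h3
  rcases Ideal.IsPrime.mem_or_mem ‹_› h3 with h4 | h4
  · exact hyP (Ideal.IsPrime.mem_of_pow_mem ‹_› _ h4)
  · exact Ideal.IsPrime.ne_top ‹P.IsPrime› (Ideal.eq_top_of_isUnit_mem _ h4 hu)

/-- If `dim R/P ≥ 2`, then `R/P` has continuum many submodules. -/
lemma exists_inj_dim_two (R : Type u) [CommRing R] [IsLocalRing R] [IsNoetherianRing R]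
    [IsAdicComplete (maximalIdeal R) R] (P Q₁ Q₂ : Ideal R) [P.IsPrime] [Q₁.IsPrime] [Q₂.IsPrime]
    (h₁ : P < Q₁) (h₂ : Q₁ < Q₂) :
    ∃ f : (ℕ → Bool) → Submodule R (R ⧸ P), Function.Injective f := by
  let π := Ideal.Quotient.mk P
  have hπ : Function.Surjective π := Ideal.Quotient.mk_surjective
  have hk : RingHom.ker π = P := Ideal.mk_ker
  have hp1 : (Q₁.map π).IsPrime := Ideal.map_isPrime_of_surjective hπ (by rw [hk]; exact h₁.le)
  have hp2 : (Q₂.map π).IsPrime :=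
    Ideal.map_isPrime_of_surjective hπ (by rw [hk]; exact (h₁.trans h₂).le)
  have hc : ∀ Q : Ideal R, P ≤ Q → (Q.map π).comap π = Q := by
    intro Q hQ
    rw [Ideal.comap_map_of_surjective π hπ, ← RingHom.ker_eq_comap_bot, hk, sup_eq_left.2 hQ]
  have hb1 : ⊥ < Q₁.map π := by
    refine bot_lt_iff_ne_bot.2 fun h => h₁.ne ?_
    rw [← hc Q₁ h₁.le, h, ← RingHom.ker_eq_comap_bot, hk]
  have hb2 : Q₁.map π < Q₂.map π := by
    refine lt_of_le_of_ne (Ideal.map_mono h₂.le) fun h => h₂.ne ?_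
    rw [← hc Q₁ h₁.le, h, hc Q₂ (h₁.trans h₂).le]
  obtain ⟨x, hx, y, hy, hxy⟩ := exists_pair_of_chain hb1 hb2
  obtain ⟨y, rfl⟩ := hπ y
  have hy2 : y ∈ Q₂ := by rw [← hc Q₂ (h₁.trans h₂).le]; exact hy
  obtain ⟨a, ha⟩ := exists_series R y (le_maximalIdeal (Ideal.IsPrime.ne_top ‹_›) hy2)
  refine ⟨fun ε => Submodule.restrictScalars R (Ideal.span {x + π (a ε) * π y}), ?_⟩
  intro ε ε' h
  by_contra hne
  obtain ⟨n, u, hu, hn⟩ := ha ε ε' hne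
  have h := Submodule.restrictScalars_injective _ _ _ h
  have e1 : x + π (a ε) * π y ∈ Ideal.span {x + π (a ε) * π y} := Ideal.mem_span_singleton_self _
  have e2 : x + π (a ε') * π y ∈ Ideal.span {x + π (a ε) * π y} := by
    rw [h]; exact Ideal.mem_span_singleton_self _
  have e3 : π y ∈ (Ideal.span {x + π (a ε) * π y}).radical := by
    refine ⟨n + 1, ?_⟩
    have e4 := sub_mem e1 e2
    have e5 : x + π (a ε) * π y - (x + π (a ε') * π y) = π u * (π y ^ (n + 1)) := by
      have : π (a ε) - π (a ε') = π y ^ n * π u := by rw [← map_sub, hn]; simp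
      linear_combination (π y) * this
    rw [e5] at e4
    exact (Ideal.unit_mul_mem_iff_mem _ (hu.map π)).1 e4
  refine hxy (x + π (a ε) * π y) (add_mem hx (Ideal.mul_mem_left _ _ hy)) ?_ e3
  have := sub_mem (Ideal.le_radical e1) (Ideal.mul_mem_left _ (π (a ε)) e3)
  simpa using this

lemma countable_of_pow_smul (R : Type u) [CommRing R] [IsLocalRing R] [IsNoetherianRing R]
    [Countable (ResidueField R)] (t : ℕ) : ∀ (X : Type v) [AddCommGroup X] [Module R X]
    [Module.Finite R X], (maximalIdeal R ^ t • (⊤ : Submodule R X) = ⊥) → Countable X := by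
  induction t with
  | zero =>
    intro X _ _ _ h
    rw [pow_zero, Ideal.one_eq_top, Submodule.top_smul] at h
    have : Subsingleton X := ⟨fun a b => by
      have ha : a ∈ (⊥ : Submodule R X) := h ▸ Submodule.mem_top
      have hb : b ∈ (⊥ : Submodule R X) := h ▸ Submodule.mem_top
      rw [(Submodule.mem_bot R).1 ha, (Submodule.mem_bot R).1 hb]⟩
    infer_instance
  | succ t ih =>
    intro X _ _ _ h
    let K : Submodule R X := maximalIdeal R • ⊤
    have hK : Countable K := by
      apply ih
      apply Submodule.map_injective_of_injective K.injective_subtype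
      rw [Submodule.map_smul'', Submodule.map_top, Submodule.range_subtype, Submodule.map_bot,
        ← h, pow_succ, mul_smul]
    have hQ : Countable (X ⧸ K) := by
      obtain ⟨n, f, hf⟩ := Module.Finite.exists_fin' R X
      let s : ResidueField R → R := Function.surjInv residue_surjective
      have hs : ∀ r, residue R (s r) = r := Function.surjInv_eq residue_surjective
      let g : (Fin n → ResidueField R) → X ⧸ K := fun v => K.mkQ (f (fun i => s (v i)))
      refine Function.Surjective.countable (f := g) fun q => ?_
      obtain ⟨x, rfl⟩ := K.mkQ_surjective q
      obtain ⟨w, rfl⟩ := hf x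
      refine ⟨fun i => residue R (w i), ?_⟩
      change K.mkQ _ = K.mkQ _
      rw [← sub_eq_zero, ← map_sub, ← map_sub, Submodule.mkQ_apply,
        Submodule.Quotient.mk_eq_zero, pi_eq_sum_univ (_ - w), map_sum]
      refine Submodule.sum_mem _ fun i _ => ?_
      rw [map_smul]
      refine Submodule.smul_mem_smul ?_ Submodule.mem_top
      rw [← residue_eq_zero_iff]
      simp [hs]
    let g : X → (X ⧸ K) × K := fun x => (K.mkQ x,
      ⟨x - Function.surjInv K.mkQ_surjective (K.mkQ x), by
        rw [← Submodule.Quotient.mk_eq_zero, ← Submodule.mkQ_apply, map_sub,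
          Function.surjInv_eq K.mkQ_surjective, sub_self]⟩)
    refine Function.Injective.countable (f := g) fun x y hxy => ?_
    have h1 : K.mkQ x = K.mkQ y := congrArg Prod.fst hxy
    have h2 := congrArg Subtype.val (congrArg Prod.snd hxy)
    simp only [g, h1] at h2
    exact sub_left_injective h2

lemma countable_quotient_pow (R : Type u) [CommRing R] [IsLocalRing R] [IsNoetherianRing R]
    [Countable (ResidueField R)] (t : ℕ) (X : Type v) [AddCommGroup X] [Module R X]
    [Module.Finite R X] : Countable (X ⧸ (maximalIdeal R ^ t • (⊤ : Submodule R X))) := by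
  refine countable_of_pow_smul R t _ ?_
  have : (⊤ : Submodule R (X ⧸ (maximalIdeal R ^ t • (⊤ : Submodule R X)))) =
      (⊤ : Submodule R X).map (Submodule.mkQ _) := by
    rw [Submodule.map_top, Submodule.range_mkQ]
  rw [this, ← Submodule.map_smul'', Submodule.mkQ_map_self]

lemma card_submodule_le (R : Type u) [CommRing R] [IsLocalRing R] [IsNoetherianRing R]
    [Countable (ResidueField R)] (X : Type v) [AddCommGroup X] [Module R X]
    [Module.Finite R X] : Cardinal.mk (Submodule R X) ≤ Cardinal.continuum := by
  have hX : Cardinal.mk X ≤ Cardinal.continuum := by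
    have := IsHausdorff.of_isLocalRing (I := maximalIdeal R) (M := X)
      (maximalIdeal.isMaximal R).ne_top
    have hc := fun t => countable_quotient_pow R t X
    choose e he using fun t => (exists_injective_nat
      (X ⧸ (maximalIdeal R ^ t • (⊤ : Submodule R X))))
    let g : X → (ℕ → ℕ) := fun x t => e t (Submodule.mkQ _ x)
    have hg : Function.Injective g := by
      intro x y h
      rw [← sub_eq_zero]
      refine IsHausdorff.haus this _ fun n => ?_
      rw [SModEq.sub_mem, sub_zero, ← Submodule.Quotient.mk_eq_zero, ← Submodule.mkQ_apply,
        map_sub, sub_eq_zero]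
      exact he n (congrFun h n)
    have := Cardinal.lift_mk_le_lift_mk_of_injective hg
    simpa using this
  have hs : Function.Surjective (fun s : Finset X => Submodule.span R (s : Set X)) := fun N =>
    (IsNoetherian.noetherian N)
  refine (Cardinal.mk_le_of_surjective hs).trans ?_
  classical
  have := Cardinal.mk_le_of_surjective (List.toFinset_surjective (α := X))
  refine this.trans ((Cardinal.mk_list_le_max X).trans (max_le Cardinal.aleph0_le_continuum hX))

/-- The key step of the noetherian induction. -/
lemma countable_step (R : Type u) [CommRing R] [IsLocalRing R] [IsNoetherianRing R]
    [Countable (ResidueField R)] (X : Type v) [AddCommGroup X] [Module R X]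
    [Module.Finite R X]
    (h1 : ∀ P : Ideal R, P.IsPrime → Module.annihilator R X ≤ P → ∀ J, P < J →
      ∃ t : ℕ, maximalIdeal R ^ t ≤ J)
    (h2 : ∀ P : Ideal R, P.IsPrime → Module.annihilator R X ≤ P → P ≠ maximalIdeal R →
      ¬ IsSubquotientOf R ((R ⧸ P) × (R ⧸ P)) X)
    (h3 : ∀ K : Submodule R X, K ≠ ⊥ → (Set.Ici K).Countable) :
    Countable (Submodule R X) := by
  rcases subsingleton_or_nontrivial X with hX | hX
  · infer_instance
  obtain ⟨P, hPa⟩ := associatedPrimes.nonempty R X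
  obtain ⟨hP, x, hx⟩ := isAssociatedPrime_iff.1 hPa
  have hx : ∀ r : R, r • x = 0 ↔ r ∈ P := by
    intro r
    rw [hx, Submodule.mem_colon_singleton, Submodule.mem_bot]
  have hann : Module.annihilator R X ≤ P := by
    intro r hr
    exact (hx r).1 (Module.mem_annihilator.1 hr x)
  let K := Submodule.span R {x}
  have hxK : x ∈ K := Submodule.mem_span_singleton_self x
  have hK : K ≠ ⊥ := by
    intro h
    have : x ∈ (⊥ : Submodule R X) := h ▸ hxK
    apply hP.ne_top
    rw [Ideal.eq_top_iff_one, ← hx, one_smul]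
    exact (Submodule.mem_bot R).1 this
  -- submodules meeting `K`
  have c1 : {N : Submodule R X | N ⊓ K ≠ ⊥}.Countable := by
    have hcov : {N : Submodule R X | N ⊓ K ≠ ⊥} ⊆
        ⋃ t ∈ {t : ℕ | maximalIdeal R ^ t • K ≠ ⊥}, Set.Ici (maximalIdeal R ^ t • K) := by
      intro N hN
      obtain ⟨n, hn, hn0⟩ := Submodule.exists_mem_ne_zero_of_ne_bot hN
      obtain ⟨r, rfl⟩ := Submodule.mem_span_singleton.1 hn.2
      have hlt : P < Submodule.colon N {x} := by
        refine lt_of_le_of_ne (fun s hs => ?_) fun h => hn0 ((hx r).2 ?_)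
        · rw [Submodule.mem_colon_singleton, (hx s).2 hs]
          exact zero_mem _
        · rw [h, Submodule.mem_colon_singleton]
          exact hn.1
      obtain ⟨t, ht, htP⟩ : ∃ t : ℕ, maximalIdeal R ^ t ≤ Submodule.colon N {x} ∧
          ¬ maximalIdeal R ^ t ≤ P := by
        by_cases hm : P = maximalIdeal R
        · refine ⟨0, ?_, ?_⟩
          · rw [pow_zero, Ideal.one_eq_top]
            rw [hm] at hlt
            exact ((maximalIdeal.isMaximal R).1.2 _ hlt).ge
          · rw [pow_zero, Ideal.one_eq_top, top_le_iff]
            exact hP.ne_top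
        · obtain ⟨t, ht⟩ := h1 P hP hann _ hlt
          refine ⟨t, ht, fun h => hm ?_⟩
          exact ((maximalIdeal.isMaximal R).eq_of_le hP.ne_top (hP.le_of_pow_le h)).symm
      simp only [Set.mem_iUnion]
      refine ⟨t, ?_, ?_⟩
      · intro h
        apply htP
        intro s hs
        rw [← hx, ← Submodule.mem_bot R, ← h]
        exact Submodule.smul_mem_smul hs hxK
      · change _ ≤ N
        rw [Submodule.smul_le]
        intro s hs k hk
        obtain ⟨r', rfl⟩ := Submodule.mem_span_singleton.1 hk
        rw [smul_comm]
        exact N.smul_mem _ (Submodule.mem_colon_singleton.1 (ht hs))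
    exact (Set.Countable.biUnion (Set.to_countable _)
      fun t (ht : maximalIdeal R ^ t • K ≠ ⊥) => h3 _ ht).mono hcov
  -- submodules not meeting `K`
  have c2 : {N : Submodule R X | N ⊓ K = ⊥}.Countable := by
    have hcov : {N : Submodule R X | N ⊓ K = ⊥} ⊆
        ⋃ L ∈ Set.Ici K, {N : Submodule R X | N ⊔ K = L ∧ N ⊓ K = ⊥} := by
      intro N hN
      simp only [Set.mem_iUnion]
      exact ⟨N ⊔ K, Set.mem_Ici.2 le_sup_right, rfl, hN⟩
    refine ((h3 K hK).biUnion fun L hL => ?_).mono hcov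
    by_cases hm : P = maximalIdeal R
    · have hKc : Countable K := by
        refine countable_of_pow_smul R 1 K ?_
        apply Submodule.map_injective_of_injective K.injective_subtype
        rw [Submodule.map_smul'', Submodule.map_top, Submodule.range_subtype, Submodule.map_bot,
          pow_one, ← hm, eq_bot_iff, Submodule.smul_le]
        intro s hs k hk
        obtain ⟨r', rfl⟩ := Submodule.mem_span_singleton.1 hk
        rw [smul_comm, (hx s).2 hs, smul_zero]
        exact zero_mem _
      obtain ⟨S, hS⟩ : L.FG := IsNoetherian.noetherian L
      have hdec : ∀ N : {N : Submodule R X | N ⊔ K = L ∧ N ⊓ K = ⊥}, ∀ g : S,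
          ∃ k : K, (g : X) - k ∈ N.1 := by
        rintro ⟨N, hN, -⟩ ⟨g, hg⟩
        have : g ∈ N ⊔ K := by
          rw [hN, ← hS]
          exact Submodule.subset_span hg
        obtain ⟨n, hn, k, hk, hnk⟩ := Submodule.mem_sup.1 this
        refine ⟨⟨k, hk⟩, ?_⟩
        change g - k ∈ N
        rw [← hnk]
        simpa using hn
      choose F hF using hdec
      rw [← Set.countable_coe_iff]
      refine Function.Injective.countable (f := F) fun N N' h => ?_
      have hle : L ≤ (N.1 ⊓ N'.1) ⊔ K := by
        refine hS.symm.le.trans ?_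
        rw [Submodule.span_le]
        intro g hg
        have a1 := hF N ⟨g, hg⟩
        have a2 := hF N' ⟨g, hg⟩
        rw [← h] at a2
        have := Submodule.add_mem_sup (Submodule.mem_inf.2 ⟨a1, a2⟩) (F N ⟨g, hg⟩).2
        simpa using this
      have b1 : N.1 ⊓ N'.1 = N.1 := eq_of_le_of_inf_le_of_sup_le (z := K) inf_le_left
        (by rw [N.2.2]; exact bot_le) (by rw [N.2.1]; exact hle)
      have b2 : N.1 ⊓ N'.1 = N'.1 := eq_of_le_of_inf_le_of_sup_le (z := K) inf_le_right
        (by rw [N'.2.2]; exact bot_le) (by rw [N'.2.1]; exact hle)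
      exact Subtype.ext (b1.symm.trans b2)
    · refine Set.Subsingleton.countable fun N hN N' hN' => ?_
      by_contra hne
      have hnot : ¬ N ≤ N' := fun hle => hne <|
        eq_of_le_of_inf_le_of_sup_le (z := K) hle (by rw [hN'.2]; exact bot_le)
          (by rw [hN'.1, hN.1])
      obtain ⟨n, hn, hn'⟩ := Set.not_subset.1 hnot
      have : n ∈ N' ⊔ K := by
        rw [hN'.1, ← hN.1]
        exact Submodule.mem_sup_left hn
      obtain ⟨n', hnn', k, hk, hsum⟩ := Submodule.mem_sup.1 this
      obtain ⟨r, rfl⟩ := Submodule.mem_span_singleton.1 hk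
      have hr : r ∉ P := by
        intro hr
        rw [(hx r).2 hr, add_zero] at hsum
        exact hn' (hsum ▸ hnn')
      have hbot : ∀ {N : Submodule R X}, N ⊓ K = ⊥ → ∀ s : R, s • x ∈ N → s ∈ P := by
        intro N hN s hs
        rw [← hx, ← Submodule.mem_bot R, ← hN]
        exact ⟨hs, K.smul_mem s hxK⟩
      refine h2 P hP hann hm (isSubquotientOf_of_pair P (N ⊓ N') n x fun s t => ⟨?_, ?_⟩)
      · rintro ⟨ha, hb⟩
        have ht : t ∈ P := hbot hN.2 t <| by
          have := N.sub_mem ha (N.smul_mem s hn)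
          simpa using this
        refine ⟨?_, ht⟩
        rw [(hx t).2 ht, add_zero, ← hsum, smul_add] at hb
        have h5 : s • r • x ∈ N' := by
          have := N'.sub_mem hb (N'.smul_mem s hnn')
          simpa using this
        rw [smul_smul] at h5
        exact (hP.mem_or_mem (hbot hN'.2 _ h5)).resolve_right hr
      · rintro ⟨hs, ht⟩
        rw [(hx t).2 ht, add_zero]
        refine ⟨N.smul_mem s hn, ?_⟩
        change s • n ∈ N'
        rw [← hsum, smul_add, smul_comm s r x, (hx s).2 hs, smul_zero, add_zero]
        exact N'.smul_mem s hnn'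
  rw [← Set.countable_univ_iff]
  refine (c1.union c2).mono fun N _ => ?_
  by_cases h : N ⊓ K = ⊥
  · exact Or.inr h
  · exact Or.inl h

lemma IsSubquotientOf.of_quotient {R : Type u} [CommRing R]
    {X : Type x} [AddCommGroup X] [Module R X]
    {M : Type v} [AddCommGroup M] [Module R M] {K : Submodule R M}
    (h : IsSubquotientOf R X (M ⧸ K)) : IsSubquotientOf R X M := by
  obtain ⟨N, P, ⟨e⟩⟩ := h
  let φ : M →ₗ[R] (M ⧸ K) ⧸ N := N.mkQ.comp K.mkQ
  have hφ : Function.Surjective φ := N.mkQ_surjective.comp K.mkQ_surjective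
  let q := (φ.quotKerEquivOfSurjective hφ).symm
  exact ⟨φ.ker, P.map q.toLinearMap, ⟨e.trans (q.submoduleMap P)⟩⟩

lemma countable_main (R : Type u) [CommRing R] [IsLocalRing R] [IsNoetherianRing R]
    [Countable (ResidueField R)] (M : Type v) [AddCommGroup M] [Module R M]
    [Module.Finite R M]
    (h1 : ∀ P : Ideal R, P.IsPrime → Module.annihilator R M ≤ P → ∀ J, P < J →
      ∃ t : ℕ, maximalIdeal R ^ t ≤ J)
    (h2 : ∀ P : Ideal R, P.IsPrime → Module.annihilator R M ≤ P → P ≠ maximalIdeal R →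
      ¬ IsSubquotientOf R ((R ⧸ P) × (R ⧸ P)) M) :
    Countable (Submodule R M) := by
  have key : ∀ K : Submodule R M, (Set.Ici K).Countable := by
    intro K
    induction K using IsNoetherian.induction with
    | _ K ih =>
    have hann : Module.annihilator R M ≤ Module.annihilator R (M ⧸ K) := by
      intro r hr
      rw [Module.mem_annihilator] at hr ⊢
      intro q
      obtain ⟨m, rfl⟩ := K.mkQ_surjective q
      rw [← map_smul, hr, map_zero]
    have hc : Countable (Submodule R (M ⧸ K)) := by
      refine countable_step R (M ⧸ K) (fun P hP hle => h1 P hP (hann.trans hle))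
        (fun P hP hle hm h => h2 P hP (hann.trans hle) hm h.of_quotient) fun L hL => ?_
      have hlt : K < L.comap K.mkQ := by
        refine lt_of_le_of_ne (Submodule.le_comap_mkQ K L) fun h => hL ?_
        rw [← Submodule.map_comap_eq_of_surjective K.mkQ_surjective L, ← h,
          Submodule.mkQ_map_self]
      refine Set.MapsTo.countable_of_injOn (f := Submodule.comap K.mkQ) ?_
        (Submodule.comap_injective_of_surjective K.mkQ_surjective).injOn (ih _ hlt)
      intro N hN
      exact Submodule.comap_mono hN
    refine (Set.countable_range (fun N : Submodule R (M ⧸ K) => N.comap K.mkQ)).mono ?_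
    intro N hN
    refine ⟨N.map K.mkQ, ?_⟩
    change Submodule.comap _ _ = _
    rw [Submodule.comap_map_mkQ, sup_eq_right]
    exact hN
  rw [← Set.countable_univ_iff, ← Set.Ici_bot]
  exact key ⊥

theorem countable_submodules_iff_complete_local
    (R : Type u) [CommRing R] [IsNoetherianRing R] [IsLocalRing R]
    [IsAdicComplete (IsLocalRing.maximalIdeal R) R]
    [Countable (IsLocalRing.ResidueField R)]
    (M : Type v) [AddCommGroup M] [Module R M] [Module.Finite R M] :
    (Countable (Submodule R M) ↔
      (ringKrullDim (R ⧸ Module.annihilator R M) ≤ 1 ∧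
        ∀ P : Ideal R, P.IsPrime → ringKrullDim (R ⧸ P) = 1 →
          ¬ IsSubquotientOf R ((R ⧸ P) × (R ⧸ P)) M)) ∧
    (¬ (ringKrullDim (R ⧸ Module.annihilator R M) ≤ 1 ∧
        ∀ P : Ideal R, P.IsPrime → ringKrullDim (R ⧸ P) = 1 →
          ¬ IsSubquotientOf R ((R ⧸ P) × (R ⧸ P)) M) →
      Cardinal.mk (Submodule R M) = Cardinal.continuum) := by
  have hno : ¬ (ringKrullDim (R ⧸ Module.annihilator R M) ≤ 1 ∧
        ∀ P : Ideal R, P.IsPrime → ringKrullDim (R ⧸ P) = 1 →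
          ¬ IsSubquotientOf R ((R ⧸ P) × (R ⧸ P)) M) →
      Cardinal.mk (Submodule R M) = Cardinal.continuum := by
    intro h
    refine le_antisymm (card_submodule_le R M) ?_
    rw [not_and_or] at h
    rcases h with h | h
    · have h2 : ((2 : ℕ) : WithBot ℕ∞) ≤ ringKrullDim (R ⧸ Module.annihilator R M) := by
        have := ENat.WithBot.add_one_le_iff (n := 1) |>.2 (by exact_mod_cast not_le.1 h)
        exact_mod_cast this
      rw [ringKrullDim_quotient, Order.le_krullDim_iff] at h2
      obtain ⟨l, hl⟩ := h2
      let i0 : Fin (l.length + 1) := ⟨0, by omega⟩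
      let i1 : Fin (l.length + 1) := ⟨1, by omega⟩
      let i2 : Fin (l.length + 1) := ⟨2, by omega⟩
      have l1 : l i0 < l i1 := l.strictMono (Fin.mk_lt_mk.2 (by omega))
      have l2 : l i1 < l i2 := l.strictMono (Fin.mk_lt_mk.2 (by omega))
      have p0 := (l i0).1.2
      have p1 := (l i1).1.2
      have p2 := (l i2).1.2
      obtain ⟨P, hP, hle⟩ := Ideal.exists_minimalPrimes_le (I := Module.annihilator R M)
        (J := (l i0).1.asIdeal) (by exact (l i0).2)
      have hPp := hP.1.1
      obtain ⟨_, x, hx⟩ := isAssociatedPrime_iff.1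
        (Module.associatedPrimes.minimalPrimes_annihilator_subset_associatedPrimes R M hP)
      have hx : ∀ r : R, r • x = 0 ↔ r ∈ P := by
        intro r
        rw [hx, Submodule.mem_colon_singleton, Submodule.mem_bot]
      obtain ⟨f, hf⟩ := exists_inj_dim_two R P _ _ (lt_of_le_of_lt hle l1) l2
      exact (isSubquotientOf_of_mem_associatedPrimes P x hx).continuum_le f hf
    · push Not at h
      obtain ⟨P, hP, hdim, hs⟩ := h
      have hne : P ≠ maximalIdeal R := by
        rintro rfl
        have := ringKrullDim_eq_zero_of_field (ResidueField R)
        change ringKrullDim (R ⧸ maximalIdeal R) = 0 at this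
        rw [this] at hdim
        exact zero_ne_one hdim
      obtain ⟨f, hf⟩ := exists_inj_square R P hne
      exact hs.continuum_le f hf
  refine ⟨⟨fun hc => ?_, ?_⟩, hno⟩
  · by_contra h
    have := hno h
    have h2 := Cardinal.mk_le_aleph0_iff.2 hc
    rw [this] at h2
    exact absurd h2 (not_le.2 Cardinal.aleph0_lt_continuum)
  · rintro ⟨hd, hs⟩
    refine countable_main R M ?_ ?_
    · intro P hP hle J hJ
      refine Ideal.exists_pow_le_of_le_radical_of_fg ?_ (IsNoetherian.noetherian _)
      rw [Ideal.radical_eq_sInf]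
      refine le_sInf fun Q hQ => ?_
      have hQp := hQ.2
      by_contra hcon
      have hQm : Q < maximalIdeal R :=
        lt_of_le_not_ge (le_maximalIdeal hQp.ne_top) hcon
      rw [ringKrullDim_quotient] at hd
      have hPQ : P < Q := hJ.trans_le hQ.1
      let a0 : PrimeSpectrum.zeroLocus (Module.annihilator R M : Set R) := ⟨⟨P, hP⟩, hle⟩
      let a1 : PrimeSpectrum.zeroLocus (Module.annihilator R M : Set R) :=
        ⟨⟨Q, hQp⟩, hle.trans hPQ.le⟩
      let a2 : PrimeSpectrum.zeroLocus (Module.annihilator R M : Set R) :=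
        ⟨⟨maximalIdeal R, inferInstance⟩, hle.trans (hPQ.trans hQm).le⟩
      have h01 : a0 < a1 := hPQ
      have h12 : a1 < a2 := hQm
      have h3 : ((2 : ℕ) : WithBot ℕ∞) ≤ Order.krullDim
          (PrimeSpectrum.zeroLocus (Module.annihilator R M : Set R)) := by
        rw [Order.le_krullDim_iff]
        exact ⟨LTSeries.mk 2 ![a0, a1, a2] (by
          rw [Fin.strictMono_iff_lt_succ]
          intro i
          fin_cases i
          · exact h01
          · exact h12), rfl⟩
      have h4 := h3.trans hd
      exact absurd h4 (by decide)
    · intro P hP hle hne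
      refine hs P hP (le_antisymm ?_ ?_)
      · exact (ringKrullDim_le_of_surjective (Ideal.Quotient.factor hle)
          (Ideal.Quotient.factor_surjective hle)).trans hd
      · rw [ringKrullDim_quotient, Order.one_le_krullDim_iff]
        refine ⟨⟨⟨P, hP⟩, le_refl P⟩, ⟨⟨maximalIdeal R, inferInstance⟩, le_maximalIdeal hP.ne_top⟩, ?_⟩
        have hlt : P < maximalIdeal R := lt_of_le_of_ne (le_maximalIdeal hP.ne_top) hne
        exact hlt
end

section
/- Let A be a noetherian commutative ring and M an A-module. The following are equivalent: (1) M is minimax; (2) no subquotient of M contains an infinite independent family of nonzero simple submodules (i.e. M does not admit an infinite direct sum of simple modules as a subquotient); (3) no subquotient of M contains an infinite independent family of nonzero submodules (i.e. M does not admit an infinite direct sum of nonzero modules as a subquotient); (4) the poset of submodules of M ordered by inclusion contains no subposet isomorphic to the poset of all subsets of ℤ ordered by inclusion; (5) there is no chain of submodules of M order-isomorphic to (ℝ, ≤); (6) there is no chain of submodules of M order-isomorphic to (ℚ, ≤); (7) there exists a natural number n such that no strictly increasing family of submodules of M is indexed by the ordinal ω^n. -/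
namespace MinimaxAux

section easy
variable {A : Type u} [CommRing A] {M : Type v} [AddCommGroup M] [Module A M]

lemma four_three (h : ¬ Nonempty (Set ℤ ↪o Submodule A M)) :
    ¬ ∃ (N : Submodule A M) (ι : Type) (_ : Infinite ι)
            (f : ι → Submodule A (M ⧸ N)),
            iSupIndep f ∧ ∀ i, f i ≠ ⊥ := by
  rintro ⟨N, ι, _, f, hf, hne⟩
  apply h
  let e : ℤ ↪ ι := (Denumerable.eqv ℤ).toEmbedding.trans (Infinite.natEmbedding ι)
  have hg : iSupIndep (fun z => f (e z)) := hf.comp e.injective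
  let F : Set ℤ ↪o Submodule A (M ⧸ N) := OrderEmbedding.ofMapLEIff
    (fun s => ⨆ z ∈ s, f (e z)) (by
      intro s t
      constructor
      · intro hst z hz
        by_contra hzt
        have h1 : Disjoint (f (e z)) (⨆ z ∈ t, f (e z)) := hg.disjoint_biSup hzt
        have h2 : f (e z) ≤ ⨆ z ∈ t, f (e z) :=
          le_trans (le_iSup₂_of_le z hz le_rfl) hst
        exact hne _ (h1.eq_bot_of_le h2)
      · intro hst
        exact biSup_mono hst)
  exact ⟨F.trans (Submodule.comapMkQOrderEmbedding N)⟩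

lemma five_four (h : ¬ ∃ f : ℝ → Submodule A M, StrictMono f) :
    ¬ Nonempty (Set ℤ ↪o Submodule A M) := by
  rintro ⟨F⟩
  apply h
  let e : ℤ ≃ ℚ := (Denumerable.eqv ℤ).trans (Denumerable.eqv ℚ).symm
  refine ⟨fun r => F {z | ((e z : ℚ) : ℝ) < r}, F.strictMono.comp ?_⟩
  intro r s hrs
  obtain ⟨q, hq1, hq2⟩ := exists_rat_btwn hrs
  refine ⟨fun z hz => lt_trans hz hrs, fun hh => ?_⟩
  have : e.symm q ∈ {z | ((e z : ℚ) : ℝ) < s} := by simpa using hq2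
  have := hh this
  simp at this
  exact lt_asymm hq1 this

lemma six_five (h : ¬ ∃ f : ℚ → Submodule A M, StrictMono f) :
    ¬ ∃ f : ℝ → Submodule A M, StrictMono f := by
  rintro ⟨f, hf⟩
  exact h ⟨fun q => f q, hf.comp Rat.cast_strictMono⟩

lemma seven_six (h : ∃ n : ℕ, ¬ ∃ f : Ordinal.{w} → Submodule A M,
          StrictMonoOn f (Set.Iio (Ordinal.omega0 ^ n))) :
    ¬ ∃ f : ℚ → Submodule A M, StrictMono f := by
  rintro ⟨f, hf⟩
  obtain ⟨n, hn⟩ := h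
  apply hn
  have hc : Countable (Set.Iio ((Ordinal.omega0 : Ordinal.{w}) ^ n)) := by
    rw [← Cardinal.mk_le_aleph0_iff, Cardinal.mk_Iio_ordinal, Cardinal.lift_le_aleph0]
    have := Ordinal.card_opow_le Ordinal.omega0.{w} (n : Ordinal.{w})
    rw [Ordinal.opow_natCast] at this
    refine this.trans ?_
    simp [Cardinal.natCast_le_aleph0]
  obtain ⟨g⟩ := Order.embedding_from_countable_to_dense
    (α := Set.Iio ((Ordinal.omega0 : Ordinal.{w}) ^ n)) (β := ℚ)
  classical
  refine ⟨fun a => if ha : a < Ordinal.omega0 ^ n then f (g ⟨a, ha⟩) else ⊥, ?_⟩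
  intro a ha b hb hab
  have ha' : a < Ordinal.omega0 ^ n := ha
  have hb' : b < Ordinal.omega0 ^ n := hb
  simp only [ha', hb', dif_pos]
  exact hf (g.strictMono hab)

end easy

section ordinals
open Ordinal

lemma pigeon (k : ℕ) (r : ℕ) : ∀ c : Ordinal.{w} → Fin k,
    ∃ (i : Fin k) (φ : Ordinal.{w} → Ordinal.{w}), StrictMonoOn φ (Set.Iio (ω ^ r)) ∧
      ∀ a < ω ^ r, φ a < ω ^ r ∧ c (φ a) = i := by
  induction r with
  | zero =>
    intro c
    refine ⟨c 0, id, strictMonoOn_id, fun a ha => ?_⟩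
    rw [pow_zero, Order.lt_one_iff] at ha
    subst ha
    simp
  | succ r ih =>
    intro c
    have hpos : (ω : Ordinal.{w}) ^ r ≠ 0 := pow_ne_zero _ omega0_ne_zero
    choose i φ hφ hφ2 using fun m : ℕ => ih (fun a => c (ω ^ r * m + a))
    obtain ⟨j, hj⟩ := Finite.exists_infinite_fiber i
    have hj' : (i ⁻¹' {j}).Infinite := Set.infinite_coe_iff.mp hj
    let ψ := Nat.nth (fun m => m ∈ i ⁻¹' {j})
    have hψ : StrictMono ψ := Nat.nth_strictMono hj'
    have hψj : ∀ m, i (ψ m) = j := fun m => Nat.nth_mem_of_infinite hj' m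
    have key : ∀ a < (ω : Ordinal.{w}) ^ (r+1), ∃ m : ℕ, a / ω ^ r = m := by
      intro a ha
      apply lt_omega0.mp
      rw [← lt_mul_iff_div_lt hpos]
      rwa [← pow_succ]
    have hm : ∀ a : Ordinal.{w}, a % ω ^ r < ω ^ r := fun a => mod_lt a hpos
    choose! q hq using key
    refine ⟨j, fun a => ω ^ r * (ψ (q a) : ℕ) + φ (ψ (q a)) (a % ω ^ r), ?_, ?_⟩
    · intro a ha b hb hab
      have hqq : q a ≤ q b := by
        have : a / ω ^ r ≤ b / ω ^ r := div_le_left hab.le _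
        rw [hq a ha, hq b hb] at this
        exact_mod_cast this
      rcases hqq.lt_or_eq with hlt | heq
      · calc ω ^ r * (ψ (q a) : ℕ) + φ (ψ (q a)) (a % ω ^ r)
            < ω ^ r * (ψ (q a) : ℕ) + ω ^ r := by
              gcongr
              exact (hφ2 _ _ (hm a)).1
          _ = ω ^ r * ((ψ (q a) + 1 : ℕ) : Ordinal) := by
              push_cast; rw [mul_add, mul_one]
          _ ≤ ω ^ r * (ψ (q b) : ℕ) := by
              gcongr
              exact hψ hlt
          _ ≤ _ := le_self_add
      · have hmod : a % ω ^ r < b % ω ^ r := by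
          have h1 := div_add_mod a (ω ^ r)
          have h2 := div_add_mod b (ω ^ r)
          rw [hq a ha, heq] at h1
          rw [hq b hb] at h2
          have h3 : ω ^ r * (q b : Ordinal) + a % ω ^ r < ω ^ r * (q b : Ordinal) + b % ω ^ r := by
            rw [h1, h2]; exact hab
          exact lt_of_add_lt_add_left h3
        simp only [heq]
        gcongr
        exact hφ _ (hm a) (hm b) hmod
    · intro a ha
      have h2 := hφ2 (ψ (q a)) _ (hm a)
      refine ⟨?_, by rw [h2.2, hψj]⟩
      calc ω ^ r * (ψ (q a) : ℕ) + φ (ψ (q a)) (a % ω ^ r)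
            < ω ^ r * (ψ (q a) : ℕ) + ω ^ r := by
              gcongr
              exact h2.1
          _ = ω ^ r * ((ψ (q a) + 1 : ℕ) : Ordinal) := by
              push_cast; rw [mul_add, mul_one]
          _ ≤ ω ^ r * ω := by
              gcongr
              exact (natCast_lt_omega0 _).le
          _ = ω ^ (r+1) := (pow_succ _ _).symm

end ordinals
section modules
variable {A : Type u} [CommRing A] {M : Type v} [AddCommGroup M] [Module A M]

lemma sub_isArtinian_of_map {P : Type*} [AddCommGroup P] [Module A P]
    (K : Submodule A M) (f : M →ₗ[A] P) (h : IsArtinian A K) : IsArtinian A (K.map f) := by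
  have : K.map f = LinearMap.range (f.comp K.subtype) := by
    rw [LinearMap.range_comp, Submodule.range_subtype]
  rw [this]; infer_instance

lemma art_of_fg_killed (J : Ideal A) (hJ : IsArtinian A (A ⧸ J)) (U : Submodule A M) (hU : U.FG)
    (h : ∀ a ∈ J, ∀ u ∈ U, a • u = 0) : IsArtinian A U := by
  obtain ⟨s, rfl⟩ := hU
  have hs : Submodule.span A (s : Set M) = ⨆ x : s, Submodule.span A {(x : M)} := by
    rw [← Submodule.span_iUnion]
    congr 1
    ext; simp
  have : ∀ x : s, IsArtinian A (Submodule.span A {(x : M)}) := by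
    intro x
    have hx : (x : M) ∈ Submodule.span A (s : Set M) := Submodule.subset_span x.2
    have : J ≤ LinearMap.ker (LinearMap.toSpanSingleton A M x) := fun a ha => by
      simpa using h a ha x hx
    have h2 := isArtinian_range (Submodule.liftQ J (LinearMap.toSpanSingleton A M x) this)
    rw [Submodule.range_liftQ, LinearMap.range_toSpanSingleton] at h2
    exact h2
  rw [hs]
  infer_instance

/-- a cofinite ideal attached to a finitely generated submodule -/
lemma exists_map_pi (S : Submodule A M) (hS : S.FG) :
    ∃ (k : ℕ) (ψ : A →ₗ[A] (Fin k → S)), ∀ a, ψ a = 0 ↔ ∀ s ∈ S, a • s = 0 := by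
  have : Module.Finite A S := Module.Finite.iff_fg.mpr hS
  obtain ⟨k, s, hs⟩ := Module.Finite.exists_fin (R := A) (M := S)
  refine ⟨k, LinearMap.pi fun i => LinearMap.toSpanSingleton A S (s i), fun a => ?_⟩
  constructor
  · intro h
    have h1 : (⊤ : Submodule A S) ≤ LinearMap.ker (LinearMap.lsmul A S a) := by
      rw [← hs, Submodule.span_le]
      rintro _ ⟨i, rfl⟩
      simpa using congrFun h i
    intro m hm
    have := h1 (Submodule.mem_top (x := (⟨m, hm⟩ : S)))
    simpa [Subtype.ext_iff] using this
  · intro h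
    ext i
    simpa using h _ (s i).2

lemma sep [IsNoetherianRing A] [Module.Finite A M] (Y : Submodule A M) (hY : IsArtinian A Y) :
    ∃ L : Submodule A M, L ⊓ Y = ⊥ ∧ IsArtinian A (M ⧸ L) := by
  have hN : IsNoetherian A M := inferInstance
  obtain ⟨k, ψ, hψ⟩ := exists_map_pi Y (IsNoetherian.noetherian Y)
  let J : Ideal A := LinearMap.ker ψ
  have hJ : IsArtinian A (A ⧸ J) :=
    isArtinian_of_linearEquiv (LinearMap.quotKerEquivRange ψ).symm
  have hpow : ∀ n : ℕ, IsArtinian A (M ⧸ (J ^ n • ⊤ : Submodule A M)) := by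
    intro n
    induction n with
    | zero =>
      rw [pow_zero, Ideal.one_eq_top, Submodule.top_smul]
      infer_instance
    | succ n ih =>
      set U : Submodule A M := J ^ n • ⊤ with hU
      have hle : J ^ (n+1) • (⊤ : Submodule A M) ≤ U := by
        rw [hU]; exact Submodule.smul_mono_left (Ideal.pow_le_pow_right (Nat.le_succ n))
      set V := U.map (J ^ (n+1) • (⊤ : Submodule A M)).mkQ with hV
      have hVa : IsArtinian A V := by
        apply art_of_fg_killed J hJ V (IsNoetherian.noetherian V)
        rintro a ha _ ⟨u, hu, rfl⟩
        rw [← map_smul, ← LinearMap.mem_ker, Submodule.ker_mkQ, pow_succ', mul_smul]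
        exact Submodule.smul_mem_smul ha hu
      refine isArtinian_of_range_eq_ker V.subtype (Submodule.factor hle) ?_
      rw [Submodule.range_subtype, Submodule.factor, Submodule.ker_mapQ]
      simp [hV]
  obtain ⟨n, hn⟩ := Ideal.exists_pow_inf_eq_pow_smul J Y
  refine ⟨J ^ (n+1) • ⊤, ?_, hpow _⟩
  rw [hn (n+1) (Nat.le_succ n), Nat.add_sub_cancel_left, pow_one, eq_bot_iff,
    Submodule.smul_le]
  intro a ha y hy
  rw [Submodule.mem_bot]
  exact (hψ a).mp ha y hy.2

lemma sep' [IsNoetherianRing A] (L D C : Submodule A M) (hLD : L ≤ D) (hDC : D ≤ C) (hC : C.FG)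
    (hD : IsArtinian A (D.map L.mkQ)) :
    ∃ L' : Submodule A M, L ≤ L' ∧ L' ≤ C ∧ L' ⊓ D = L ∧ IsArtinian A (C.map L'.mkQ) := by
  set X := C.map L.mkQ with hX
  have : Module.Finite A X := Module.Finite.iff_fg.mpr (hC.map _)
  let Y : Submodule A X := (D.map L.mkQ).comap X.subtype
  have hY : IsArtinian A Y := by
    refine isArtinian_of_injective (P := D.map L.mkQ)
      ((X.subtype.comp Y.subtype).codRestrict _ (fun y => y.2)) ?_
    intro a b hab
    have hab2 := congrArg Subtype.val hab
    apply Subtype.ext; apply Subtype.ext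
    exact hab2
  obtain ⟨L0, h1, h2⟩ := sep Y hY
  set L' := (L0.map X.subtype).comap L.mkQ with hL'
  have hLL : L ≤ L' := by
    intro x hx
    refine ⟨0, L0.zero_mem, ?_⟩
    rw [map_zero, eq_comm, ← LinearMap.mem_ker, Submodule.ker_mkQ]
    exact hx
  refine ⟨L', hLL, ?_, ?_, ?_⟩
  · rintro x ⟨y, hy, hxy⟩
    obtain ⟨c, hc, hcy⟩ := y.2
    have : L.mkQ (x - c) = 0 := by
      rw [map_sub, ← hxy, hcy]; simp
    rw [← LinearMap.mem_ker, Submodule.ker_mkQ] at this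
    have := C.add_mem (hDC (hLD this)) hc
    simpa using this
  · apply le_antisymm
    · rintro x ⟨⟨y, hy, hxy⟩, hxD⟩
      have : y ∈ L0 ⊓ Y := ⟨hy, x, hxD, hxy.symm⟩
      rw [h1, Submodule.mem_bot] at this
      rw [← L.ker_mkQ, LinearMap.mem_ker, ← hxy, this]; simp
    · exact le_inf hLL hLD
  · let g : X →ₗ[A] M ⧸ L' := (Submodule.factor hLL).comp X.subtype
    have hg : L0 ≤ LinearMap.ker g := by
      intro x hx
      obtain ⟨m, hm⟩ := L.mkQ_surjective x.1
      have : m ∈ L' := ⟨x, hx, hm.symm⟩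
      rw [LinearMap.mem_ker]
      change Submodule.factor hLL x.1 = 0
      rw [← hm]
      simpa using this
    have h3 := isArtinian_range (L0.liftQ g hg)
    have : LinearMap.range (L0.liftQ g hg) = C.map L'.mkQ := by
      rw [Submodule.range_liftQ, LinearMap.range_comp, Submodule.range_subtype, hX,
        ← Submodule.map_comp]
      rfl
    rwa [this] at h3

lemma art_of_le {L L' C : Submodule A M} (h : L ≤ L') (hC : IsArtinian A (C.map L.mkQ)) :
    IsArtinian A (C.map L'.mkQ) := by
  have := sub_isArtinian_of_map _ (Submodule.factor h) hC
  rw [← Submodule.map_comp] at this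
  exact this

lemma step [IsNoetherianRing A] (C L C' : Submodule A M) (hLC : L ≤ C) (hCC : C ≤ C')
    (hC' : C'.FG) (hart : IsArtinian A (C.map L.mkQ)) (hna : ¬ IsArtinian A (C'.map C.mkQ)) :
    ∃ (L' : Submodule A M) (h : M) (m : Ideal A), L ≤ L' ∧ L' ≤ C' ∧ L' ⊓ C = L ∧
      IsArtinian A (C'.map L'.mkQ) ∧ m.IsMaximal ∧ h ∈ C' ∧ h ∉ C ⊔ L' ∧ ∀ a ∈ m, a • h ∈ L' := by
  obtain ⟨L1, hL1, hL1C, hL1i, hL1a⟩ := sep' L C C' hLC hCC hC' hart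
  have hne : ¬ L1 ≤ L := by
    intro hle
    have : L1 = L := le_antisymm hle hL1
    subst this
    exact hna (art_of_le hLC hL1a)
  obtain ⟨h, hh1, hhL⟩ := Set.not_subset.mp hne
  let I : Ideal A := L.comap (LinearMap.toSpanSingleton A M h)
  have hI : I ≠ ⊤ := by
    rw [Ideal.ne_top_iff_one]
    simpa [I] using hhL
  obtain ⟨m, hm, hIm⟩ := Ideal.exists_le_maximal I hI
  let mh : Submodule A M := Submodule.map (LinearMap.toSpanSingleton A M h) m
  have hmh1 : mh ≤ L1 := by
    rintro _ ⟨a, ha, rfl⟩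
    exact L1.smul_mem a hh1
  have hL21 : L ⊔ mh ≤ L1 := sup_le hL1 hmh1
  have hhL2 : h ∉ L ⊔ mh := by
    intro hh
    obtain ⟨l, hl, _, ⟨a, ha, rfl⟩, hla⟩ := Submodule.mem_sup.mp hh
    have : (1 - a) ∈ I := by
      change (1 - a) • h ∈ L
      rw [sub_smul, one_smul]
      nth_rewrite 1 [← hla]
      simpa using hl
    have h2 := m.add_mem (hIm this) ha
    rw [sub_add_cancel] at h2
    exact hm.ne_top ((Ideal.eq_top_iff_one m).mpr h2)
  have hD : IsArtinian A ((C ⊔ Submodule.span A {h}).map (L ⊔ mh).mkQ) := by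
    rw [Submodule.map_sup]
    have i1 : IsArtinian A (C.map (L ⊔ mh).mkQ) := art_of_le le_sup_left hart
    have i2 : IsArtinian A ((Submodule.span A {h}).map (L ⊔ mh).mkQ) := by
      have hs : IsSimpleModule A (A ⧸ m) := isSimpleModule_iff_isCoatom.mpr hm.out
      apply art_of_fg_killed m inferInstance
      · exact (Submodule.fg_span_singleton h).map _
      · rintro a ha _ ⟨u, hu, rfl⟩
        obtain ⟨b, rfl⟩ := Submodule.mem_span_singleton.mp hu
        rw [← map_smul, ← LinearMap.mem_ker, Submodule.ker_mkQ, smul_comm]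
        exact Submodule.smul_mem _ _ (le_sup_right (a := L) ⟨a, ha, rfl⟩)
    infer_instance
  have hhC : h ∈ C' := hL1C hh1
  obtain ⟨L', h1, h2, h3, h4⟩ := sep' (L ⊔ mh) (C ⊔ Submodule.span A {h}) C'
    (sup_le (hLC.trans le_sup_left)
      ((by rintro _ ⟨a, ha, rfl⟩; exact Submodule.smul_mem _ _ (Submodule.mem_span_singleton_self h) :
        mh ≤ Submodule.span A {h}).trans le_sup_right))
    (sup_le hCC (by simpa using hhC)) hC' hD
  refine ⟨L', h, m, le_sup_left.trans h1, h2, ?_, h4, hm, hhC, ?_, ?_⟩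
  · apply le_antisymm
    · rw [← hL1i]
      refine le_inf ?_ inf_le_right
      calc L' ⊓ C ≤ L' ⊓ (C ⊔ Submodule.span A {h}) := inf_le_inf_left _ le_sup_left
        _ = _ := h3
        _ ≤ _ := hL21
    · exact le_inf (le_sup_left.trans h1) hLC
  · intro hh
    obtain ⟨c, hc, l, hl, hcl⟩ := Submodule.mem_sup.mp hh
    have hl2 : l ∈ L ⊔ mh := by
      rw [← h3]
      refine ⟨hl, ?_⟩
      have : l = h - c := by rw [← hcl]; abel
      rw [this]
      exact Submodule.sub_mem _ (Submodule.mem_sup_right (Submodule.mem_span_singleton_self h))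
        (Submodule.mem_sup_left hc)
    have hcL : c ∈ L := by
      rw [← hL1i]
      refine ⟨?_, hc⟩
      have : c = h - l := by rw [← hcl]; abel
      rw [this]
      exact L1.sub_mem hh1 (hL21 hl2)
    apply hhL2
    rw [← hcl]
    exact Submodule.add_mem _ (Submodule.mem_sup_left hcL) hl2
  · intro a ha
    exact h1 (le_sup_right (a := L) ⟨a, ha, rfl⟩)

lemma indep_of_seq {α : Type*} [CompleteLattice α] [IsModularLattice α] [IsCompactlyGenerated α]
    (f C : ℕ → α) (hC : Monotone C) (h1 : ∀ n, f n ≤ C (n+1)) (h2 : ∀ n, Disjoint (f n) (C n)) :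
    iSupIndep f := by
  classical
  rw [iSupIndep_iff_supIndep]
  have : ∀ n, (Finset.range n).SupIndep f := by
    intro n
    induction n with
    | zero => simp
    | succ n ih =>
      rw [Finset.range_add_one]
      apply ih.insert
      refine (h2 n).mono_right (Finset.sup_le fun i hi => (h1 i).trans (hC ?_))
      have := Finset.mem_range.mp hi
      omega
  intro s
  obtain ⟨n, hn⟩ := s.exists_nat_subset_range
  exact (this n).subset hn

lemma exists_fg [IsNoetherianRing A]
    (H : ¬ ∃ (N : Submodule A M) (ι : Type) (_ : Infinite ι)
            (f : ι → Submodule A (M ⧸ N)),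
            iSupIndep f ∧ ∀ i, f i ≠ ⊥ ∧ IsSimpleModule A (f i)) :
    ∃ N : Submodule A M, N.FG ∧ ∀ C : Submodule A M, N ≤ C → C.FG → IsArtinian A (C.map N.mkQ) := by
  by_contra! hcon
  let St := {p : Submodule A M × Submodule A M // p.1.FG ∧ p.2 ≤ p.1 ∧ IsArtinian A (p.1.map p.2.mkQ)}
  have hstep : ∀ p : St, ∃ (q : St) (h : M) (m : Ideal A), p.1.1 ≤ q.1.1 ∧ p.1.2 ≤ q.1.2 ∧
      q.1.2 ⊓ p.1.1 = p.1.2 ∧ m.IsMaximal ∧ h ∈ q.1.1 ∧ h ∉ p.1.1 ⊔ q.1.2 ∧ ∀ a ∈ m, a • h ∈ q.1.2 := by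
    rintro ⟨⟨C, L⟩, hC, hL, hart⟩
    obtain ⟨C', h1, h2, h3⟩ := hcon C hC
    obtain ⟨L', h, m, a1, a2, a3, a4, a5, a6, a7, a8⟩ := step C L C' hL h1 h2 hart h3
    exact ⟨⟨⟨C', L'⟩, h2, a2, a4⟩, h, m, h1, a1, a3, a5, a6, a7, a8⟩
  choose nxt h m k1 k2 k3 k4 k5 k6 k7 using hstep
  let p0 : St := ⟨⟨⊥, ⊥⟩, Submodule.fg_bot, le_rfl, by
    rw [Submodule.map_bot]; infer_instance⟩
  let s : ℕ → St := fun n => Nat.rec p0 (fun _ p => nxt p) n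
  have hs : ∀ n, s (n+1) = nxt (s n) := fun n => rfl
  let C : ℕ → Submodule A M := fun n => (s n).1.1
  let L : ℕ → Submodule A M := fun n => (s n).1.2
  have hCm : Monotone C := monotone_nat_of_le_succ fun n => k1 (s n)
  have hLm : Monotone L := monotone_nat_of_le_succ fun n => k2 (s n)
  have hLC : ∀ n, L n ≤ C n := fun n => (s n).2.2.1
  have h_meet : ∀ n d, L (n + d) ⊓ C n = L n := by
    intro n d
    induction d with
    | zero => exact inf_eq_left.mpr (hLC n)
    | succ d ih =>
      have h3 : L (n + d + 1) ⊓ C (n + d) = L (n + d) := k3 (s (n+d))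
      rw [← ih, ← h3, inf_assoc, inf_eq_right.mpr (hCm (Nat.le_add_right n d))]
      rfl
  let Li := ⨆ n, L n
  have hLi : ∀ n x, x ∈ Li → x ∈ C n → x ∈ L n := by
    intro n x hx hxC
    obtain ⟨j, hj⟩ := (Submodule.mem_iSup_of_directed _ hLm.directed_le).mp hx
    rw [← h_meet n j]
    exact ⟨hLm (Nat.le_add_left j n) hj, hxC⟩
  have hnot : ∀ n, h (s n) ∉ C n ⊔ Li := by
    intro n hh
    obtain ⟨c, hc, l, hl, hcl⟩ := Submodule.mem_sup.mp hh
    apply k6 (s n)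
    rw [← hcl]
    refine Submodule.add_mem_sup hc (hLi (n+1) l hl ?_)
    have : l = h (s n) - c := by rw [← hcl]; abel
    rw [this]
    exact Submodule.sub_mem _ (k5 (s n)) (hCm (Nat.le_succ n) hc)
  let f : ℕ → Submodule A (M ⧸ Li) := fun n => Submodule.span A {Li.mkQ (h (s n))}
  have hne : ∀ n, Li.mkQ (h (s n)) ≠ 0 := by
    intro n hh
    rw [← LinearMap.mem_ker, Submodule.ker_mkQ] at hh
    exact hnot n (Submodule.mem_sup_right hh)
  have hsimp : ∀ n, IsSimpleModule A (f n) := by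
    intro n
    have hs : IsSimpleModule A (A ⧸ m (s n)) := isSimpleModule_iff_isCoatom.mpr (k4 (s n)).out
    have hk : LinearMap.ker (LinearMap.toSpanSingleton A _ (Li.mkQ (h (s n)))) = m (s n) := by
      symm
      apply (k4 (s n)).eq_of_le
      · rw [Ideal.ne_top_iff_one]
        simpa using hne n
      · intro a ha
        rw [LinearMap.mem_ker, LinearMap.toSpanSingleton_apply, ← map_smul, ← LinearMap.mem_ker,
          Submodule.ker_mkQ]
        exact le_iSup L (n+1) (k7 (s n) a ha)
    have e := LinearMap.quotKerEquivRange (LinearMap.toSpanSingleton A _ (Li.mkQ (h (s n))))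
    rw [hk, LinearMap.range_toSpanSingleton] at e
    exact IsSimpleModule.congr e.symm
  apply H
  refine ⟨Li, ℕ, inferInstance, f, ?_, fun n => ⟨?_, hsimp n⟩⟩
  · refine indep_of_seq f (fun n => (C n).map Li.mkQ) (fun a b hab => Submodule.map_mono (hCm hab)) ?_ ?_
    · intro n
      rw [Submodule.span_singleton_le_iff_mem]
      exact ⟨_, k5 (s n), rfl⟩
    · intro n
      have hat : IsAtom (f n) := isSimpleModule_iff_isAtom.mp (hsimp n)
      rw [← hat.not_le_iff_disjoint, Submodule.span_singleton_le_iff_mem]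
      rintro ⟨c, hc, hcl⟩
      apply hnot n
      have : h (s n) - c ∈ Li := by
        rw [← Li.ker_mkQ, LinearMap.mem_ker, map_sub, hcl, sub_self]
      have := Submodule.add_mem_sup hc this
      simpa using this
  · simpa [f] using hne n

lemma simple_map (U : Submodule A M) (T : Submodule A U) (hT : IsSimpleModule A T) :
    IsSimpleModule A (T.map U.subtype) :=
  IsSimpleModule.congr (Submodule.equivSubtypeMap U T).symm

lemma exists_simple_le (U : Submodule A M) (hU : IsArtinian A U) (hne : U ≠ ⊥) :
    ∃ T ≤ U, IsSimpleModule A T := by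
  have : Nontrivial U := Submodule.nontrivial_iff_ne_bot.mpr hne
  have hat : IsAtomic (Submodule A U) := isAtomic_of_orderBot_wellFounded_lt hU.wf
  obtain h | ⟨T, hT, -⟩ := hat.eq_bot_or_exists_atom_le ⊤
  · exact absurd h top_ne_bot
  · refine ⟨T.map U.subtype, Submodule.map_subtype_le _ _, ?_⟩
    have := isSimpleModule_iff_isAtom.mpr hT
    exact IsSimpleModule.congr (Submodule.equivSubtypeMap U T).symm

variable (A M) in
/-- The socle: the supremum of all semisimple submodules. -/
def soc : Submodule A M := ⨆ N ∈ {N : Submodule A M | IsSemisimpleModule A N}, N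

lemma soc_ss : IsSemisimpleModule A (soc A M) :=
  isSemisimpleModule_biSup_of_isSemisimpleModule_submodule (fun _ h => h)

lemma le_soc {N : Submodule A M} (h : IsSemisimpleModule A N) : N ≤ soc A M :=
  le_biSup (fun N : Submodule A M => N) h

lemma soc_art (L : Submodule A M)
    (H : ¬ ∃ (N : Submodule A M) (ι : Type) (_ : Infinite ι)
            (f : ι → Submodule A (M ⧸ N)),
            iSupIndep f ∧ ∀ i, f i ≠ ⊥ ∧ IsSimpleModule A (f i)) :
    IsArtinian A (soc A (M ⧸ L)) := by
  have := soc_ss (A := A) (M := M ⧸ L)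
  set S := soc A (M ⧸ L)
  obtain ⟨s, hs, htop, hsim⟩ := IsSemisimpleModule.exists_sSupIndep_sSup_simples_eq_top A S
  by_cases hfin : s.Finite
  · have : Finite s := hfin
    have : ∀ i : s, IsSimpleModule A (i : Submodule A S) := fun i => hsim _ i.2
    have h2 : IsArtinian A (↥(⨆ i : s, (i : Submodule A S))) := isArtinian_iSup
    rw [← sSup_eq_iSup', htop] at h2
    exact isArtinian_of_linearEquiv Submodule.topEquiv
  · exfalso
    have hinf : Infinite s := Set.infinite_coe_iff.mpr hfin
    let e := Infinite.natEmbedding s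
    have h1 : iSupIndep (fun n => (e n : Submodule A S)) :=
      ((sSupIndep_iff s).mp hs).comp e.injective
    have h2 := S.subtype.iSupIndep_map S.subtype_injective h1
    have hsim2 : ∀ n, IsSimpleModule A ((e n : Submodule A S).map S.subtype) := fun n => by
      have := hsim _ (e n).2
      exact simple_map S _ this
    refine H ⟨L, ℕ, inferInstance, fun n => (e n : Submodule A S).map S.subtype, h2, fun n => ⟨?_, hsim2 n⟩⟩
    exact (isSimpleModule_iff_isAtom.mp (hsim2 n)).1

lemma two_one [IsNoetherianRing A]
    (H : ¬ ∃ (N : Submodule A M) (ι : Type) (_ : Infinite ι)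
            (f : ι → Submodule A (M ⧸ N)),
            iSupIndep f ∧ ∀ i, f i ≠ ⊥ ∧ IsSimpleModule A (f i)) :
    ∃ N : Submodule A M, N.FG ∧ IsArtinian A (M ⧸ N) := by
  obtain ⟨N, hN, hC⟩ := exists_fg H
  refine ⟨N, hN, monotone_stabilizes_iff_artinian.mp ?_⟩
  intro f
  let F : ℕ → Submodule A M := fun n => (OrderDual.ofDual (f n)).comap N.mkQ
  have hF : Antitone F := fun a b hab => Submodule.comap_mono (f.monotone hab)
  have hNF : ∀ n, N ≤ F n := fun n => by
    intro x hx
    change N.mkQ x ∈ OrderDual.ofDual (f n)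
    rw [(by rwa [← LinearMap.mem_ker, Submodule.ker_mkQ] : N.mkQ x = 0)]
    exact zero_mem _
  let L := ⨅ n, F n
  have hNL : N ≤ L := le_iInf hNF
  have hLF : ∀ n, L ≤ F n := fun n => iInf_le F n
  have hS := soc_art L H
  set S := soc A (M ⧸ L)
  let G : ℕ →o (Submodule A S)ᵒᵈ :=
    ⟨fun n => OrderDual.toDual (((F n).map L.mkQ).comap S.subtype),
      fun a b hab => Submodule.comap_mono (Submodule.map_mono (hF hab))⟩
  obtain ⟨n, hn⟩ := IsArtinian.monotone_stabilizes G
  have hbot : ∀ q ∈ S, q ∈ (F n).map L.mkQ → q = 0 := by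
    intro q hqS hq
    have key : ∀ k, q ∈ (F k).map L.mkQ := by
      intro k
      rcases le_total n k with hk | hk
      · have h1 : ((F n).map L.mkQ).comap S.subtype = ((F k).map L.mkQ).comap S.subtype := hn k hk
        have h2 : (⟨q, hqS⟩ : S) ∈ ((F n).map L.mkQ).comap S.subtype := hq
        rw [h1] at h2
        exact h2
      · exact Submodule.map_mono (hF hk) hq
    obtain ⟨x, rfl⟩ := L.mkQ_surjective q
    rw [← LinearMap.mem_ker, Submodule.ker_mkQ, Submodule.mem_iInf]
    intro k
    have := key k
    rw [← Submodule.mem_comap, Submodule.comap_map_mkQ, sup_eq_right.mpr (hLF k)] at this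
    exact this
  have hFL : F n ≤ L := by
    intro x hx
    by_contra hxL
    have hx0 : L.mkQ x ≠ 0 := by
      rwa [Ne, ← LinearMap.mem_ker, Submodule.ker_mkQ]
    have h1 : IsArtinian A ((Submodule.span A {x}).map L.mkQ) := by
      have h0 := hC (N ⊔ Submodule.span A {x}) le_sup_left (hN.sup (Submodule.fg_span_singleton x))
      have := art_of_le hNL h0
      exact isArtinian_of_le (t := (N ⊔ Submodule.span A {x}).map L.mkQ) (Submodule.map_mono le_sup_right)
    obtain ⟨T, hT, hTs⟩ := exists_simple_le _ h1 (by
      rw [Submodule.map_span, Set.image_singleton]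
      simpa using hx0)
    have hTS : T ≤ S := le_soc inferInstance
    apply (isSimpleModule_iff_isAtom.mp hTs).1
    rw [eq_bot_iff]
    intro t ht
    exact hbot t (hTS ht) (Submodule.map_mono (by simpa using hx) (hT ht))
  refine ⟨n, fun k hk => ?_⟩
  have hFk : F n = F k := le_antisymm (hFL.trans (hLF k)) (hF hk)
  exact Submodule.comap_injective_of_surjective N.mkQ_surjective hFk

end modules

section chains
universe u v w
open Ordinal
variable {A : Type u} [CommRing A] {M : Type v} [AddCommGroup M] [Module A M]

/-- `K` has no chain of submodules of type `ω ^ r`. -/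
def NoCh (K : Submodule A M) (r : ℕ) : Prop :=
  ¬ ∃ f : Ordinal.{w} → Submodule A M, StrictMonoOn f (Set.Iio (ω ^ r)) ∧ ∀ a < ω ^ r, f a ≤ K

lemma noeth_bound (K : Submodule A M) (hK : IsNoetherian A K) (g : Ordinal.{w} → Submodule A M)
    (r : ℕ) (hg : MonotoneOn g (Set.Iio (ω ^ r))) (hgK : ∀ a < ω ^ r, g a ≤ K) :
    ∃ b < (ω : Ordinal.{w}) ^ r, ∀ a < ω ^ r, b ≤ a → g a = g b := by
  have wf : WellFounded ((· > ·) : Submodule A K → Submodule A K → Prop) :=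
    (isNoetherian_iff'.mp hK).wf
  let s : Set (Submodule A K) := (fun a => (g a).comap K.subtype) '' Set.Iio (ω ^ r)
  have hpos : (0 : Ordinal.{w}) < ω ^ r := pow_pos omega0_pos r
  obtain ⟨_, ⟨b, hb, rfl⟩, hmax⟩ := wf.has_min s ⟨_, 0, hpos, rfl⟩
  refine ⟨b, hb, fun a ha hba => ?_⟩
  have hle : g b ≤ g a := hg hb ha hba
  refine le_antisymm ?_ hle
  have h1 := hmax _ ⟨a, ha, rfl⟩
  have h2 : (g b).comap K.subtype ≤ (g a).comap K.subtype := Submodule.comap_mono hle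
  have h3 : (g a).comap K.subtype = (g b).comap K.subtype := (h2.eq_of_not_lt h1).symm
  intro x hx
  have : (⟨x, hgK a ha hx⟩ : K) ∈ (g a).comap K.subtype := hx
  rw [h3] at this
  exact this

lemma noCh_noeth (K : Submodule A M) (hK : IsNoetherian A K) : NoCh.{u, v, w} K 1 := by
  rintro ⟨f, hf, hfK⟩
  obtain ⟨b, hb, h⟩ := noeth_bound K hK f 1 hf.monotoneOn hfK
  have hb' : Order.succ b < (ω : Ordinal.{w}) ^ 1 := by
    rw [pow_one] at hb ⊢
    exact isSuccLimit_omega0.succ_lt hb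
  exact (hf hb hb' (Order.lt_succ b)).ne (h _ hb' (Order.le_succ b)).symm

lemma NoCh.mono {K : Submodule A M} {r s : ℕ} (h : NoCh.{u, v, w} K r) (hrs : r ≤ s) :
    NoCh.{u, v, w} K s := by
  rintro ⟨f, hf, hfK⟩
  have hle : (ω : Ordinal.{w}) ^ r ≤ ω ^ s := pow_le_pow_right₀ (Order.one_le_iff_pos.mpr omega0_pos) hrs
  exact h ⟨f, hf.mono fun a ha => lt_of_lt_of_le ha hle, fun a ha => hfK a (ha.trans_le hle)⟩

lemma eq_of_gr (x : A) (U V : Submodule A M) (hUV : U ≤ V)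
    (htor : ∀ v ∈ V, ∃ n : ℕ, x ^ n • v = 0)
    (h : ∀ n : ℕ, ∀ v ∈ V, x ^ (n+1) • v = 0 → ∃ u ∈ U, x ^ n • u = x ^ n • v) : U = V := by
  refine le_antisymm hUV ?_
  have : ∀ n : ℕ, ∀ v ∈ V, x ^ n • v = 0 → v ∈ U := by
    intro n
    induction n with
    | zero => intro v _ h0; simp at h0; simp [h0]
    | succ n ih =>
      intro v hv h0
      obtain ⟨u, hu, huv⟩ := h n v hv h0
      have := ih (v - u) (V.sub_mem hv (hUV hu)) (by simp [smul_sub, huv])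
      have := U.add_mem this hu
      simpa using this
  intro v hv
  obtain ⟨n, hn⟩ := htor v hv
  exact this n v hv hn

lemma chain_step [IsArtinian A M] (x : A) (K : Submodule A M)
    (htor : ∀ v ∈ K, ∃ n : ℕ, x ^ n • v = 0) (r : ℕ) (hr : 1 ≤ r)
    (h : NoCh.{u, v, w} (K ⊓ LinearMap.ker (LinearMap.lsmul A M x)) r) :
    NoCh.{u, v, w} K (r + r) := by
  rintro ⟨f, hf, hfK⟩
  set K' := K ⊓ LinearMap.ker (LinearMap.lsmul A M x) with hK'
  let g : ℕ → Ordinal.{w} → Submodule A M := fun n a => (f a).map (LinearMap.lsmul A M (x ^ n)) ⊓ K'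
  have hgK : ∀ n a, g n a ≤ K' := fun n a => inf_le_right
  have hmono : ∀ n, ∀ a b, a ≤ b → b < (ω : Ordinal.{w}) ^ (r+r) → g n a ≤ g n b := by
    intro n a b hab hb
    exact inf_le_inf_right _ (Submodule.map_mono (hf.monotoneOn (hab.trans_lt hb) hb hab))
  have hanti : ∀ a, Antitone fun n => g n a := by
    intro a
    apply antitone_nat_of_succ_le
    intro n
    refine inf_le_inf_right _ ?_
    rintro _ ⟨u, hu, rfl⟩
    refine ⟨x • u, (f a).smul_mem x hu, ?_⟩
    change x ^ n • x • u = x ^ (n + 1) • u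
    rw [pow_succ, mul_smul]
  have hstab : ∀ a, ∃ n, ∀ m, n ≤ m → g m a = g n a := by
    intro a
    obtain ⟨n, hn⟩ := IsArtinian.monotone_stabilizes
      (⟨fun n => OrderDual.toDual (g n a), fun i j hij => hanti a hij⟩ : ℕ →o (Submodule A M)ᵒᵈ)
    exact ⟨n, fun m hm => (hn m hm).symm⟩
  choose N hN using hstab
  have hdet : ∀ a b, a < b → b < (ω : Ordinal.{w}) ^ (r+r) → ∃ n, g n a < g n b := by
    intro a b hab hb
    by_contra! hcon
    have hlt := hf (hab.trans hb) hb hab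
    apply hlt.ne
    apply eq_of_gr x _ _ hlt.le (fun v hv => htor v (hfK b hb hv))
    intro n v hv h0
    have h1 : g n a = g n b := (hmono n a b hab.le hb).eq_of_not_lt (hcon n)
    have h2 : x ^ n • v ∈ g n b := by
      refine ⟨⟨v, hv, rfl⟩, K.smul_mem _ (hfK b hb hv), ?_⟩
      change x • x ^ n • v = 0
      rw [← mul_smul, ← pow_succ', h0]
    rw [← h1] at h2
    obtain ⟨⟨u, hu, huv⟩, -⟩ := h2
    exact ⟨u, hu, huv⟩
  -- the stable values
  let G : Ordinal.{w} → Submodule A M := fun a => g (N a) a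
  have hG : ∀ n a, G a ≤ g n a := by
    intro n a
    rcases le_total n (N a) with h | h
    · exact hanti a h
    · exact (hN a n h).ge
  have hGmono : ∀ a b, a ≤ b → b < (ω : Ordinal.{w}) ^ (r+r) → G a ≤ G b := by
    intro a b hab hb
    calc G a ≤ g (N b) a := hG _ _
      _ ≤ G b := hmono _ a b hab hb
  have hmul : ∀ β < (ω : Ordinal.{w}) ^ r, ω ^ r * β < (ω : Ordinal.{w}) ^ (r+r) := by
    intro β hβ
    rw [pow_add]
    gcongr
    exact pow_pos omega0_pos r
  have hex : ∃ a b : Ordinal.{w}, a + ω ^ r ≤ b ∧ b < ω ^ (r+r) ∧ G b ≤ G a := by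
    by_contra! hcon
    apply h
    refine ⟨fun β => G (ω ^ r * β), ?_, fun a _ => hgK _ _⟩
    intro β hβ β' hβ' hlt
    refine lt_of_le_not_ge (hGmono _ _ (by gcongr) (hmul _ hβ')) (hcon _ _ ?_ (hmul _ hβ'))
    calc ω ^ r * β + ω ^ r = ω ^ r * Order.succ β := (mul_succ _ _).symm
      _ ≤ ω ^ r * β' := by gcongr; exact Order.succ_le_of_lt hlt
  obtain ⟨a, b, hab, hb, hGba⟩ := hex
  have hlim : ∀ γ < (ω : Ordinal.{w}) ^ r, Order.succ γ < (ω : Ordinal.{w}) ^ r := by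
    intro γ hγ
    have : Order.IsSuccLimit ((ω : Ordinal.{w}) ^ r) := by
      have := isSuccLimit_opow_left isSuccLimit_omega0 (b := (r : Ordinal.{w}))
        (by exact_mod_cast (by omega : r ≠ 0))
      rwa [opow_natCast] at this
    exact this.succ_lt hγ
  have hcol : ∀ γ < (ω : Ordinal.{w}) ^ r, ∃ n : ℕ, n < N b ∧ g n (a + γ) < g n (a + Order.succ γ) := by
    intro γ hγ
    have hs := hlim γ hγ
    have hle : a + Order.succ γ ≤ b := le_trans (by gcongr) hab
    have hle1 : a + γ ≤ b := le_trans (by gcongr) hab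
    obtain ⟨n, hn⟩ := hdet (a + γ) (a + Order.succ γ) (by gcongr; exact Order.lt_succ γ)
      (hle.trans_lt hb)
    refine ⟨n, ?_, hn⟩
    by_contra! hNn
    apply hn.not_ge
    calc g n (a + Order.succ γ) ≤ g n b := hmono n _ _ hle hb
      _ = G b := hN b n hNn
      _ ≤ G a := hGba
      _ ≤ G (a + γ) := hGmono _ _ le_self_add (hle1.trans_lt hb)
      _ ≤ g n (a + γ) := hG _ _
  have hNb : 0 < N b := by
    obtain ⟨n, hn, -⟩ := hcol 0 (pow_pos omega0_pos r)
    omega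
  have hcol' : ∀ γ : Ordinal.{w}, ∃ n : Fin (N b), γ < ω ^ r → g n (a + γ) < g n (a + Order.succ γ) := by
    intro γ
    by_cases hγ : γ < ω ^ r
    · obtain ⟨n, hn, hh⟩ := hcol γ hγ
      exact ⟨⟨n, hn⟩, fun _ => hh⟩
    · exact ⟨⟨0, hNb⟩, fun h => absurd h hγ⟩
  choose c hc using hcol'
  obtain ⟨i, φ, hφ, hφ2⟩ := pigeon (N b) r c
  apply h
  refine ⟨fun γ => g i (a + φ γ), ?_, fun _ _ => hgK _ _⟩
  intro γ hγ γ' hγ' hlt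
  have h1 := hc (φ γ) (hφ2 γ hγ).1
  rw [(hφ2 γ hγ).2] at h1
  refine h1.trans_le (hmono _ _ _ ?_ ?_)
  · gcongr
    exact Order.succ_le_of_lt (hφ hγ hγ' hlt)
  · refine lt_of_lt_of_le ?_ (hab.trans hb.le)
    gcongr
    exact (hφ2 γ' hγ').1

lemma chain_list [IsArtinian A M] (l : List A) : ∀ K : Submodule A M,
    (∀ x ∈ l, ∀ v ∈ K, ∃ n : ℕ, x ^ n • v = 0) →
    (∃ S : Submodule A M, IsNoetherian A S ∧ ∀ v ∈ K, (∀ x ∈ l, x • v = 0) → v ∈ S) →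
    ∃ r, 1 ≤ r ∧ NoCh.{u, v, w} K r := by
  induction l with
  | nil =>
    rintro K - ⟨S, hS, h⟩
    have hKS : K ≤ S := fun v hv => h v hv (by simp)
    exact ⟨1, le_rfl, noCh_noeth K (isNoetherian_of_le hKS)⟩
  | cons x l ih =>
    rintro K htor ⟨S, hS, h⟩
    obtain ⟨r, hr, hch⟩ := ih (K ⊓ LinearMap.ker (LinearMap.lsmul A M x))
      (fun y hy v hv => htor y (List.mem_cons_of_mem _ hy) v hv.1)
      ⟨S, hS, fun v hv hl => h v hv.1 (by
        intro y hy
        rcases List.mem_cons.mp hy with rfl | hy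
        · simpa using hv.2
        · exact hl y hy)⟩
    exact ⟨r + r, by omega, chain_step x K (htor x (by simp)) r hr hch⟩

lemma chain_artinian [IsNoetherianRing A] [IsArtinian A M] :
    ∃ r, NoCh.{u, v, w} (⊤ : Submodule A M) r := by
  have hss := soc_ss (A := A) (M := M)
  set S := soc A M with hS
  have hSn : IsNoetherian A S := ((IsSemisimpleModule.finite_tfae (R := A) (M := S)).out 1 2).mpr
    (inferInstance : IsArtinian A S)
  obtain ⟨k, ψ, hψ⟩ := exists_map_pi S (Module.Finite.iff_fg.mp (inferInstance : Module.Finite A S))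
  obtain ⟨s, hs⟩ := IsNoetherian.noetherian (LinearMap.ker ψ)
  have hsk : ∀ x ∈ s, x ∈ LinearMap.ker ψ := fun x hx => by
    rw [← hs]; exact Submodule.subset_span hx
  suffices hh : (∀ x ∈ s.toList, ∀ v ∈ (⊤ : Submodule A M), ∃ n : ℕ, x ^ n • v = 0) ∧
      ∀ v ∈ (⊤ : Submodule A M), (∀ x ∈ s.toList, x • v = 0) → v ∈ S by
    obtain ⟨r, -, h⟩ := chain_list.{u, v, w} s.toList (⊤ : Submodule A M) hh.1 ⟨S, hSn, hh.2⟩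
    exact ⟨r, h⟩
  constructor
  · intro x hx v _
    have hxk : x ∈ LinearMap.ker ψ := hsk x (by simpa using hx)
    have hkill := (hψ x).mp hxk
    -- the cyclic submodules generated by `x ^ n • v` stabilise
    obtain ⟨n, hn⟩ := IsArtinian.monotone_stabilizes
      (⟨fun n => OrderDual.toDual (Submodule.span A {x ^ n • v}), by
        apply monotone_nat_of_le_succ
        intro n
        change Submodule.span A {x ^ (n+1) • v} ≤ Submodule.span A {x ^ n • v}
        rw [Submodule.span_singleton_le_iff_mem, Submodule.mem_span_singleton]
        exact ⟨x, by rw [← mul_smul, ← pow_succ']⟩⟩ : ℕ →o (Submodule A M)ᵒᵈ)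
    have h1 : Submodule.span A {x ^ n • v} = Submodule.span A {x ^ (n+1) • v} := hn (n+1) (by omega)
    have h2 : x ^ n • v ∈ Submodule.span A {x ^ (n+1) • v} := by
      rw [← h1]; exact Submodule.mem_span_singleton_self _
    obtain ⟨a, ha⟩ := Submodule.mem_span_singleton.mp h2
    refine ⟨n, ?_⟩
    by_contra hne
    obtain ⟨T, hT, hTs⟩ := exists_simple_le (Submodule.span A {x ^ n • v}) inferInstance
      (by simpa using hne)
    have hTS : T ≤ S := le_soc inferInstance
    apply (isSimpleModule_iff_isAtom.mp hTs).1
    rw [eq_bot_iff]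
    intro t ht
    obtain ⟨b, hb⟩ := Submodule.mem_span_singleton.mp (hT ht)
    have h3 : t = a • x • t := by
      rw [← hb]
      nth_rewrite 1 [← ha]
      rw [pow_succ]
      simp only [← mul_smul]
      congr 1
      ring
    rw [hkill t (hTS ht), smul_zero] at h3
    simpa using h3
  · intro v _ hv
    have hker : LinearMap.ker ψ ≤ LinearMap.ker (LinearMap.toSpanSingleton A M v) := by
      rw [← hs, Submodule.span_le]
      intro x hx
      simpa using hv x (by simpa using hx)
    have : IsSemisimpleModule A (A ⧸ LinearMap.ker ψ) :=
      IsSemisimpleModule.congr (LinearMap.quotKerEquivRange ψ)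
    have h2 := IsSemisimpleModule.range ((LinearMap.ker ψ).liftQ _ hker)
    rw [Submodule.range_liftQ, LinearMap.range_toSpanSingleton] at h2
    exact le_soc h2 (Submodule.mem_span_singleton_self v)

lemma one_seven [IsNoetherianRing A] (H : ∃ N : Submodule A M, N.FG ∧ IsArtinian A (M ⧸ N)) :
    ∃ n : ℕ, ¬ ∃ f : Ordinal.{w} → Submodule A M,
          StrictMonoOn f (Set.Iio (Ordinal.omega0 ^ n)) := by
  obtain ⟨N, hN, hart⟩ := H
  obtain ⟨r, hr⟩ := chain_artinian.{u, v, w} (A := A) (M := M ⧸ N)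
  refine ⟨r, ?_⟩
  rintro ⟨f, hf⟩
  have hNn : IsNoetherian A N := isNoetherian_of_fg_of_noetherian N hN
  obtain ⟨b, hb, hconst⟩ := noeth_bound N hNn (fun a => f a ⊓ N) r
    (fun a ha b hb hab => inf_le_inf_right _ (hf.monotoneOn ha hb hab)) (fun _ _ => inf_le_right)
  have hadd : ∀ a < (ω : Ordinal.{w}) ^ r, b + a < ω ^ r := by
    intro a ha
    have := isPrincipal_add_omega0_opow (r : Ordinal.{w})
    rw [opow_natCast] at this
    exact this hb ha
  apply hr
  refine ⟨fun a => (f (b + a)).map N.mkQ, ?_, fun _ _ => le_top⟩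
  intro a ha a' ha' hlt
  have hl := hf (hadd a ha) (hadd a' ha') (by gcongr : b + a < b + a')
  refine lt_of_le_not_ge (Submodule.map_mono hl.le) fun hge => ?_
  apply hl.ne
  refine eq_of_le_of_inf_le_of_sup_le (z := N) hl.le ?_ ?_
  · have h1 := hconst _ (hadd a ha) le_self_add
    have h2 := hconst _ (hadd a' ha') le_self_add
    exact (h2.trans h1.symm).le
  · have := Submodule.comap_mono (f := N.mkQ) hge
    rw [Submodule.comap_map_mkQ, Submodule.comap_map_mkQ] at this
    rwa [sup_comm _ N, sup_comm _ N]

end chains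
end MinimaxAux


/-- Characterizations of minimax modules over a noetherian commutative ring: minimax is
equivalent to: no subquotient contains an infinite independent family of (nonzero) simple
submodules; no subquotient contains an infinite independent family of nonzero submodules;
the submodule poset has no subposet isomorphic to `(Set ℤ, ⊆)`; there is no chain of
submodules order-isomorphic to `ℝ`; none order-isomorphic to `ℚ`; and there is an `n` such
that no strictly increasing family of submodules is indexed by the ordinal `ω^n`. -/
theorem minimax_tfae
    (A : Type u) [CommRing A] [IsNoetherianRing A]
    (M : Type v) [AddCommGroup M] [Module A M] :
    List.TFAE
      [ ∃ N : Submodule A M, N.FG ∧ IsArtinian A (M ⧸ N),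
        ¬ ∃ (N : Submodule A M) (ι : Type) (_ : Infinite ι)
            (f : ι → Submodule A (M ⧸ N)),
            iSupIndep f ∧ ∀ i, f i ≠ ⊥ ∧ IsSimpleModule A (f i),
        ¬ ∃ (N : Submodule A M) (ι : Type) (_ : Infinite ι)
            (f : ι → Submodule A (M ⧸ N)),
            iSupIndep f ∧ ∀ i, f i ≠ ⊥,
        ¬ Nonempty (Set ℤ ↪o Submodule A M),
        ¬ ∃ f : ℝ → Submodule A M, StrictMono f,
        ¬ ∃ f : ℚ → Submodule A M, StrictMono f,
        ∃ n : ℕ, ¬ ∃ f : Ordinal → Submodule A M,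
          StrictMonoOn f (Set.Iio (Ordinal.omega0 ^ n)) ] := by
  tfae_have 1 → 7 := MinimaxAux.one_seven
  tfae_have 7 → 6 := MinimaxAux.seven_six
  tfae_have 6 → 5 := MinimaxAux.six_five
  tfae_have 5 → 4 := MinimaxAux.five_four
  tfae_have 4 → 3 := MinimaxAux.four_three
  tfae_have 3 → 2 := by
    rintro h ⟨N, ι, i, f, hf, h2⟩
    exact h ⟨N, ι, i, f, hf, fun j => (h2 j).1⟩
  tfae_have 2 → 1 := MinimaxAux.two_one
  tfae_finish
end

section
/- Let A be a noetherian commutative ring and M an A-module. If M is not minimax, then M has at least 2^ℵ₀ submodules. -/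
/-- A binary tree of pairs of submodules yields continuum many submodules. -/
theorem tree_continuum {A : Type u} [CommRing A] {M : Type v} [AddCommGroup M] [Module A M]
    (Φ : Submodule A M × Submodule A M → Prop) (q₀ : {q // Φ q})
    (step : ∀ q : {q // Φ q}, ∃ (u : M) (r : Bool → {q // Φ q}),
      (∀ b, q.1.1 ≤ (r b).1.1 ∧ q.1.2 ≤ (r b).1.2 ∧ (r b).1.1 ⊓ q.1.2 ≤ q.1.1 ∧ u ∈ (r b).1.2) ∧
      u ∈ (r true).1.1 ∧ u ∉ (r false).1.1) :
    Cardinal.continuum ≤ Cardinal.mk (Submodule A M) := by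
  choose u r hr ht hf using step
  let st : (ℕ → Bool) → ℕ → {q // Φ q} := fun σ n => Nat.rec q₀ (fun n q => r q (σ n)) n
  have st_succ : ∀ σ n, st σ (n + 1) = r (st σ n) (σ n) := fun _ _ => rfl
  have st_congr : ∀ σ τ : ℕ → Bool, ∀ n, (∀ i < n, σ i = τ i) → st σ n = st τ n := by
    intro σ τ n
    induction n with
    | zero => intro _; rfl
    | succ n ih =>
      intro h
      rw [st_succ, st_succ, ih (fun i hi => h i (by omega)), h n (by omega)]
  have hL : ∀ σ, Monotone (fun n => (st σ n).1.1) := fun σ =>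
    monotone_nat_of_le_succ (fun n => by rw [st_succ]; exact (hr _ _).1)
  have hP : ∀ σ, Monotone (fun n => (st σ n).1.2) := fun σ =>
    monotone_nat_of_le_succ (fun n => by rw [st_succ]; exact (hr _ _).2.1)
  have hinf : ∀ σ n k, (st σ (n + k)).1.1 ⊓ (st σ n).1.2 ≤ (st σ n).1.1 := by
    intro σ n k
    induction k with
    | zero => exact inf_le_left
    | succ k ih =>
      refine le_trans (le_inf ?_ inf_le_right) ih
      refine le_trans (le_inf inf_le_left (inf_le_right.trans (hP σ (Nat.le_add_right n k)))) ?_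
      rw [← add_assoc, st_succ]
      exact (hr _ _).2.2.1
  let F : (ℕ → Bool) → Submodule A M := fun σ => ⨆ n, (st σ n).1.1
  have key : ∀ σ τ : ℕ → Bool, ∀ n, (∀ i < n, σ i = τ i) → σ n = true → τ n = false →
      F σ ≠ F τ := by
    intro σ τ n h hσ hτ hF
    have h1 : u (st τ n) ∈ F σ := by
      refine Submodule.mem_iSup_of_mem (n + 1) ?_
      rw [st_succ, st_congr σ τ n h, hσ]
      exact ht _
    rw [hF] at h1
    obtain ⟨m, hm⟩ := (Submodule.mem_iSup_of_directed _ (hL τ).directed_le).1 h1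
    have h2 : u (st τ n) ∈ (st τ (n + 1 + m)).1.1 := hL τ (by omega) hm
    have h3 : u (st τ n) ∈ (st τ (n + 1)).1.2 := by
      rw [st_succ]; exact (hr _ _).2.2.2
    have h4 := hinf τ (n + 1) m ⟨h2, h3⟩
    rw [st_succ, hτ] at h4
    exact hf _ h4
  have inj : Function.Injective F := by
    intro σ τ hF
    by_contra hne
    have hex : ∃ n, σ n ≠ τ n := by
      by_contra hc
      push Not at hc
      exact hne (funext hc)
    classical
    have hn := Nat.find_spec hex
    have hlt : ∀ i < Nat.find hex, σ i = τ i := fun i hi => by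
      by_contra hc
      exact Nat.find_min hex hi hc
    cases hs : σ (Nat.find hex) <;> cases hft : τ (Nat.find hex)
    · exact hn (hs.trans hft.symm)
    · exact key τ σ _ (fun i hi => (hlt i hi).symm) hft hs hF.symm
    · exact key σ τ _ hlt hs hft hF
    · exact hn (hs.trans hft.symm)
  have := Cardinal.mk_le_of_injective (inj.comp (Equiv.ulift.{v}).injective)
  simpa using this

/-- First case: no finitely generated submodule has a quotient supported at maximal ideals. -/
theorem continuum_of_nonmax {A : Type u} [CommRing A] [IsNoetherianRing A]
    {M : Type v} [AddCommGroup M] [Module A M]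
    (H : ∀ P : Submodule A M, P.FG → ∃ (x : M) (p : Ideal A), p.IsPrime ∧ ¬ p.IsMaximal ∧
      P.colon {x} ≤ p) :
    Cardinal.continuum ≤ Cardinal.mk (Submodule A M) := by
  let Φ : Submodule A M × Submodule A M → Prop := fun q =>
    q.2.FG ∧ q.1 ≤ q.2 ∧ ∃ J : Ideal A, (∀ a ∈ J, ∀ x ∈ q.2, a • x ∈ q.1) ∧
      ∀ p : Ideal A, p.IsPrime → J ≤ p → p.IsMaximal
  refine tree_continuum Φ ⟨(⊥, ⊥), Submodule.fg_bot, le_rfl, ⊤, ?_, ?_⟩ ?_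
  · intro a _ x hx
    exact Submodule.smul_mem _ _ hx
  · intro p hp h
    exact absurd (top_le_iff.1 h) hp.ne_top
  rintro ⟨⟨L, P⟩, hPfg, hLP, J, hJ, hJmax⟩
  dsimp only at hPfg hLP hJ
  obtain ⟨x, q, hq, hqm, hxq⟩ := H P hPfg
  obtain ⟨p, hp, hpq⟩ := Ideal.exists_minimalPrimes_le hxq
  have hpp : p.IsPrime := hp.1.1
  have hpm : ¬ p.IsMaximal := fun h => hqm (by
    rwa [← h.eq_of_le hq.ne_top hpq])
  obtain ⟨y, hy⟩ := Submodule.exists_eq_colon_of_mem_minimalPrimes hp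
  have hy' : ∀ a, a ∈ p ↔ a • y ∈ P := fun a => by rw [hy, Submodule.mem_colon_singleton]
  obtain ⟨s, hsJ, hsp⟩ : ∃ s ∈ J, s ∉ p := by
    by_contra hc
    push Not at hc
    exact hpm (hJmax p hpp hc)
  obtain ⟨m, hm, hpm'⟩ := Ideal.exists_le_maximal p hpp.ne_top
  have huP : ∀ a : A, a • s • y ∈ P → a ∈ p := fun a ha => by
    rw [smul_smul, ← hy'] at ha
    exact (hpp.mem_or_mem ha).resolve_right hsp
  have huL : ∀ a : A, a • s • y ∈ P → a • s • y ∈ L := fun a ha => by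
    rw [smul_comm]
    exact hJ s hsJ _ ((hy' a).1 (huP a ha))
  let L0 : Submodule A M := L ⊔ Submodule.map (LinearMap.toSpanSingleton A M (s • y)) m
  let L1 : Submodule A M := L ⊔ Submodule.span A {s • y}
  let P' : Submodule A M := P ⊔ Submodule.span A {s • y}
  have hL01 : L0 ≤ L1 := by
    refine sup_le_sup_left ?_ _
    rintro _ ⟨a, _, rfl⟩
    exact Submodule.mem_span_singleton.2 ⟨a, rfl⟩
  have hL1P : L1 ≤ P' := sup_le_sup_right hLP _
  have hP'fg : P'.FG := hPfg.sup (Submodule.fg_span_singleton _)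
  have hkill : ∀ a ∈ J * m, ∀ x ∈ P', a • x ∈ L0 := by
    intro a ha x hx
    obtain ⟨z, hz, w, hw, rfl⟩ := Submodule.mem_sup.1 hx
    obtain ⟨c, rfl⟩ := Submodule.mem_span_singleton.1 hw
    rw [smul_add]
    have haJ : a ∈ J := (Ideal.mul_le_left : J * m ≤ J) ha
    have ham : a ∈ m := (Ideal.mul_le_right : J * m ≤ m) ha
    have h1 : a • z ∈ L0 := Submodule.mem_sup_left (hJ a haJ z hz)
    have h2 : a • c • s • y ∈ L0 := by
      refine Submodule.mem_sup_right (Submodule.mem_map.2 ⟨a * c, m.mul_mem_right c ham, ?_⟩)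
      rw [LinearMap.toSpanSingleton_apply, mul_smul]
    exact add_mem h1 h2
  have hmax' : ∀ p : Ideal A, p.IsPrime → J * m ≤ p → p.IsMaximal := by
    intro p' hp' h
    rcases hp'.mul_le.1 h with h | h
    · exact hJmax p' hp' h
    · rwa [← hm.eq_of_le hp'.ne_top h]
  have hinf : L1 ⊓ P ≤ L := by
    rintro z ⟨hz, hzP⟩
    obtain ⟨l, hl, w, hw, rfl⟩ := Submodule.mem_sup.1 hz
    obtain ⟨c, rfl⟩ := Submodule.mem_span_singleton.1 hw
    exact add_mem hl (huL c ((Submodule.add_mem_iff_right P (hLP hl)).1 hzP))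
  have hu1 : s • y ∈ Submodule.span A {s • y} := Submodule.mem_span_singleton_self _
  refine ⟨s • y, fun b => ⟨(if b then L1 else L0, P'), hP'fg, ?_, J * m, ?_, hmax'⟩, ?_, ?_, ?_⟩
  · cases b
    · exact hL01.trans hL1P
    · exact hL1P
  · cases b
    · exact hkill
    · exact fun a ha x hx => hL01 (hkill a ha x hx)
  · intro b
    refine ⟨?_, le_sup_left, ?_, Submodule.mem_sup_right hu1⟩
    · cases b
      · exact le_sup_left
      · exact le_sup_left
    · cases b
      · exact le_trans (inf_le_inf_right _ hL01) hinf
      · exact hinf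
  · exact Submodule.mem_sup_right hu1
  · intro h
    obtain ⟨l, hl, w, ⟨a, ha, rfl⟩, hlw⟩ := Submodule.mem_sup.1 h
    have h1 : (1 - a) • s • y = l := by
      rw [LinearMap.toSpanSingleton_apply] at hlw
      rw [sub_smul, one_smul, sub_eq_iff_eq_add]
      exact hlw.symm
    have h2 := hpm' (huP _ (h1 ▸ hLP hl))
    exact hm.ne_top ((Ideal.eq_top_iff_one m).2 (by simpa using add_mem h2 ha))

/-- Second case: a non-artinian quotient supported at maximal ideals. -/
theorem continuum_of_max {A : Type u} [CommRing A] [IsNoetherianRing A]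
    {M : Type v} [AddCommGroup M] [Module A M] (P₀ : Submodule A M)
    (H : ∀ (x : M) (p : Ideal A), p.IsPrime → P₀.colon {x} ≤ p → p.IsMaximal)
    (hart : ¬ IsArtinian A (M ⧸ P₀)) :
    Cardinal.continuum ≤ Cardinal.mk (Submodule A M) := by
  obtain ⟨N, hN, hNP⟩ : ∃ N : ℕ → Submodule A M, StrictAnti N ∧ ∀ n, P₀ ≤ N n := by
    rw [isArtinian_iff, RelEmbedding.wellFounded_iff_isEmpty, not_isEmpty_iff] at hart
    obtain ⟨f⟩ := hart
    refine ⟨fun n => (f n).comap P₀.mkQ, ?_, fun n => Submodule.le_comap_mkQ _ _⟩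
    intro a b hab
    have h1 : f b < f a := f.map_rel_iff.2 hab
    exact Submodule.comap_strictMono_of_surjective P₀.mkQ_surjective h1
  let K : Submodule A M := ⨅ n, N n
  have hKN : ∀ n, K ≤ N n := fun n => iInf_le _ n
  have hPK : P₀ ≤ K := le_iInf hNP
  have simple : ∀ n, ∃ u ∈ N n, u ∉ K ∧ (K.colon {u}).IsMaximal := by
    intro n
    obtain ⟨x, hx, hx'⟩ := SetLike.exists_of_lt (hN (Nat.lt_succ_self n))
    have hxK : x ∉ K := fun h => hx' (hKN _ h)
    let K' : Submodule A (N n) := K.submoduleOf (N n)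
    have hne : K'.colon {(⟨x, hx⟩ : N n)} ≠ ⊤ := by
      rw [Ne, Ideal.eq_top_iff_one, Submodule.mem_colon_singleton, one_smul]
      exact hxK
    obtain ⟨m, hm, hle⟩ := Ideal.exists_le_maximal _ hne
    have := hm.isPrime
    obtain ⟨p, hp, -⟩ := Ideal.exists_minimalPrimes_le hle
    obtain ⟨y, hy⟩ := Submodule.exists_eq_colon_of_mem_minimalPrimes hp
    have hpp : p.IsPrime := hp.1.1
    have hyp : p = K.colon {(y : M)} := by
      rw [hy]
      ext a
      rw [Submodule.mem_colon_singleton, Submodule.mem_colon_singleton]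
      exact Iff.rfl
    refine ⟨y, y.2, ?_, ?_⟩
    · intro h
      apply hpp.ne_top
      rw [hyp, Ideal.eq_top_iff_one, Submodule.mem_colon_singleton, one_smul]
      exact h
    · rw [← hyp]
      refine H y p hpp ?_
      rw [hyp]
      intro a ha
      rw [Submodule.mem_colon_singleton] at ha ⊢
      exact hPK ha
  let Φ : Submodule A M × Submodule A M → Prop := fun q =>
    K ≤ q.1 ∧ q.1 ≤ q.2 ∧ ∃ n, q.2 ⊓ N n ≤ K
  refine tree_continuum Φ ⟨(K, K), le_rfl, le_rfl, 0, inf_le_left⟩ ?_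
  rintro ⟨⟨L, P⟩, hKL, hLP, n, hn⟩
  dsimp only at hKL hLP hn
  obtain ⟨u, huN, huK, humax⟩ := simple n
  have huP : ∀ a : A, a • u ∈ P → a • u ∈ K := fun a h => hn ⟨h, (N n).smul_mem a huN⟩
  obtain ⟨k, hk⟩ : ∃ k, u ∉ N k := by
    by_contra hc
    push Not at hc
    exact huK ((Submodule.mem_iInf _).2 hc)
  have hu1 : u ∈ Submodule.span A {u} := Submodule.mem_span_singleton_self _
  let L1 : Submodule A M := L ⊔ Submodule.span A {u}
  let P' : Submodule A M := P ⊔ Submodule.span A {u}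
  have hinf : L1 ⊓ P ≤ L := by
    rintro z ⟨hz, hzP⟩
    obtain ⟨l, hl, w, hw, rfl⟩ := Submodule.mem_sup.1 hz
    obtain ⟨c, rfl⟩ := Submodule.mem_span_singleton.1 hw
    exact add_mem hl (hKL (huP c ((Submodule.add_mem_iff_right P (hLP hl)).1 hzP)))
  have hP' : ∃ j, P' ⊓ N j ≤ K := by
    refine ⟨max n k, ?_⟩
    rintro z ⟨hz, hzN⟩
    obtain ⟨z, hzP, w, hw, rfl⟩ := Submodule.mem_sup.1 hz
    obtain ⟨c, rfl⟩ := Submodule.mem_span_singleton.1 hw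
    have h1 : z + c • u ∈ N n := hN.antitone (le_max_left n k) hzN
    have h2 : z + c • u ∈ N k := hN.antitone (le_max_right n k) hzN
    have h3 : z ∈ K := hn ⟨hzP, (Submodule.add_mem_iff_left _ ((N n).smul_mem c huN)).1 h1⟩
    have h4 : c • u ∈ N k := (Submodule.add_mem_iff_right _ (hKN k h3)).1 h2
    refine add_mem h3 ?_
    by_contra hc
    have hc' : c ∉ K.colon {u} := fun h => hc (Submodule.mem_colon_singleton.1 h)
    obtain ⟨b, i, hi, hbi⟩ := humax.exists_inv hc'
    apply hk
    have h5 : u = b • c • u + i • u := by rw [smul_smul, ← add_smul, hbi, one_smul]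
    rw [h5]
    exact add_mem ((N k).smul_mem b h4) (hKN k (Submodule.mem_colon_singleton.1 hi))
  refine ⟨u, fun b => ⟨(if b then L1 else L, P'), ?_, ?_, hP'⟩, ?_, ?_, ?_⟩
  · cases b
    · exact hKL
    · exact hKL.trans le_sup_left
  · cases b
    · exact hLP.trans le_sup_left
    · exact sup_le_sup_right hLP _
  · intro b
    refine ⟨?_, le_sup_left, ?_, Submodule.mem_sup_right hu1⟩
    · cases b
      · exact le_rfl
      · exact le_sup_left
    · cases b
      · exact inf_le_left
      · exact hinf
  · exact Submodule.mem_sup_right hu1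
  · intro h
    have h1 : u ∈ L := h
    exact huK (by simpa using huP 1 (by simpa using hLP h1))

/-- Let `A` be a noetherian commutative ring and `M` an `A`-module. If `M` is not minimax
(i.e. there is no finitely generated submodule `N` of `M` with `M/N` artinian), then `M` has
at least `2^ℵ₀` submodules. -/
theorem not_minimax_continuum_le_card_submodules
    {A : Type u} [CommRing A] [IsNoetherianRing A]
    {M : Type v} [AddCommGroup M] [Module A M]
    (h : ¬ ∃ N : Submodule A M, N.FG ∧ IsArtinian A (M ⧸ N)) :
    Cardinal.continuum ≤ Cardinal.mk (Submodule A M) := by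
  by_cases H : ∀ P : Submodule A M, P.FG → ∃ (x : M) (p : Ideal A), p.IsPrime ∧
      ¬ p.IsMaximal ∧ P.colon {x} ≤ p
  · exact continuum_of_nonmax H
  · push Not at H
    obtain ⟨P, hP, H⟩ := H
    refine continuum_of_max P (fun x p hp hle => ?_) (fun hart => h ⟨P, hP, hart⟩)
    by_contra hc
    exact H x p hp hc hle
end

section
/- Let R be a complete noetherian local ring (a noetherian local ring complete in the topology defined by its maximal ideal) of Krull dimension at least 2. Then R has uncountably many prime ideals of height 1; in particular, R has uncountably many ideals. -/
open IsLocalRing in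
/-- Primes are closed in the adic topology (Krull intersection). -/
theorem aux_separate {R : Type*} [CommRing R] [IsNoetherianRing R] [IsLocalRing R]
    (P : Ideal R) (x : R) (hx : x ∉ P) :
    ∃ k : ℕ, ∀ z ∈ maximalIdeal R ^ k, x + z ∉ P := by
  by_contra! h
  apply hx
  rw [← Ideal.Quotient.eq_zero_iff_mem]
  have hH : IsHausdorff (maximalIdeal R) (R ⧸ P) := inferInstance
  refine hH.haus _ fun n => ?_
  obtain ⟨z, hz, hxz⟩ := h n
  rw [SModEq.zero]
  have h1 : Ideal.Quotient.mk P x = (-z) • (1 : R ⧸ P) := by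
    rw [Algebra.smul_def, mul_one, Ideal.Quotient.algebraMap_eq, Ideal.Quotient.eq]
    simpa using hxz
  rw [h1]
  exact Submodule.smul_mem_smul (neg_mem hz) trivial

open IsLocalRing in
/-- Countable prime avoidance for the maximal ideal of a complete local ring. -/
theorem aux_avoid {R : Type*} [CommRing R] [IsNoetherianRing R] [IsLocalRing R]
    [IsAdicComplete (maximalIdeal R) R]
    (P : ℕ → PrimeSpectrum R) (hP : ∀ n, ¬ maximalIdeal R ≤ (P n).asIdeal) :
    ∃ x ∈ maximalIdeal R, ∀ n, x ∉ (P n).asIdeal := by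
  have step : ∀ (n : ℕ) (s : R × ℕ), ∃ t : R × ℕ, s.2 < t.2 ∧
      t.1 - s.1 ∈ maximalIdeal R ^ s.2 ∧
      ∀ z ∈ maximalIdeal R ^ t.2, t.1 + z ∉ (P n).asIdeal := by
    rintro n ⟨x, k⟩
    obtain ⟨y, hy, hxy⟩ : ∃ y, y - x ∈ maximalIdeal R ^ k ∧ y ∉ (P n).asIdeal := by
      by_cases hx : x ∈ (P n).asIdeal
      · have : ¬ maximalIdeal R ^ k ≤ (P n).asIdeal :=
          fun h => hP n ((P n).isPrime.le_of_pow_le h)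
        obtain ⟨y, hy, hy'⟩ := SetLike.not_le_iff_exists.mp this
        exact ⟨x + y, by simpa using hy, fun h => hy' (by simpa using sub_mem h hx)⟩
      · exact ⟨x, by simp, hx⟩
    obtain ⟨l, hl⟩ := aux_separate _ y hxy
    exact ⟨(y, l + k + 1), by simp only; omega, hy,
      fun z hz => hl z (Ideal.pow_le_pow_right (by simp only; omega) hz)⟩
  choose g hg1 hg2 hg3 using step
  let s : ℕ → R × ℕ := fun n => Nat.rec ((0 : R), 1) g n
  have hs : ∀ n, s (n + 1) = g n (s n) := fun n => rfl
  have hmono : StrictMono fun n => (s n).2 := strictMono_nat_of_lt_succ fun n => by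
    rw [hs]; exact hg1 _ _
  have hdiff : ∀ m n, m ≤ n → (s n).1 - (s m).1 ∈ maximalIdeal R ^ (s m).2 := by
    intro m n hmn
    induction n, hmn using Nat.le_induction with
    | base => simp
    | succ n hmn ih =>
      have h2 := hg2 n (s n)
      rw [← hs] at h2
      have := add_mem (Ideal.pow_le_pow_right (hmono.monotone hmn) h2) ih
      simpa using this
  have hle : ∀ n, n ≤ (s n).2 := fun n => hmono.le_apply (x := n)
  obtain ⟨L, hL⟩ := IsPrecomplete.prec (I := maximalIdeal R) (M := R) inferInstance
    (f := fun n => (s n).1) (by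
      intro m n hmn
      rw [SModEq.comm, SModEq.sub_mem, smul_eq_mul, Ideal.mul_top]
      exact Ideal.pow_le_pow_right (hle m) (hdiff m n hmn))
  have hlim : ∀ n, L - (s n).1 ∈ maximalIdeal R ^ (s n).2 := by
    intro n
    have h1 := hL (s n).2
    rw [SModEq.comm, SModEq.sub_mem, smul_eq_mul, Ideal.mul_top] at h1
    simpa using add_mem h1 (hdiff n _ (hle n))
  refine ⟨L, ?_, fun n => ?_⟩
  · have := hlim 0
    simpa [s] using this
  · have h3 := hg3 n (s n) (L - (s (n + 1)).1) (by rw [← hs]; exact hlim (n + 1))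
    rw [← hs] at h3
    simpa using h3

/-- A complete noetherian local ring of Krull dimension at least 2 has uncountably many
prime ideals of height one; in particular it has uncountably many ideals. -/
theorem uncountably_many_height_one_primes
    (R : Type u) [CommRing R] [IsNoetherianRing R] [IsLocalRing R]
    [IsAdicComplete (IsLocalRing.maximalIdeal R) R]
    (hdim : 2 ≤ ringKrullDim R) :
    ¬ ({P : PrimeSpectrum R | Order.height P = 1} : Set (PrimeSpectrum R)).Countable ∧
      ¬ Countable (Ideal R) := by
  have key : ¬ ({P : PrimeSpectrum R | Order.height P = 1} : Set (PrimeSpectrum R)).Countable := by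
    intro hc
    have hmin : {P : PrimeSpectrum R | Order.height P = 0}.Countable := by
      refine Set.Countable.mono ?_ ((minimalPrimes.finite_of_isNoetherianRing R).countable.preimage
        (f := PrimeSpectrum.asIdeal) (fun a b h => PrimeSpectrum.ext h))
      intro P hP
      rw [Set.mem_setOf_eq, ← PrimeSpectrum.height_eq_orderHeight] at hP
      exact Ideal.height_eq_zero_iff.mp hP
    have hT := hc.union hmin
    have hmem : ∀ x ∈ IsLocalRing.maximalIdeal R, ∃ P ∈ {P : PrimeSpectrum R | Order.height P = 1} ∪
        {P : PrimeSpectrum R | Order.height P = 0}, x ∈ P.asIdeal := by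
      intro x hx
      obtain ⟨p, hp, -⟩ := Ideal.exists_minimalPrimes_le
        (I := Ideal.span {x}) (J := IsLocalRing.maximalIdeal R) (by simpa [Ideal.span_le] using hx)
      have h1 := Ideal.height_le_one_of_isPrincipal_of_mem_minimalPrimes _ p hp
      refine ⟨⟨p, hp.1.1⟩, ?_, hp.1.2 (Ideal.mem_span_singleton_self x)⟩
      have h2 := PrimeSpectrum.height_eq_orderHeight ⟨p, hp.1.1⟩
      simp only at h2
      rw [h2] at h1
      rcases h1.lt_or_eq with h | h
      · exact Or.inr (Order.lt_one_iff.mp h)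
      · exact Or.inl h
    obtain ⟨P₀, hP₀, -⟩ := hmem 0 (zero_mem _)
    obtain ⟨f, hf⟩ := hT.exists_eq_range ⟨P₀, hP₀⟩
    obtain ⟨x, hx, hxf⟩ := aux_avoid f (by
      intro n hn
      have hfn : f n ∈ Set.range f := ⟨n, rfl⟩
      rw [← hf] at hfn
      have hle : Order.height (f n) ≤ 1 := by
        rcases hfn with h | h
        · exact le_of_eq h
        · exact (le_of_eq h).trans zero_le_one
      rw [← PrimeSpectrum.height_eq_orderHeight] at hle
      have := (Ideal.height_mono hn).trans hle
      rw [← IsLocalRing.maximalIdeal_height_eq_ringKrullDim] at hdim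
      have h2 : (2 : ℕ∞) ≤ (IsLocalRing.maximalIdeal R).height := WithBot.coe_le_coe.mp hdim
      exact absurd (h2.trans this) (by norm_num))
    obtain ⟨P, hP, hxP⟩ := hmem x hx
    rw [hf] at hP
    obtain ⟨n, rfl⟩ := hP
    exact hxf n hxP
  refine ⟨key, fun h => key ?_⟩
  have : Countable (PrimeSpectrum R) :=
    Function.Injective.countable (f := PrimeSpectrum.asIdeal) (fun a b h => PrimeSpectrum.ext h)
  exact Set.to_countable _
end

section
/- Let R be a complete noetherian local ring (a noetherian local ring complete in the topology defined by its maximal ideal) of Krull dimension at least 2, whose residue field has cardinality α. Then the set of ideals of R has cardinality exactly α^ℵ₀ (cardinal exponentiation). -/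
section helpers
open Cardinal IsLocalRing
variable (R : Type u) [CommRing R] [IsNoetherianRing R] [IsLocalRing R]
    [IsAdicComplete (IsLocalRing.maximalIdeal R) R]

lemma exists_F {R : Type u} [CommRing R] [IsLocalRing R]
    [IsAdicComplete (maximalIdeal R) R] (y : R) (hy : y ∈ maximalIdeal R) :
    ∃ F : (ℕ → ResidueField R) → R, ∀ c, ∃ a, residue R a = c 0 ∧ 
      (∀ c', c 0 = c' 0 → F c - F c' = y * (F (fun n => c (n+1)) - F (fun n => c' (n+1)))) ∧
      F c = a + y * F (fun n => c (n+1)) := by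
  choose σ hσ using (residue_surjective (R := R))
  have h1 : ∀ c : ℕ → ResidueField R, ∃ L : R, ∀ n,
      (∑ i ∈ Finset.range n, σ (c i) * y ^ i) - L ∈ maximalIdeal R ^ n := by
    intro c
    obtain ⟨L, hL⟩ := IsPrecomplete.prec' (I := maximalIdeal R) (M := R)
      (fun n => ∑ i ∈ Finset.range n, σ (c i) * y ^ i) (by
        intro m n hmn
        rw [SModEq.comm, SModEq.sub_mem, ← Finset.sum_sdiff_eq_sub (Finset.range_mono hmn), smul_eq_mul, Ideal.mul_top]
        refine Ideal.sum_mem _ fun i hi => Ideal.mul_mem_left _ _ ?_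
        simp at hi
        exact Ideal.pow_le_pow_right hi.2 (Ideal.pow_mem_pow hy i))
    refine ⟨L, fun n => ?_⟩
    have := hL n
    rwa [SModEq.sub_mem, smul_eq_mul, Ideal.mul_top] at this
  choose F hF using h1
  have key : ∀ c, F c = σ (c 0) + y * F (fun n => c (n+1)) := by
    intro c
    rw [IsHausdorff.eq_iff_smodEq (I := maximalIdeal R)]
    intro n
    rw [SModEq.sub_mem, smul_eq_mul, Ideal.mul_top]
    have h2 := Ideal.pow_le_pow_right (Nat.le_succ n) (hF c (n+1))
    have h3 := Ideal.mul_mem_left _ y (hF (fun n => c (n+1)) n)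
    rw [Finset.sum_range_succ'] at h2
    have := sub_mem h3 h2
    convert this using 1
    rw [mul_sub, Finset.mul_sum, Finset.sum_congr rfl (fun i _ => (by ring : y * (σ (c (i+1)) * y^i) = σ (c (i+1)) * y^(i+1)))]
    ring
  refine ⟨F, fun c => ⟨σ (c 0), hσ _, fun c' h => ?_, key c⟩⟩
  rw [key c, key c', h]; ring

lemma F_inj {R : Type u} [CommRing R] [IsLocalRing R]
    (y : R) (hy : y ∈ maximalIdeal R) (F : (ℕ → ResidueField R) → R)
    (hF : ∀ c, ∃ a, residue R a = c 0 ∧ 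
      (∀ c', c 0 = c' 0 → F c - F c' = y * (F (fun n => c (n+1)) - F (fun n => c' (n+1)))) ∧
      F c = a + y * F (fun n => c (n+1))) (Q : Ideal R) [hQ : Q.IsPrime] (hyQ : y ∉ Q) (n : ℕ) :
    ∀ c c', F c - F c' ∈ Q → c n = c' n := by
  have h0 : ∀ c c', F c - F c' ∈ Q → c 0 = c' 0 := by
    intro c c' h
    obtain ⟨a, ha, -, h1⟩ := hF c
    obtain ⟨a', ha', -, h1'⟩ := hF c'
    have h2 : residue R (F c - F c') = 0 := by
      rw [residue_eq_zero_iff]; exact le_maximalIdeal hQ.ne_top h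
    have hy0 : residue R y = 0 := by rwa [residue_eq_zero_iff]
    rw [h1, h1'] at h2
    simpa [hy0, ha, ha', sub_eq_zero] using h2
  induction n with
  | zero => exact h0
  | succ n ih =>
    intro c c' h
    obtain ⟨a, ha, h1, -⟩ := hF c
    rw [h1 c' (h0 c c' h)] at h
    exact ih (fun n => c (n+1)) (fun n => c' (n+1)) ((hQ.mem_or_mem h).resolve_left hyQ)

lemma exists_xy (hdim : 2 ≤ ringKrullDim R) : ∃ x y : R, x ∈ maximalIdeal R ∧ y ∈ maximalIdeal R ∧
    2 ≤ (Ideal.span {x, y}).height := by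
  rw [← IsLocalRing.maximalIdeal_height_eq_ringKrullDim] at hdim
  obtain ⟨J, hJ, h1, h2⟩ := exists_spanRank_le_and_le_height_of_le_height (maximalIdeal R) 2
    (WithBot.coe_le_coe.1 hdim)
  have hJt : J ≠ ⊤ := fun h => (maximalIdeal.isMaximal R).ne_top (top_le_iff.1 (h ▸ hJ))
  have h3 : J.spanRank = 2 := by
    apply le_antisymm (by exact_mod_cast h1)
    refine le_trans ?_ (J.height_le_spanRank hJt)
    exact_mod_cast (Cardinal.ofENat_le_ofENat.{u}.2 h2)
  have h4 : #J.generators = 2 := by rw [← h3, Submodule.generators_card]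
  obtain ⟨x, y, hxy, h⟩ := Cardinal.mk_eq_two_iff.1 h4
  have h5 : J.generators = {x.1, y.1} := by
    ext z; constructor
    · intro hz
      have : (⟨z, hz⟩ : J.generators) ∈ ({x, y} : Set _) := h ▸ Set.mem_univ _
      rcases this with h | h
      · left; exact congrArg Subtype.val h
      · right; exact congrArg Subtype.val h
    · rintro (rfl | rfl)
      exacts [x.2, y.2]
  have h6 : Ideal.span {x.1, y.1} = J := by rw [← h5]; exact J.span_generators
  refine ⟨x, y, hJ (h6.le (Ideal.subset_span (by simp))), hJ (h6.le (Ideal.subset_span (by simp))), ?_⟩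
  rw [h6]; exact_mod_cast h2

lemma lower (hdim : 2 ≤ ringKrullDim R) : #(ResidueField R) ^ ℵ₀ ≤ #(Ideal R) := by
  obtain ⟨x, y, hx, hy, hh⟩ := exists_xy R hdim
  obtain ⟨F, hF⟩ := exists_F y hy
  have : Function.Injective (fun c => Ideal.span {x - F c * y}) := by
    intro c c' h
    by_contra hne
    obtain ⟨Q, hQ⟩ := (Ideal.span {x - F c * y}).nonempty_minimalPrimes (by
      intro h
      rw [Ideal.span_singleton_eq_top] at h
      exact (sub_mem hx (Ideal.mul_mem_left _ (F c) hy)) h)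
    have hp := hQ.isPrime
    have h1 : x - F c * y ∈ Q := hQ.1.2 (Ideal.mem_span_singleton_self _)
    have h2 : x - F c' * y ∈ Q := hQ.1.2 (by
      dsimp only at h
      rw [h]; exact (Ideal.mem_span_singleton_self _))
    have h3 : (F c - F c') * y ∈ Q := by
      convert sub_mem h2 h1 using 1; ring
    have hyQ : y ∈ Q := by
      by_contra hyQ
      exact hne (funext fun n => F_inj y hy F hF Q hyQ n c c' ((hp.mem_or_mem h3).resolve_right hyQ))
    have hxQ : x ∈ Q := by
      convert add_mem h1 (Ideal.mul_mem_left _ (F c) hyQ) using 1; ring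
    have h4 : Ideal.span {x, y} ≤ Q := by
      rw [Ideal.span_le]; rintro z (rfl | rfl) <;> assumption
    have h5 := Ideal.height_le_one_of_isPrincipal_of_mem_minimalPrimes _ Q hQ
    have h6 := (hh.trans (Ideal.height_mono h4)).trans h5
    exact absurd h6 (by decide)
  have := Cardinal.mk_le_of_injective this
  simpa using this

lemma card_quot (n : ℕ) : #(R ⧸ (maximalIdeal R ^ n)) ≤ max #(ResidueField R) ℵ₀ := by
  induction n with
  | zero =>
    have : Subsingleton (R ⧸ (maximalIdeal R ^ 0)) := by
      rw [pow_zero]; exact Ideal.Quotient.subsingleton_iff.2 Ideal.one_eq_top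
    exact (Cardinal.le_one_iff_subsingleton.2 this).trans (one_le_aleph0.trans (le_max_right _ _))
  | succ n ih =>
    obtain ⟨k, s, hs⟩ := Submodule.fg_iff_exists_fin_generating_family.1
      (IsNoetherian.noetherian (maximalIdeal R ^ n))
    choose σ hσ using (residue_surjective (R := R))
    choose τ hτ using (Ideal.Quotient.mk_surjective (I := maximalIdeal R ^ n))
    have hsurj : Function.Surjective
      (fun p : (R ⧸ (maximalIdeal R ^ n)) × (Fin k → ResidueField R) =>
        Ideal.Quotient.mk (maximalIdeal R ^ (n+1)) (τ p.1 + ∑ i, σ (p.2 i) * s i)) := by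
      intro r
      obtain ⟨r, rfl⟩ := Ideal.Quotient.mk_surjective r
      have h1 : r - τ (Ideal.Quotient.mk _ r) ∈ maximalIdeal R ^ n := by
        rw [← Ideal.Quotient.eq, hτ]
      have h1 := hs.ge h1
      obtain ⟨a, ha⟩ := (Submodule.mem_span_range_iff_exists_fun R).1 h1
      refine ⟨⟨Ideal.Quotient.mk _ r, fun i => residue R (a i)⟩, ?_⟩
      dsimp only
      rw [eq_comm, Ideal.Quotient.eq, ← sub_sub, ← ha, ← Finset.sum_sub_distrib]
      refine Ideal.sum_mem _ fun i _ => ?_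
      rw [smul_eq_mul, ← sub_mul, pow_succ']
      refine Ideal.mul_mem_mul ?_ (hs ▸ Submodule.subset_span ⟨i, rfl⟩)
      rw [← residue_eq_zero_iff, map_sub, hσ, sub_self]
    refine (Cardinal.mk_le_of_surjective hsurj).trans ?_
    rw [mk_prod, lift_id, lift_id]
    refine (mul_le_mul' ih ?_).trans (mul_eq_self (le_max_right _ _)).le
    simpa using Cardinal.power_nat_le_max (c := #(ResidueField R)) (n := k)

lemma upper : #(Ideal R) ≤ #(ResidueField R) ^ ℵ₀ := by
  have h2 : 2 ≤ #(ResidueField R) := by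
    rw [Cardinal.two_le_iff]; exact exists_pair_ne _
  have hal : ℵ₀ ≤ #(ResidueField R) ^ ℵ₀ :=
    (cantor ℵ₀).le.trans (power_le_power_right h2)
  have hmax : max #(ResidueField R) ℵ₀ ≤ #(ResidueField R) ^ ℵ₀ :=
    max_le (self_le_power _ one_le_aleph0) hal
  have hR : #R ≤ #(ResidueField R) ^ ℵ₀ := by
    have : Function.Injective (fun (r : R) (n : ℕ) => Ideal.Quotient.mk (maximalIdeal R ^ n) r) := by
      intro a b h
      rw [IsHausdorff.eq_iff_smodEq (I := maximalIdeal R)]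
      intro n
      rw [SModEq.sub_mem, smul_eq_mul, Ideal.mul_top, ← Ideal.Quotient.eq]
      exact congrFun h n
    refine (Cardinal.mk_le_of_injective this).trans ?_
    rw [mk_pi]
    refine (prod_le_prod _ (fun _ => #(ResidueField R) ^ ℵ₀) (fun n => (card_quot R n).trans hmax)).trans ?_
    simp [← power_mul]
  have hsurj : Function.Surjective (fun l : List R => Ideal.span {x | x ∈ l}) := by
    intro I
    obtain ⟨s, hs⟩ := IsNoetherian.noetherian I
    refine ⟨s.toList, ?_⟩
    simp only [Finset.mem_toList]
    exact hs
  exact (Cardinal.mk_le_of_surjective hsurj).trans ((mk_list_le_max R).trans (max_le hal hR))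

end helpers

/-- Let `R` be a complete noetherian local ring of Krull dimension at least 2 whose residue
field has cardinality `α`.  Then `R` has exactly `α ^ ℵ₀` ideals. -/
theorem card_ideals_of_complete_local_dim_ge_two
    (R : Type u) [CommRing R] [IsNoetherianRing R] [IsLocalRing R]
    [IsAdicComplete (IsLocalRing.maximalIdeal R) R]
    (hdim : 2 ≤ ringKrullDim R) :
    Cardinal.mk (Ideal R) =
      Cardinal.mk (IsLocalRing.ResidueField R) ^ Cardinal.aleph0 := by
  exact le_antisymm (upper R) (lower R hdim)
end

section
/- Let R be a complete noetherian local ring (a noetherian local ring complete in the topology defined by its maximal ideal) whose residue field has cardinality α, and let M be a finitely generated R-module whose Krull dimension is at least two (i.e. the Krull dimension of R/Ann_R(M) is at least 2). Then the set of R-submodules of M has cardinality exactly α^ℵ₀. In particular, if the residue field is countable, M has exactly 2^ℵ₀ submodules. -/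
open IsLocalRing
open scoped Pointwise

theorem aux_params {R : Type*} [CommRing R] [IsNoetherianRing R] [IsLocalRing R] (I : Ideal R)
    (hdim : 2 ≤ ringKrullDim (R ⧸ I)) :
    ∃ x ∈ maximalIdeal R, ∃ y ∈ maximalIdeal R, ∀ z ∈ maximalIdeal R,
      ¬ (∀ q : Ideal R, q.IsPrime → I ≤ q → z ∈ q → x ∈ q ∧ y ∈ q) := by
  have hnt : Nontrivial (R ⧸ I) := by
    by_contra h
    rw [not_nontrivial_iff_subsingleton] at h
    rw [ringKrullDim_eq_bot_of_subsingleton] at hdim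
    simp at hdim
  have hI : I ≤ maximalIdeal R := IsLocalRing.le_maximalIdeal (Ideal.Quotient.nontrivial_iff.mp hnt)
  have hloc : IsLocalRing (R ⧸ I) :=
    IsLocalRing.of_surjective' (Ideal.Quotient.mk I) Ideal.Quotient.mk_surjective
  have hh : (2 : ℕ) ≤ (maximalIdeal (R ⧸ I)).height := by
    rw [← IsLocalRing.maximalIdeal_height_eq_ringKrullDim] at hdim
    exact WithBot.coe_le_coe.mp hdim
  obtain ⟨J, hJ, hJ2, hJh⟩ := exists_spanRank_le_and_le_height_of_le_height _ 2 hh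
  obtain ⟨a, b, rfl⟩ : ∃ a b : R ⧸ I, J = Ideal.span {a, b} := by
    have hs : J.generators.Finite := (IsNoetherian.noetherian J).finite_generators
    have hsp : Ideal.span J.generators = J := J.span_generators
    have hcard : J.generators.ncard ≤ 2 := by
      rw [(IsNoetherian.noetherian J).generators_ncard]
      rw [Submodule.fg_iff_spanRank_eq_spanFinrank.mpr (IsNoetherian.noetherian J)] at hJ2
      exact_mod_cast hJ2
    rw [← hsp]
    obtain h | h | h : J.generators.ncard = 0 ∨ J.generators.ncard = 1 ∨ J.generators.ncard = 2 := by
      omega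
    · rw [Set.ncard_eq_zero hs] at h
      exact ⟨0, 0, by simp [h]⟩
    · obtain ⟨a, h⟩ := Set.ncard_eq_one.mp h
      exact ⟨a, a, by simp [h]⟩
    · obtain ⟨a, b, -, h⟩ := Set.ncard_eq_two.mp h
      exact ⟨a, b, by simp [h]⟩
  obtain ⟨x, rfl⟩ := Ideal.Quotient.mk_surjective a
  obtain ⟨y, rfl⟩ := Ideal.Quotient.mk_surjective b
  have hmem : ∀ t : R, Ideal.Quotient.mk I t ∈ maximalIdeal (R ⧸ I) → t ∈ maximalIdeal R := by
    intro t ht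
    rw [mem_maximalIdeal, mem_nonunits_iff] at ht ⊢
    exact fun h => ht (h.map _)
  refine ⟨x, hmem _ (hJ (Ideal.subset_span (by simp))), y,
    hmem _ (hJ (Ideal.subset_span (by simp))), fun z hz H => ?_⟩
  have hne : I ⊔ Ideal.span {z} ≠ ⊤ := by
    intro h
    have : I ⊔ Ideal.span {z} ≤ maximalIdeal R :=
      sup_le hI ((Ideal.span_singleton_le_iff_mem _).mpr hz)
    rw [h] at this
    exact (maximalIdeal.isMaximal R).ne_top (top_le_iff.mp this)
  obtain ⟨q, hq⟩ := Ideal.nonempty_minimalPrimes hne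
  have h1 := Ideal.map_height_le_one_of_mem_minimalPrimes hq
  have hqI : I ≤ q := le_sup_left.trans hq.1.2
  obtain ⟨hx, hy⟩ := H q hq.1.1 hqI
    ((Ideal.span_singleton_le_iff_mem _).mp (le_sup_right.trans hq.1.2))
  have h2 : Ideal.span {Ideal.Quotient.mk I x, Ideal.Quotient.mk I y} ≤
      q.map (Ideal.Quotient.mk I) := by
    rw [Ideal.span_le]
    rintro t (rfl | rfl)
    · exact Ideal.mem_map_of_mem _ hx
    · exact Ideal.mem_map_of_mem _ hy
  have h3 := (hJh.trans (Ideal.height_mono h2)).trans h1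
  norm_num at h3

theorem aux_supp {R : Type*} [CommRing R] {M : Type*} [AddCommGroup M] [Module R M]
    [Module.Finite R M] (z w : R) (n : ℕ)
    (h : ∀ m : M, (w ^ n) • m ∈ z • (⊤ : Submodule R M))
    (q : Ideal R) (hq : q.IsPrime) (hI : Module.annihilator R M ≤ q) (hz : z ∈ q) : w ∈ q := by
  have h1 : (⟨q, hq⟩ : PrimeSpectrum R) ∈ Module.support R (QuotSMulTop z M) := by
    rw [Module.support_quotSMulTop]
    refine ⟨Module.mem_support_iff_of_finite.mpr hI, ?_⟩
    simpa [PrimeSpectrum.mem_zeroLocus] using hz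
  have h2 := Module.annihilator_le_of_mem_support h1
  refine hq.mem_of_pow_mem n (h2 ?_)
  rw [Module.mem_annihilator]
  intro m
  obtain ⟨m, rfl⟩ := Submodule.Quotient.mk_surjective _ m
  rw [← Submodule.Quotient.mk_smul, Submodule.Quotient.mk_eq_zero]
  exact h m

/-- the power series evaluation -/
theorem aux_series {R : Type*} [CommRing R] [IsLocalRing R]
    [IsAdicComplete (maximalIdeal R) R] (y : R) (hy : y ∈ maximalIdeal R) :
    ∃ S : (ℕ → ResidueField R) → R, ∀ f g, f ≠ g → ∃ k u, IsUnit u ∧ S f - S g = y ^ k * u := by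
  obtain ⟨σ, hσ⟩ := (residue_surjective (R := R)).hasRightInverse
  have key : ∀ f : ℕ → ResidueField R, ∃ L : R, ∀ n,
      (∑ i ∈ Finset.range n, σ (f i) * y ^ i) - L ∈ maximalIdeal R ^ n := by
    intro f
    obtain ⟨L, hL⟩ := IsPrecomplete.prec' (I := maximalIdeal R) (M := R)
      (fun n => ∑ i ∈ Finset.range n, σ (f i) * y ^ i) (by
        intro m n hmn
        rw [SModEq.sub_mem, smul_eq_mul, Ideal.mul_top, ← neg_mem_iff, neg_sub,
          Finset.sum_range_sub_sum_range hmn]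
        refine Ideal.sum_mem _ fun i hi => Ideal.mul_mem_left _ _ ?_
        exact Ideal.pow_le_pow_right (by simpa using (Finset.mem_filter.mp hi).2)
          (Ideal.pow_mem_pow hy i))
    refine ⟨L, fun n => ?_⟩
    simpa [SModEq.sub_mem] using hL n
  choose S hS using key
  have hrec : ∀ f, S f = σ (f 0) + y * S (fun i => f (i + 1)) := by
    intro f
    rw [← sub_eq_zero]
    refine IsHausdorff.haus' (I := maximalIdeal R) _ fun n => ?_
    rw [SModEq.sub_mem, smul_eq_mul, Ideal.mul_top, sub_zero]
    have h1 := hS f (n + 1)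
    have h2 := Ideal.mul_mem_left _ y (hS (fun i => f (i + 1)) n)
    have h3 := sub_mem h2 (Ideal.pow_le_pow_right (Nat.le_succ n) h1)
    rw [Finset.sum_range_succ'] at h3
    convert h3 using 1
    rw [mul_sub, Finset.mul_sum]
    have : ∀ i, y * (σ (f (i + 1)) * y ^ i) = σ (f (i + 1)) * y ^ (i + 1) := fun i => by ring
    simp only [this]
    ring
  have hres : ∀ f, residue R (S f) = f 0 := by
    intro f
    rw [hrec f, map_add, hσ, map_mul, (residue_eq_zero_iff y).mpr hy, zero_mul, add_zero]
  refine ⟨S, ?_⟩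
  have main : ∀ k f g, (∀ i < k, f i = g i) → f k ≠ g k →
      ∃ u, IsUnit u ∧ S f - S g = y ^ k * u := by
    intro k
    induction k with
    | zero =>
      intro f g _ h
      refine ⟨S f - S g, ?_, by simp⟩
      by_contra hu
      have : S f - S g ∈ maximalIdeal R := hu
      rw [← residue_eq_zero_iff, map_sub, hres, hres, sub_eq_zero] at this
      exact h this
    | succ k ih =>
      intro f g h1 h2
      obtain ⟨u, hu, h⟩ := ih (fun i => f (i + 1)) (fun i => g (i + 1))
        (fun i hi => h1 _ (by omega)) h2
      refine ⟨u, hu, ?_⟩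
      rw [hrec f, hrec g, h1 0 (by omega), pow_succ', mul_assoc, ← h]
      ring
  intro f g hfg
  have hex : ∃ k, f k ≠ g k := Function.ne_iff.mp hfg
  classical
  obtain ⟨u, hu⟩ := main (Nat.find hex) f g (fun i hi => not_not.mp (Nat.find_min hex hi))
    (Nat.find_spec hex)
  exact ⟨_, u, hu⟩

theorem aux_lower {R : Type*} [CommRing R] [IsNoetherianRing R] [IsLocalRing R]
    [IsAdicComplete (maximalIdeal R) R]
    {M : Type*} [AddCommGroup M] [Module R M] [Module.Finite R M]
    (hdim : 2 ≤ ringKrullDim (R ⧸ Module.annihilator R M)) :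
    ∃ F : (ℕ → ResidueField R) → Submodule R M, Function.Injective F := by
  obtain ⟨x, hx, y, hy, H⟩ := aux_params _ hdim
  obtain ⟨S, hS⟩ := aux_series y hy
  refine ⟨fun f => (x + S f * y) • (⊤ : Submodule R M), fun f g hfg => ?_⟩
  by_contra hne
  obtain ⟨k, u, hu, hk⟩ := hS f g hne
  refine H (x + S f * y) (add_mem hx (Ideal.mul_mem_left _ _ hy)) fun q hq hI hz => ?_
  have hyq : y ∈ q := by
    refine aux_supp (M := M) (x + S f * y) y (k + 1) (fun m => ?_) q hq hI hz
    obtain ⟨v, rfl⟩ := hu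
    have e : y ^ (k + 1) = (x + S f * y) * ↑v⁻¹ - (x + S g * y) * ↑v⁻¹ := by
      have : y ^ k = (S f - S g) * ↑v⁻¹ := by rw [hk, mul_assoc, Units.mul_inv, mul_one]
      rw [pow_succ, this]; ring
    rw [e, sub_smul, mul_smul, mul_smul]
    refine sub_mem (Submodule.smul_mem_pointwise_smul _ _ _ trivial) ?_
    dsimp only at hfg
    rw [hfg]
    exact Submodule.smul_mem_pointwise_smul _ _ _ trivial
  refine ⟨?_, hyq⟩
  have := sub_mem hz (Ideal.mul_mem_left _ (S f) hyq)
  simpa using this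

open Cardinal

theorem aux_card_ring (R : Type u) [CommRing R] [IsNoetherianRing R] [IsLocalRing R]
    [IsAdicComplete (maximalIdeal R) R] :
    #R ≤ #(ResidueField R) ^ ℵ₀ := by
  set β := #(ResidueField R) ^ ℵ₀ with hβ
  have h2 : 2 ≤ #(ResidueField R) := by
    rw [Cardinal.two_le_iff]; exact exists_pair_ne _
  have hβ0 : ℵ₀ ≤ β := by
    refine (Cardinal.cantor ℵ₀).le.trans (Cardinal.power_le_power_right h2)
  have hαβ : #(ResidueField R) ≤ β := by
    simpa using Cardinal.self_le_power (#(ResidueField R)) Cardinal.one_le_aleph0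
  obtain ⟨σ, hσ⟩ := (residue_surjective (R := R)).hasRightInverse
  have key : ∀ n, #(R ⧸ maximalIdeal R ^ n) ≤ β := by
    intro n
    induction n with
    | zero =>
      have : Subsingleton (R ⧸ maximalIdeal R ^ 0) := by
        rw [Ideal.Quotient.subsingleton_iff, pow_zero, Ideal.one_eq_top]
      exact (Cardinal.le_one_iff_subsingleton.mpr this).trans
        (Cardinal.one_le_aleph0.trans hβ0)
    | succ n ih =>
      obtain ⟨s, hs⟩ := IsNoetherian.noetherian (maximalIdeal R ^ n)
      let φ : (R ⧸ maximalIdeal R ^ n) × (s → ResidueField R) → R ⧸ maximalIdeal R ^ (n + 1) :=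
        fun p => Ideal.Quotient.mk _ (p.1.out + ∑ g : s, σ (p.2 g) * (g : R))
      have hφ : Function.Surjective φ := by
        intro z
        obtain ⟨z, rfl⟩ := Ideal.Quotient.mk_surjective z
        have hz : z - (Ideal.Quotient.mk (maximalIdeal R ^ n) z).out ∈ maximalIdeal R ^ n := by
          rw [← Ideal.Quotient.eq]
          exact (Quotient.out_eq' _).symm
        obtain ⟨c, hc⟩ := Submodule.mem_span_finset'.mp (hs.ge hz)
        refine ⟨(Ideal.Quotient.mk _ z, fun g => residue R (c g)), ?_⟩
        rw [eq_comm]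
        apply Ideal.Quotient.eq.mpr
        rw [← sub_sub, ← hc, ← Finset.sum_sub_distrib]
        refine Ideal.sum_mem _ fun g _ => ?_
        rw [smul_eq_mul, ← sub_mul, pow_succ']
        refine Ideal.mul_mem_mul ?_ ?_
        · rw [← residue_eq_zero_iff, map_sub, hσ, sub_self]
        · rw [← hs]; exact Submodule.subset_span g.2
      refine (Cardinal.mk_le_of_surjective hφ).trans ?_
      rw [Cardinal.mk_prod, Cardinal.lift_id, Cardinal.lift_id]
      refine Cardinal.mul_le_of_le hβ0 ih ?_
      rw [← Cardinal.power_def]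
      refine (Cardinal.power_le_power_right hαβ).trans ?_
      rw [Cardinal.mk_fintype]
      exact Cardinal.power_nat_le hβ0
  have hinj : Function.Injective (fun (r : R) (n : ℕ) => Ideal.Quotient.mk (maximalIdeal R ^ n) r) := by
    intro a b hab
    rw [← sub_eq_zero]
    refine IsHausdorff.haus' (I := maximalIdeal R) _ fun n => ?_
    rw [SModEq.sub_mem, smul_eq_mul, Ideal.mul_top, sub_zero]
    exact Ideal.Quotient.eq.mp (congrFun hab n)
  refine (Cardinal.mk_le_of_injective hinj).trans ?_
  rw [Cardinal.mk_pi]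
  refine (Cardinal.prod_le_prod _ (fun _ => β) key).trans ?_
  rw [Cardinal.prod_const]
  simp [hβ, ← Cardinal.power_mul]



/-- Let `R` be a complete noetherian local ring whose residue field has cardinality `α`, and
let `M` be a finitely generated `R`-module of Krull dimension at least two (i.e. the Krull
dimension of `R ⧸ Ann M` is at least 2).  Then `M` has exactly `α ^ ℵ₀` submodules; in
particular, if the residue field is countable then `M` has exactly `2^ℵ₀` submodules. -/
theorem card_submodules_of_dim_ge_two
    (R : Type u) [CommRing R] [IsNoetherianRing R] [IsLocalRing R]
    [IsAdicComplete (IsLocalRing.maximalIdeal R) R]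
    (M : Type v) [AddCommGroup M] [Module R M] [Module.Finite R M]
    (hdim : 2 ≤ ringKrullDim (R ⧸ Module.annihilator R M)) :
    Cardinal.lift.{u} (Cardinal.mk (Submodule R M)) =
        Cardinal.lift.{v} (Cardinal.mk (IsLocalRing.ResidueField R) ^ Cardinal.aleph0) ∧
      (Countable (IsLocalRing.ResidueField R) →
        Cardinal.mk (Submodule R M) = Cardinal.continuum) := by
  have h2 : 2 ≤ #(ResidueField R) := by
    rw [Cardinal.two_le_iff]; exact exists_pair_ne _
  have hβ0 : ℵ₀ ≤ #(ResidueField R) ^ ℵ₀ :=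
    (Cardinal.cantor ℵ₀).le.trans (Cardinal.power_le_power_right h2)
  have main : Cardinal.lift.{u} (Cardinal.mk (Submodule R M)) =
        Cardinal.lift.{v} (Cardinal.mk (IsLocalRing.ResidueField R) ^ Cardinal.aleph0) := by
    apply le_antisymm
    · have hM : Cardinal.lift.{u} #M ≤ Cardinal.lift.{v} (#(ResidueField R) ^ ℵ₀) := by
        obtain ⟨n, f, hf⟩ := Module.Finite.exists_fin' R M
        refine (Cardinal.lift_mk_le_lift_mk_of_surjective hf).trans ?_
        rw [Cardinal.lift_le, Cardinal.mk_pi, Cardinal.prod_const]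
        simp only [Cardinal.mk_fin, Cardinal.lift_natCast, Cardinal.lift_uzero]
        exact (Cardinal.power_le_power_right (aux_card_ring R)).trans (Cardinal.power_nat_le hβ0)
      have hL : Function.Surjective (fun l : List M => Submodule.span R {m | m ∈ l}) := by
        intro N
        obtain ⟨s, hs⟩ := IsNoetherian.noetherian N
        exact ⟨s.toList, by simpa using hs⟩
      refine (Cardinal.lift_le.mpr ((Cardinal.mk_le_of_surjective hL).trans
        (Cardinal.mk_list_le_max M))).trans ?_
      rw [Cardinal.lift_max]
      refine max_le ?_ hM
      rw [Cardinal.lift_aleph0, Cardinal.aleph0_le_lift]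
      exact hβ0
    · obtain ⟨F, hF⟩ := aux_lower (M := M) hdim
      have := Cardinal.lift_mk_le_lift_mk_of_injective hF
      simpa using this
  refine ⟨main, fun hc => ?_⟩
  have hcont : #(ResidueField R) ^ ℵ₀ = 𝔠 := by
    apply le_antisymm
    · rw [← Cardinal.aleph0_power_aleph0]
      exact Cardinal.power_le_power_right (Cardinal.mk_le_aleph0_iff.mpr hc)
    · rw [← Cardinal.two_power_aleph0]
      exact Cardinal.power_le_power_right h2
  rw [hcont, Cardinal.lift_continuum] at main
  rw [← Cardinal.lift_inj.{v, u}, main, Cardinal.lift_continuum]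
end

section
/- Let R be a complete noetherian local ring (a noetherian local ring complete in the topology defined by its maximal ideal) whose residue field has cardinality α, and let M be a finitely generated R-module with Krull dimension of R/Ann_R(M) at most 1. Suppose that for every non-maximal prime ideal P of R, (R/P)^2 is not isomorphic to a subquotient of M. Then M has at most max(α, ℵ₀) submodules. More precisely: if M is not meager and M is infinite, then M has exactly max(α, ℵ₀) submodules; if M is meager, then it has exactly ℵ₀ submodules when M has infinite length and finitely many submodules when M has finite length; and if M is finite as a set, it has finitely many submodules. -/
/-- An `R`-module `M` is meager if for every maximal ideal `𝔪` of `R`, `(R/𝔪)²` is not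
isomorphic to a subquotient of `M`. -/
def IsMeagerModule (R : Type u) [CommRing R]
    (M : Type v) [AddCommGroup M] [Module R M] : Prop :=
  ∀ 𝔪 : Ideal R, 𝔪.IsMaximal → ¬ IsSubquotientOf R ((R ⧸ 𝔪) × (R ⧸ 𝔪)) M

section Helpers

open IsLocalRing

variable {R : Type u} [CommRing R] {M : Type v} [AddCommGroup M] [Module R M]

theorem exists_prod_equiv_of_disjoint {P : Ideal R} {x y : M}
    (hx : ∀ r : R, r • x = 0 ↔ r ∈ P) (hy : ∀ r : R, r • y = 0 ↔ r ∈ P)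
    (hd : ∀ a b : R, a • x = b • y → a • x = 0) :
    ∃ Q : Submodule R M, Nonempty (((R ⧸ P) × (R ⧸ P)) ≃ₗ[R] Q) := by
  let f : (R ⧸ P) →ₗ[R] M := Submodule.liftQ P (LinearMap.toSpanSingleton R M x)
    (fun r hr => by simpa using (hx r).2 hr)
  let g : (R ⧸ P) →ₗ[R] M := Submodule.liftQ P (LinearMap.toSpanSingleton R M y)
    (fun r hr => by simpa using (hy r).2 hr)
  have hf : ∀ r : R, f (Submodule.Quotient.mk r) = r • x := fun _ => rfl
  have hg : ∀ r : R, g (Submodule.Quotient.mk r) = r • y := fun _ => rfl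
  have hinj : Function.Injective (f.coprod g) := by
    rw [← LinearMap.ker_eq_bot, LinearMap.ker_eq_bot']
    rintro ⟨a, b⟩ hab
    obtain ⟨a, rfl⟩ := Submodule.Quotient.mk_surjective _ a
    obtain ⟨b, rfl⟩ := Submodule.Quotient.mk_surjective _ b
    rw [LinearMap.coprod_apply] at hab
    simp only at hab
    rw [hf, hg] at hab
    have h1 : a • x = 0 := hd a (-b) (by rw [neg_smul]; exact eq_neg_of_add_eq_zero_left hab)
    have h2 : b • y = 0 := by rwa [h1, zero_add] at hab
    have h1' := (hx a).1 h1
    have h2' := (hy b).1 h2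
    ext1
    · exact (Submodule.Quotient.mk_eq_zero P).2 h1'
    · exact (Submodule.Quotient.mk_eq_zero P).2 h2'
  exact ⟨_, ⟨LinearEquiv.ofInjective _ hinj⟩⟩

theorem isMaximal_of_lt_of_dim {J P Q : Ideal R} (hdim : ringKrullDim (R ⧸ J) ≤ 1)
    (hP : P.IsPrime) (hQ : Q.IsPrime) (hJ : J ≤ P) (hPQ : P < Q) : Q.IsMaximal := by
  have h1 : Ring.KrullDimLE 1 (R ⧸ J) := Ring.krullDimLE_iff.2 (by exact_mod_cast hdim)
  have hs : Function.Surjective (Ideal.Quotient.mk J) := Ideal.Quotient.mk_surjective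
  have hJQ : J ≤ Q := hJ.trans hPQ.le
  have cP : (P.map (Ideal.Quotient.mk J)).comap (Ideal.Quotient.mk J) = P := by
    rw [Ideal.comap_map_mk hJ]
  have cQ : (Q.map (Ideal.Quotient.mk J)).comap (Ideal.Quotient.mk J) = Q := by
    rw [Ideal.comap_map_mk hJQ]
  have pP : (P.map (Ideal.Quotient.mk J)).IsPrime :=
    Ideal.map_isPrime_of_surjective hs (by simpa using hJ)
  have pQ : (Q.map (Ideal.Quotient.mk J)).IsPrime :=
    Ideal.map_isPrime_of_surjective hs (by simpa using hJQ)
  rcases Ring.krullDimLE_one_iff.1 h1 _ pQ with h | h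
  · exfalso
    have := h.2 ⟨pP, bot_le⟩ (Ideal.map_mono hPQ.le)
    have := Ideal.comap_mono (f := Ideal.Quotient.mk J) this
    rw [cP, cQ] at this
    exact absurd hPQ (not_lt_of_ge this)
  · rw [← cQ]
    exact Ideal.comap_isMaximal_of_surjective _ hs

theorem exists_pow_le_of_lt_of_dim [IsNoetherianRing R] [IsLocalRing R] {J P I : Ideal R}
    (hdim : ringKrullDim (R ⧸ J) ≤ 1) (hP : P.IsPrime) (hJ : J ≤ P) (hPI : P < I) :
    ∃ n : ℕ, maximalIdeal R ^ n ≤ I := by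
  apply Ideal.exists_pow_le_of_le_radical_of_fg _ (IsNoetherian.noetherian _)
  rw [Ideal.radical_eq_sInf]
  refine le_sInf ?_
  rintro Q ⟨hIQ, hQ⟩
  have := isMaximal_of_lt_of_dim hdim hP hQ hJ (lt_of_lt_of_le hPI hIQ)
  exact (eq_maximalIdeal this).ge

/-- The coinitial family of nonzero submodules. -/
theorem exists_coinitial_family [IsNoetherianRing R] [IsLocalRing R] [Module.Finite R M]
    {J : Ideal R} (hdim : ringKrullDim (R ⧸ J) ≤ 1)
    (hJ : ∀ r ∈ J, ∀ x : M, r • x = 0)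
    (hsq : ∀ P : Ideal R, P.IsPrime → ¬ P.IsMaximal →
      ¬ ∃ Q : Submodule R M, Nonempty (((R ⧸ P) × (R ⧸ P)) ≃ₗ[R] Q)) :
    ∃ (S : Type u) (f : S → Submodule R M),
      Cardinal.mk S ≤ max (Cardinal.mk (ResidueField R)) Cardinal.aleph0 ∧
      ∀ N : Submodule R M, N ≠ ⊥ → ∃ s, f s ≠ ⊥ ∧ f s ≤ N := by
  classical
  have hnoeth : IsNoetherian R M := isNoetherian_of_isNoetherianRing_of_finite R M
  let Soc : Submodule R M := Submodule.torsionBySet R M (maximalIdeal R : Set R)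
  have hSoc : ∀ x : M, x ∈ Soc ↔ ∀ r ∈ maximalIdeal R, r • x = 0 := by
    intro x
    simp [Soc, Submodule.mem_torsionBySet_iff]
  obtain ⟨n, b, hb⟩ := Submodule.fg_iff_exists_fin_generating_family.1
    (IsNoetherian.noetherian Soc)
  let A : Type u := { P : Ideal R // P ∈ associatedPrimes R M }
  have hA : Finite A := (associatedPrimes.finite R M).to_subtype
  have hy : ∀ P : A, ∃ y : M, ∀ r : R, r • y = 0 ↔ r ∈ P.1 := by
    rintro ⟨P, hP⟩
    obtain ⟨_, y, hy⟩ := isAssociatedPrime_iff.1 hP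
    exact ⟨y, fun r => by simp [hy, Submodule.mem_colon_singleton]⟩
  choose y hy using hy
  let out : ResidueField R → R := Function.surjInv residue_surjective
  have hout : ∀ c, residue R (out c) = c := Function.surjInv_eq residue_surjective
  refine ⟨(Fin n → ResidueField R) ⊕ (A × ℕ), Sum.elim
    (fun c => Submodule.span R {∑ i, out (c i) • b i})
    (fun p => (maximalIdeal R ^ p.2) • Submodule.span R {y p.1}), ?_, ?_⟩
  · rw [Cardinal.mk_sum, Cardinal.lift_id, Cardinal.lift_id]
    refine Cardinal.add_le_of_le (le_max_right _ _) ?_ ?_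
    · have hpow : Cardinal.mk (Fin n → ResidueField R) =
          Cardinal.mk (ResidueField R) ^ n := by simp
      rw [hpow, ← Cardinal.power_natCast]
      refine (Cardinal.power_le_power_right (le_max_left _ Cardinal.aleph0)).trans ?_
      exact Cardinal.power_nat_le (le_max_right _ _)
    · exact (Cardinal.mk_le_aleph0 (α := A × ℕ)).trans (le_max_right _ _)
  · intro N hN
    have : Nontrivial N := Submodule.nontrivial_iff_ne_bot.2 hN
    obtain ⟨P, hP⟩ := associatedPrimes.nonempty R N
    obtain ⟨hPp, ⟨x, hxN⟩, hx⟩ := isAssociatedPrime_iff.1 hP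
    have hx' : ∀ r : R, r • x = 0 ↔ r ∈ P := by
      intro r
      rw [hx, Submodule.mem_colon_singleton, Submodule.mem_bot, Subtype.ext_iff]
      rfl
    have hx0 : x ≠ 0 := by
      intro h
      apply hPp.ne_top
      rw [Ideal.eq_top_iff_one, ← hx', h, smul_zero]
    by_cases hmax : P.IsMaximal
    · have hPm := eq_maximalIdeal hmax
      have hxS : x ∈ Soc := (hSoc x).2 fun r hr => (hx' r).2 (hPm ▸ hr)
      rw [← hb] at hxS
      obtain ⟨c, hc⟩ := (Submodule.mem_span_range_iff_exists_fun R).1 hxS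
      have hbS : ∀ i, b i ∈ Soc := fun i => hb ▸ Submodule.subset_span ⟨i, rfl⟩
      have key : ∑ i, out (residue R (c i)) • b i = x := by
        rw [← hc]
        refine Finset.sum_congr rfl fun i _ => ?_
        rw [← sub_eq_zero, ← sub_smul]
        refine (hSoc _).1 (hbS i) _ ?_
        rw [← residue_eq_zero_iff, map_sub, hout, sub_self]
      refine ⟨Sum.inl fun i => residue R (c i), ?_, ?_⟩
      · simp only [Sum.elim_inl, key]
        simpa using hx0
      · simp only [Sum.elim_inl, key]
        simpa using hxN
    · have hPA : P ∈ associatedPrimes R M :=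
        associatedPrimes.subset_of_injective (f := N.subtype) N.injective_subtype hP
      let PA : A := ⟨P, hPA⟩
      have hyP : ∀ r : R, r • y PA = 0 ↔ r ∈ P := hy PA
      have hJP : J ≤ P := fun r hr => (hx' r).1 (hJ r hr x)
      have : ∃ a b : R, a • x = b • y PA ∧ a • x ≠ 0 := by
        by_contra hcon
        push Not at hcon
        exact hsq P hPp hmax (exists_prod_equiv_of_disjoint hx' hyP hcon)
      obtain ⟨a, b, hab, hne⟩ := this
      have hbP : b ∉ P := by
        rw [← hyP, ← hab]; exact hne
      have hlt : P < P ⊔ Ideal.span {b} := by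
        refine lt_of_le_of_ne le_sup_left fun h => hbP ?_
        rw [h]
        exact Ideal.mem_sup_right (Ideal.mem_span_singleton_self b)
      obtain ⟨k, hk⟩ := exists_pow_le_of_lt_of_dim hdim hPp hJP hlt
      refine ⟨Sum.inr (PA, k), ?_, ?_⟩
      · simp only [Sum.elim_inr]
        intro h
        apply hmax
        have hle : maximalIdeal R ^ k ≤ P := by
          intro r hr
          rw [← hyP]
          have := Submodule.smul_mem_smul hr (Submodule.mem_span_singleton_self (R := R) (y PA))
          rw [h] at this
          simpa using this
        have hle' := hPp.le_of_pow_le hle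
        rw [(le_maximalIdeal hPp.ne_top).antisymm hle']
        infer_instance
      · simp only [Sum.elim_inr]
        rw [Submodule.smul_le]
        intro r hr z hz
        obtain ⟨c, rfl⟩ := Submodule.mem_span_singleton.1 hz
        obtain ⟨p, hp, q, hq, rfl⟩ := Submodule.mem_sup.1 (hk hr)
        obtain ⟨d, rfl⟩ := Ideal.mem_span_singleton'.1 hq
        have : (p + d * b) • c • y PA = (c * d * a) • x := by
          rw [smul_comm, add_smul, (hyP p).2 hp, zero_add, mul_smul d b, ← hab]
          simp only [smul_smul, mul_assoc]
        rw [this]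
        exact N.smul_mem _ hxN

theorem exists_cover_Ici [IsNoetherianRing R] [IsLocalRing R] [Module.Finite R M]
    (hdim : ringKrullDim (R ⧸ Module.annihilator R M) ≤ 1)
    (hsq : ∀ P : Ideal R, P.IsPrime → ¬ P.IsMaximal →
      ¬ IsSubquotientOf R ((R ⧸ P) × (R ⧸ P)) M) (N : Submodule R M) :
    ∃ (S : Type u) (f : S → Submodule R M),
      Cardinal.mk S ≤ max (Cardinal.mk (ResidueField R)) Cardinal.aleph0 ∧
      ∀ L : Submodule R M, N ≤ L → ∃ s, f s = L := by
  classical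
  have hnoeth : IsNoetherian R M := isNoetherian_of_isNoetherianRing_of_finite R M
  induction N using WellFoundedGT.induction with
  | ind N ih =>
  obtain ⟨S, f, hS, hf⟩ := exists_coinitial_family (M := M ⧸ N) hdim
    (by
      intro r hr x
      obtain ⟨x, rfl⟩ := Submodule.Quotient.mk_surjective _ x
      rw [← Submodule.Quotient.mk_smul, Module.mem_annihilator.1 hr x, Submodule.Quotient.mk_zero])
    (fun P hP hm hQ => hsq P hP hm ⟨N, hQ⟩)
  have key : ∀ s : S, ∃ (T : Type u) (g : T → Submodule R M),
      Cardinal.mk T ≤ max (Cardinal.mk (ResidueField R)) Cardinal.aleph0 ∧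
      (f s ≠ ⊥ → ∀ L : Submodule R M, (f s).comap N.mkQ ≤ L → ∃ t, g t = L) := by
    intro s
    by_cases hs : f s = ⊥
    · exact ⟨PEmpty, PEmpty.elim, by simp, fun h => absurd hs h⟩
    · have hlt : N < (f s).comap N.mkQ := by
        refine lt_of_le_of_ne (Submodule.le_comap_mkQ N _) fun h => hs ?_
        have := congrArg (Submodule.map N.mkQ) h
        rw [Submodule.map_comap_eq_of_surjective N.mkQ_surjective, Submodule.mkQ_map_self] at this
        exact this.symm
      obtain ⟨T, g, hT, hg⟩ := ih _ hlt
      exact ⟨T, g, hT, fun _ => hg⟩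
  choose T g hT hg using key
  refine ⟨Option (Σ s, T s), fun o => o.elim N fun p => g p.1 p.2, ?_, ?_⟩
  · rw [Cardinal.mk_option, Cardinal.mk_sigma]
    refine Cardinal.add_le_of_le (le_max_right _ _) ?_
      (Cardinal.one_le_aleph0.trans (le_max_right _ _))
    refine (Cardinal.sum_le_sum _ _ hT).trans ?_
    rw [Cardinal.sum_const']
    exact Cardinal.mul_le_of_le (le_max_right _ _) hS le_rfl
  · intro L hL
    by_cases h : L.map N.mkQ = ⊥
    · refine ⟨none, ?_⟩
      refine le_antisymm hL ?_
      rw [← le_bot_iff, Submodule.map_le_iff_le_comap, Submodule.comap_bot, Submodule.ker_mkQ] at h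
      exact h
    · obtain ⟨s, hs, hle⟩ := hf _ h
      have h2 : (f s).comap N.mkQ ≤ L := by
        refine (Submodule.comap_mono hle).trans ?_
        rw [Submodule.comap_map_mkQ]
        exact sup_le hL le_rfl
      obtain ⟨t, ht⟩ := hg s hs L h2
      exact ⟨some ⟨s, t⟩, ht⟩

/-- In a meager module, any element of `L` outside `𝔪 L` generates `L`. -/
theorem le_span_of_meager [IsNoetherianRing R] [IsLocalRing R] [Module.Finite R M]
    (hM : IsMeagerModule R M) (L : Submodule R M) {x : M} (hxL : x ∈ L)
    (hx : x ∉ maximalIdeal R • L) : L ≤ Submodule.span R {x} := by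
  have hnoeth : IsNoetherian R M := isNoetherian_of_isNoetherianRing_of_finite R M
  refine Submodule.le_of_le_smul_of_le_jacobson_bot (I := maximalIdeal R)
    (IsNoetherian.noetherian L) (maximalIdeal_le_jacobson _) ?_
  intro y hyL
  by_contra hcon
  set K := maximalIdeal R • L with hK
  have ann : ∀ z ∈ L, z ∉ K → ∀ r : R, r • (K.mkQ z) = 0 ↔ r ∈ maximalIdeal R := by
    intro z hz hzK r
    rw [← map_smul, Submodule.mkQ_apply, Submodule.Quotient.mk_eq_zero]
    constructor
    · intro h
      by_contra hr
      have hu : IsUnit r := by simpa using hr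
      exact hzK ((Submodule.smul_mem_iff_of_isUnit K hu).1 h)
    · intro h
      exact Submodule.smul_mem_smul h hz
  have hyK : y ∉ K := fun h => hcon (Submodule.mem_sup_right h)
  refine hM (maximalIdeal R) inferInstance ⟨K, exists_prod_equiv_of_disjoint
    (ann x hxL hx) (ann y hyL hyK) ?_⟩
  intro a b hab
  by_contra hne
  have hb : b ∉ maximalIdeal R := by
    rw [← ann y hyL hyK, ← hab]; exact hne
  have hu : IsUnit b := by simpa using hb
  apply hcon
  rw [← Submodule.smul_mem_iff_of_isUnit _ hu]
  have h1 : b • y - a • x ∈ K := by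
    rw [← Submodule.Quotient.mk_eq_zero, ← Submodule.mkQ_apply, map_sub, map_smul, map_smul, hab,
      sub_self]
  have h2 : b • y = a • x + (b • y - a • x) := by abel
  rw [h2]
  exact Submodule.add_mem_sup (Submodule.smul_mem _ _ (Submodule.mem_span_singleton_self x)) h1

theorem eq_pow_smul_of_meager [IsNoetherianRing R] [IsLocalRing R] [Module.Finite R M]
    (hM : IsMeagerModule R M) (N : Submodule R M) (hN : N ≠ ⊥) :
    ∃ n : ℕ, maximalIdeal R ^ n • (⊤ : Submodule R M) = N := by
  by_contra hcon
  push Not at hcon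
  apply hN
  have hle : ∀ n : ℕ, N ≤ maximalIdeal R ^ n • (⊤ : Submodule R M) := by
    intro n
    induction n with
    | zero => simp
    | succ n ih =>
      intro x hx
      by_contra hx2
      rw [pow_succ', mul_smul] at hx2
      have := le_span_of_meager hM _ (ih hx) hx2
      exact hcon n (le_antisymm (this.trans ((Submodule.span_singleton_le_iff_mem _ _).2 hx)) ih)
  have h := Ideal.iInf_pow_smul_eq_bot_of_isLocalRing (M := M) (maximalIdeal R)
    (Ideal.IsPrime.ne_top inferInstance)
  rw [eq_bot_iff, ← h]
  exact le_iInf hle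

/-- If the powers of the maximal ideal stabilise on `M` then they vanish. -/
theorem pow_smul_eq_bot_of_eq [IsNoetherianRing R] [IsLocalRing R] [Module.Finite R M]
    {i j : ℕ} (hij : i < j)
    (h : maximalIdeal R ^ i • (⊤ : Submodule R M) = maximalIdeal R ^ j • (⊤ : Submodule R M)) :
    maximalIdeal R ^ i • (⊤ : Submodule R M) = ⊥ := by
  have hnoeth : IsNoetherian R M := isNoetherian_of_isNoetherianRing_of_finite R M
  refine Submodule.eq_bot_of_le_smul_of_le_jacobson_bot (maximalIdeal R) _
    (IsNoetherian.noetherian _) ?_ (maximalIdeal_le_jacobson _)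
  rw [← mul_smul, ← pow_succ']
  nth_rewrite 1 [h]
  exact Submodule.smul_mono_left (Ideal.pow_le_pow_right hij)

theorem exists_pow_smul_eq_bot_of_finite [IsNoetherianRing R] [IsLocalRing R] [Module.Finite R M]
    [IsArtinian R M] : ∃ n : ℕ, maximalIdeal R ^ n • (⊤ : Submodule R M) = ⊥ := by
  obtain ⟨n, hn⟩ := IsArtinian.monotone_stabilizes (R := R) (M := M)
    ⟨fun n => OrderDual.toDual (maximalIdeal R ^ n • (⊤ : Submodule R M)), fun i j hij =>
      Submodule.smul_mono_left (Ideal.pow_le_pow_right hij)⟩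
  exact ⟨n, pow_smul_eq_bot_of_eq (Nat.lt_succ_self n) (hn (n + 1) (Nat.le_succ n))⟩

theorem lift_residueField_le_of_not_meager [IsLocalRing R]
    (hM : ¬ IsMeagerModule R M) :
    Cardinal.lift.{v} (Cardinal.mk (ResidueField R)) ≤
      Cardinal.lift.{u} (Cardinal.mk (Submodule R M)) := by
  unfold IsMeagerModule at hM
  push Not at hM
  obtain ⟨m, hm, N, P, ⟨e⟩⟩ := hM
  obtain rfl := eq_maximalIdeal hm
  let F : (R ⧸ maximalIdeal R) → Submodule R M := fun c =>
    (((Submodule.span R {((1 : R ⧸ maximalIdeal R), c)}).map e.toLinearMap).map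
      P.subtype).comap N.mkQ
  refine Cardinal.lift_mk_le_lift_mk_of_injective (f := F) ?_
  intro (c : R ⧸ maximalIdeal R) (d : R ⧸ maximalIdeal R) hcd
  have h1 := Submodule.comap_injective_of_surjective N.mkQ_surjective hcd
  have h2 := Submodule.map_injective_of_injective P.injective_subtype h1
  have h3 := Submodule.map_injective_of_injective e.injective h2
  have h4 : ((1 : R ⧸ maximalIdeal R), c) ∈
      Submodule.span R {((1 : R ⧸ maximalIdeal R), d)} := by
    rw [← h3]; exact Submodule.mem_span_singleton_self _
  obtain ⟨a, ha⟩ := Submodule.mem_span_singleton.1 h4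
  rw [Prod.smul_mk, Prod.mk.injEq] at ha
  obtain ⟨ha1, ha2⟩ := ha
  rw [← ha2, ← one_mul d, ← smul_mul_assoc, ha1]

theorem infinite_submodule_of_not_meager [IsNoetherianRing R] [IsLocalRing R] [Module.Finite R M]
    (hM : ¬ IsMeagerModule R M) (hinf : Infinite M) : Infinite (Submodule R M) := by
  by_contra hfin
  rw [not_infinite_iff_finite] at hfin
  have hart : IsArtinian R M := ⟨Finite.wellFounded_of_trans_of_irrefl _⟩
  have hk : Finite (ResidueField R) := by
    have h := lift_residueField_le_of_not_meager hM
    rw [← Cardinal.lt_aleph0_iff_finite, ← Cardinal.lift_lt_aleph0.{u, v}]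
    refine h.trans_lt ?_
    rw [Cardinal.lift_lt_aleph0]
    exact Cardinal.lt_aleph0_iff_finite.2 hfin
  have hk' : Finite (R ⧸ maximalIdeal R) := hk
  obtain ⟨n, hn⟩ := exists_pow_smul_eq_bot_of_finite (R := R) (M := M)
  have h1 : Finite (R ⧸ maximalIdeal R ^ n) :=
    Ideal.finite_quotient_pow (IsNoetherian.noetherian _) n
  have h0 : Finite (M ⧸ (⊤ : Submodule R M)) := inferInstance
  have h2 : Finite (M ⧸ (maximalIdeal R ^ n • (⊤ : Submodule R M))) :=
    Submodule.finite_quotient_smul _ Module.Finite.fg_top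
  rw [hn] at h2
  have h3 : Finite M := Finite.of_equiv _ (Submodule.quotEquivOfEqBot (⊥ : Submodule R M) rfl).toEquiv
  exact not_finite M

end Helpers

/-- Let `R` be a complete noetherian local ring whose residue field has cardinality `α`, and
`M` a finitely generated `R`-module with `dim (R ⧸ Ann M) ≤ 1` such that for every
non-maximal prime `P`, `(R/P)²` is not a subquotient of `M`.  Then `M` has at most
`max (α, ℵ₀)` submodules; if moreover `M` is not meager and infinite it has exactly
`max (α, ℵ₀)` submodules; if `M` is meager it has exactly `ℵ₀` submodules when its length is
infinite and finitely many when its length is finite; and if `M` is finite it has finitely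
many submodules. -/
theorem card_submodules_le_of_no_square_subquotient
    (R : Type u) [CommRing R] [IsNoetherianRing R] [IsLocalRing R]
    [IsAdicComplete (IsLocalRing.maximalIdeal R) R]
    (M : Type v) [AddCommGroup M] [Module R M] [Module.Finite R M]
    (hdim : ringKrullDim (R ⧸ Module.annihilator R M) ≤ 1)
    (hsq : ∀ P : Ideal R, P.IsPrime → ¬ P.IsMaximal →
      ¬ IsSubquotientOf R ((R ⧸ P) × (R ⧸ P)) M) :
    Cardinal.lift.{u} (Cardinal.mk (Submodule R M)) ≤
        Cardinal.lift.{v}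
          (max (Cardinal.mk (IsLocalRing.ResidueField R)) Cardinal.aleph0) ∧
      (¬ IsMeagerModule R M → Infinite M →
        Cardinal.lift.{u} (Cardinal.mk (Submodule R M)) =
          Cardinal.lift.{v}
            (max (Cardinal.mk (IsLocalRing.ResidueField R)) Cardinal.aleph0)) ∧
      (IsMeagerModule R M →
        (¬ IsFiniteLength R M →
          Cardinal.mk (Submodule R M) = Cardinal.aleph0) ∧
        (IsFiniteLength R M → Finite (Submodule R M))) ∧
      (Finite M → Finite (Submodule R M)) := by
  have hle : Cardinal.lift.{u} (Cardinal.mk (Submodule R M)) ≤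
      Cardinal.lift.{v}
        (max (Cardinal.mk (IsLocalRing.ResidueField R)) Cardinal.aleph0) := by
    obtain ⟨S, f, hS, hf⟩ := exists_cover_Ici hdim hsq ⊥
    have hsurj : Function.Surjective f := fun L => hf L bot_le
    exact (Cardinal.lift_mk_le_lift_mk_of_surjective hsurj).trans (Cardinal.lift_le.2 hS)
  refine ⟨hle, ?_, ?_, ?_⟩
  · intro hM hinf
    refine le_antisymm hle ?_
    rw [Cardinal.lift_max, max_le_iff]
    refine ⟨lift_residueField_le_of_not_meager hM, ?_⟩
    have := infinite_submodule_of_not_meager hM hinf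
    rw [Cardinal.lift_aleph0, Cardinal.aleph0_le_lift]
    exact Cardinal.aleph0_le_mk _
  · intro hM
    let g : Option ℕ → Submodule R M := fun o => o.elim ⊥ fun n =>
      IsLocalRing.maximalIdeal R ^ n • (⊤ : Submodule R M)
    have hg : Function.Surjective g := by
      intro N
      by_cases hN : N = ⊥
      · exact ⟨none, hN.symm⟩
      · obtain ⟨n, hn⟩ := eq_pow_smul_of_meager hM N hN
        exact ⟨some n, hn⟩
    have hnoeth : IsNoetherian R M := isNoetherian_of_isNoetherianRing_of_finite R M
    constructor
    · intro hlen
      have hc : Countable (Submodule R M) := hg.countable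
      have hi : Infinite (Submodule R M) := by
        by_contra hfin
        rw [not_infinite_iff_finite] at hfin
        have hart : IsArtinian R M := ⟨Finite.wellFounded_of_trans_of_irrefl _⟩
        exact hlen (isFiniteLength_iff_isNoetherian_isArtinian.2 ⟨hnoeth, hart⟩)
      exact Cardinal.mk_eq_aleph0 _
    · intro hlen
      have hart := (isFiniteLength_iff_isNoetherian_isArtinian.1 hlen).2
      obtain ⟨k, hk⟩ := exists_pow_smul_eq_bot_of_finite (R := R) (M := M)
      have hfin : (g '' (insert none (some '' Set.Iic k))).Finite :=
        (((Set.finite_Iic k).image _).insert _).image _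
      rw [← Set.finite_univ_iff]
      refine hfin.subset ?_
      intro N _
      obtain ⟨o, rfl⟩ := hg N
      rcases o with _ | n
      · exact ⟨none, by simp, rfl⟩
      · by_cases hn : n ≤ k
        · exact ⟨some n, by simpa using hn, rfl⟩
        · refine ⟨none, by simp, ?_⟩
          symm
          change IsLocalRing.maximalIdeal R ^ n • (⊤ : Submodule R M) = ⊥
          rw [eq_bot_iff, ← hk]
          exact Submodule.smul_mono_left (Ideal.pow_le_pow_right (not_le.1 hn).le)
  · intro _
    infer_instance
end

section
/- Let A be a noetherian commutative ring. Then every finitely discriminable A-module is artinian. Moreover, the converse (every artinian A-module is finitely discriminable) holds if and only if every simple A-module is finite. -/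
/-- An `A`-module `M` is finitely discriminable if there are finitely many nonzero
submodules `M₁, …, M_k` of `M` such that every nonzero submodule of `M` contains some
`M_i`. -/
def FinitelyDiscriminable (A : Type u) [CommRing A]
    (M : Type v) [AddCommGroup M] [Module A M] : Prop :=
  ∃ s : Finset (Submodule A M), (∀ N ∈ s, N ≠ ⊥) ∧
    ∀ N : Submodule A M, N ≠ ⊥ → ∃ P ∈ s, P ≤ N

theorem FD.double_chain {α : Type*} [PartialOrder α] [WellFoundedLT α] (L : ℕ → ℕ → α)
    (hL : ∀ i i' j j', i ≤ i' → j ≤ j' → L i' j' ≤ L i j) :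
    ∃ j₀, ∀ i j, j₀ ≤ j → L i j = L i j₀ := by
  have stab : ∀ f : ℕ → α, Antitone f → ∃ n, ∀ m, n ≤ m → f m = f n := by
    intro f hf
    obtain ⟨n, hn⟩ := exists_minimal_of_wellFoundedLT (fun a => a ∈ Set.range f) ⟨f 0, 0, rfl⟩
    obtain ⟨⟨k, rfl⟩, hk⟩ := hn
    exact ⟨k, fun m hm => le_antisymm (hf hm) (hk ⟨m, rfl⟩ (hf hm))⟩
  obtain ⟨n, hn⟩ := stab (fun i => L i i) (fun a b h => hL _ _ _ _ h h)
  choose f hf using fun i => stab (fun j => L i j) (fun a b h => hL _ _ _ _ le_rfl h)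
  have key : ∀ i j, n ≤ i → n ≤ j → L i j = L n n := by
    intro i j hi hj
    refine le_antisymm (hL _ _ _ _ hi hj) ?_
    rw [← hn (max i j) (hi.trans (le_max_left _ _))]
    exact hL _ _ _ _ (le_max_left _ _) (le_max_right _ _)
  refine ⟨n + ∑ i ∈ Finset.range n, f i, fun i j hj => ?_⟩
  by_cases hi : n ≤ i
  · rw [key i j hi (by omega), key i _ hi (by omega)]
  · have : f i ≤ ∑ i ∈ Finset.range n, f i :=
      Finset.single_le_sum (fun _ _ => Nat.zero_le _) (Finset.mem_range.2 (by omega))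
    exact (hf i j (by omega)).trans (hf i _ (by omega)).symm

theorem FD.artinian_step {A : Type*} [CommRing A] {M : Type*} [AddCommGroup M] [Module A M]
    (x : A) (hx : ∀ y : M, ∃ n : ℕ, x ^ n • y = 0)
    (h : IsArtinian A (Submodule.torsionBy A M x)) : IsArtinian A M := by
  rw [← monotone_stabilizes_iff_artinian]
  intro N
  have hN : ∀ i j, i ≤ j → (OrderDual.ofDual (N j) : Submodule A M) ≤ OrderDual.ofDual (N i) :=
    fun i j hij => N.monotone hij
  let L : ℕ → ℕ → Submodule A (Submodule.torsionBy A M x) := fun i j =>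
    ((OrderDual.ofDual (N j)).map (LinearMap.lsmul A M (x ^ i))).comap
      (Submodule.torsionBy A M x).subtype
  have hL : ∀ i i' j j', i ≤ i' → j ≤ j' → L i' j' ≤ L i j := by
    intro i i' j j' hi hj y hy
    obtain ⟨z, hz, hzy⟩ := hy
    refine ⟨x ^ (i' - i) • z, Submodule.smul_mem _ _ (hN _ _ hj hz), ?_⟩
    rw [← hzy]
    simp only [LinearMap.lsmul_apply, smul_smul, ← pow_add]
    congr 2
    omega
  obtain ⟨j₀, hj₀⟩ := FD.double_chain L hL
  refine ⟨j₀, fun j hj => ?_⟩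
  have key : ∀ n : ℕ, ∀ y ∈ OrderDual.ofDual (N j₀), x ^ n • y = 0 → y ∈ OrderDual.ofDual (N j) := by
    intro n
    induction n with
    | zero =>
      intro y _ h0
      have : y = 0 := by simpa using h0
      rw [this]
      exact Submodule.zero_mem _
    | succ i ih =>
      intro y hy h0
      have hm : x ^ i • y ∈ Submodule.torsionBy A M x := by
        rw [Submodule.mem_torsionBy_iff, smul_smul, ← pow_succ']
        exact h0
      have h1 : (⟨x ^ i • y, hm⟩ : Submodule.torsionBy A M x) ∈ L i j₀ := ⟨y, hy, rfl⟩
      rw [← hj₀ i j hj] at h1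
      obtain ⟨z, hz, hzy⟩ := h1
      have hzy' : x ^ i • z = x ^ i • y := hzy
      have := ih (y - z) (Submodule.sub_mem _ hy (hN _ _ hj hz)) (by rw [smul_sub, hzy', sub_self])
      simpa using Submodule.add_mem _ this hz
  apply le_antisymm
  · exact hN _ _ hj |> fun h => h
  · intro y hy
    obtain ⟨n, hn⟩ := hx y
    exact key n y hy hn

theorem FD.artinian_finset {A : Type*} [CommRing A] (F : Finset A) :
    ∀ {M : Type v} [AddCommGroup M] [Module A M]
    (_ : ∀ x ∈ F, ∀ y : M, ∃ n : ℕ, x ^ n • y = 0)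
    (_ : IsArtinian A (Submodule.torsionBySet A M (F : Set A))), IsArtinian A M := by
  classical
  induction F using Finset.induction_on with
  | empty =>
    intro M _ _ _ h
    refine isArtinian_of_injective
      (LinearMap.codRestrict (Submodule.torsionBySet A M ((∅ : Finset A) : Set A))
        LinearMap.id ?_) ?_
    · intro y
      simp [Submodule.mem_torsionBySet_iff]
    · intro a b hab
      simpa using congrArg Subtype.val hab
  | insert a F ha ih =>
    intro M _ _ hx h
    refine FD.artinian_step a (hx a (Finset.mem_insert_self _ _)) (ih ?_ ?_)
    · intro x hxF y
      obtain ⟨n, hn⟩ := hx x (Finset.mem_insert_of_mem hxF) y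
      exact ⟨n, Subtype.ext hn⟩
    · refine isArtinian_of_injective
        (LinearMap.codRestrict (Submodule.torsionBySet A M ((insert a F : Finset A) : Set A))
          ((Submodule.torsionBy A M a).subtype ∘ₗ (Submodule.subtype _)) ?_) ?_
      · rintro ⟨⟨y, hy⟩, hy'⟩
        rw [Submodule.mem_torsionBySet_iff] at hy' ⊢
        rintro ⟨b, hb⟩
        rcases Finset.mem_insert.1 hb with rfl | hb
        · exact hy
        · exact congrArg Subtype.val (hy' ⟨b, hb⟩)
      · intro y z hyz
        have h1 : ((y : Submodule.torsionBy A M a) : M) = ((z : Submodule.torsionBy A M a) : M) := by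
          have h0 := congrArg Subtype.val hyz
          exact h0
        exact Subtype.ext (Subtype.ext h1)

theorem FD.mem_of_maximal {A : Type*} [CommRing A] {M : Type*} [AddCommGroup M] [Module A M]
    (m : Ideal A) [hm : m.IsMaximal] (y : M) (hy : y ∈ Submodule.torsionBySet A M (m : Set A))
    (P : Submodule A M) (hP : P ≠ ⊥) (hPy : P ≤ Submodule.span A {y}) : y ∈ P := by
  obtain ⟨z, hz, hz0⟩ := Submodule.exists_mem_ne_zero_of_ne_bot hP
  obtain ⟨a, rfl⟩ := Submodule.mem_span_singleton.1 (hPy hz)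
  rw [Submodule.mem_torsionBySet_iff] at hy
  have ha : a ∉ m := fun h => hz0 (hy ⟨a, h⟩)
  obtain ⟨b, i, hi, hbi⟩ := hm.exists_inv ha
  have : y = b • (a • y) := by
    have h1 : (b * a + i) • y = y := by rw [hbi, one_smul]
    rw [add_smul, hy ⟨i, hi⟩, add_zero, mul_smul] at h1
    exact h1.symm
  rw [this]
  exact P.smul_mem _ hz

theorem FD.artinian {A : Type*} [CommRing A] [IsNoetherianRing A]
    {M : Type*} [AddCommGroup M] [Module A M] (h : FinitelyDiscriminable A M) :
    IsArtinian A M := by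
  classical
  obtain ⟨s, hs0, hs⟩ := h
  let t := s.filter (fun P => IsAtom P)
  have ht : ∀ N : Submodule A M, N ≠ ⊥ → ∃ P ∈ t, P ≤ N := by
    intro N hN
    obtain ⟨P, hP, hPN⟩ := hs N hN
    obtain ⟨Q, hQP, hQ⟩ := s.exists_le_minimal hP
    refine ⟨Q, Finset.mem_filter.2 ⟨hQ.1, hs0 Q hQ.1, ?_⟩, hQP.trans hPN⟩
    intro R hR
    by_contra hR0
    obtain ⟨P', hP', hP'R⟩ := hs R hR0
    exact absurd ((hQ.2 hP' (hP'R.trans hR.le)).trans hP'R) (not_le_of_gt hR)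
  have htA : ∀ P ∈ t, IsAtom P := fun P hP => (Finset.mem_filter.1 hP).2
  have htS : ∀ P ∈ t, IsSimpleModule A P := fun P hP =>
    isSimpleModule_iff_isAtom.2 (Finset.mem_filter.1 hP).2
  let ms : Finset (Ideal A) := t.image (fun P : Submodule A M => Module.annihilator A P)
  have hms : ∀ m ∈ ms, m.IsMaximal := by
    intro m hm
    obtain ⟨P, hP, rfl⟩ := Finset.mem_image.1 hm
    have := htS P hP
    exact IsSimpleModule.annihilator_isMaximal
  have hmem : ∀ P ∈ t, Module.annihilator A P ∈ ms := fun P hP =>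
    Finset.mem_image.2 ⟨P, hP, rfl⟩
  clear_value ms t
  obtain ⟨I, hIdef⟩ : ∃ I : Ideal A, I = ⨅ m ∈ ms, m := ⟨_, rfl⟩
  have hIle : ∀ P ∈ t, I ≤ Module.annihilator A P := by
    intro P hP
    rw [hIdef]
    exact (iInf_le _ (Module.annihilator A P)).trans (iInf_le _ (hmem P hP))
  obtain ⟨F, hF⟩ : I.FG := IsNoetherian.noetherian I
  refine FD.artinian_finset F ?_ ?_
  · intro x hxF y
    have hxI : x ∈ I := hF ▸ Submodule.subset_span hxF
    let f : Module.End A (Submodule.span A {y}) := LinearMap.lsmul A _ x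
    have hf : ∀ n (z : Submodule.span A {y}), ((f ^ n) z : M) = x ^ n • (z : M) := by
      intro n
      induction n with
      | zero => intro z; simp
      | succ n ih =>
        intro z
        rw [pow_succ', Module.End.mul_apply, pow_succ', mul_smul, ← ih]
        rfl
    obtain ⟨n, hn⟩ := Filter.eventually_atTop.1 f.eventually_disjoint_ker_pow_range_pow
    have hd := hn (n + 1) (by omega)
    refine ⟨n + 1, ?_⟩
    by_contra hne
    have hy : y ∈ Submodule.span A {y} := Submodule.mem_span_singleton_self y
    obtain ⟨P, hP, hPle⟩ := ht (Submodule.span A {x ^ (n + 1) • y})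
      (by simpa [Submodule.span_singleton_eq_bot] using hne)
    have hP0 : P ≠ ⊥ := (htA P hP).1
    obtain ⟨z, hz, hz0⟩ := Submodule.exists_mem_ne_zero_of_ne_bot hP0
    obtain ⟨a, rfl⟩ := Submodule.mem_span_singleton.1 (hPle hz)
    have hxz : x • (a • x ^ (n + 1) • y) = 0 := by
      have h1 : x ∈ Module.annihilator A P := by
        exact hIle P hP hxI
      exact congrArg Subtype.val (Module.mem_annihilator.1 h1 ⟨_, hz⟩)
    have hw := Submodule.disjoint_def.1 hd ((f ^ (n + 1)) (a • ⟨y, hy⟩)) ?_ ⟨_, rfl⟩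
    · apply hz0
      have := congrArg Subtype.val hw
      rw [hf] at this
      rw [smul_comm]
      exact this
    · rw [LinearMap.mem_ker]
      apply Subtype.ext
      rw [hf, hf]
      change x ^ (n + 1) • x ^ (n + 1) • a • y = 0
      rw [smul_comm _ a y, pow_succ, mul_smul, ← pow_succ, hxz, smul_zero]
  · rw [Submodule.torsionBySet_eq_torsionBySet_span, hF]
    have hart : IsArtinian A (⨆ P : t, (P : Submodule A M) : Submodule A M) := by
      have : ∀ P : t, IsArtinian A (P : Submodule A M) := fun P => by
        have := htS P P.2
        infer_instance
      infer_instance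
    refine isArtinian_of_le (t := ⨆ P : t, (P : Submodule A M)) ?_
    have hI := Submodule.iSup_torsionBySet_ideal_eq_torsionBySet_iInf (R := A) (M := M)
      (S := ms) (p := fun m => m) (fun m hm m' hm' hne =>
        Ideal.IsMaximal.coprime_of_ne (hms m hm) (hms m' hm') hne)
    rw [hIdef, ← hI]
    refine iSup₂_le fun m hm y hy => ?_
    by_cases hy0 : y = 0
    · rw [hy0]
      exact Submodule.zero_mem _
    obtain ⟨P, hP, hPle⟩ := ht (Submodule.span A {y}) (by simpa using hy0)
    have := hms m hm
    exact (le_iSup (fun P : t => (P : Submodule A M)) ⟨P, hP⟩)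
      (FD.mem_of_maximal m y hy P (htA P hP).1 hPle)

theorem FD.finite_of_isFiniteLength {A : Type*} [CommRing A]
    (hA : ∀ (S : Type v) [AddCommGroup S] [Module A S], IsSimpleModule A S → Finite S)
    (M : Type v) [AddCommGroup M] [Module A M] (h : IsFiniteLength A M) : Finite M := by
  induction h with
  | of_subsingleton => infer_instance
  | @of_simple_quotient M _ _ N hq _ ih =>
    have := hA (M ⧸ N) hq
    have h1 : Finite ((M ⧸ N.toAddSubgroup) × N.toAddSubgroup) := by
      have h2 : Finite (M ⧸ N.toAddSubgroup) := this
      have h3 : Finite N.toAddSubgroup := ih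
      infer_instance
    exact Finite.of_equiv _ N.toAddSubgroup.addGroupEquivQuotientProdAddSubgroup.symm

theorem FD.of_artinian {A : Type*} [CommRing A]
    (hA : ∀ (S : Type v) [AddCommGroup S] [Module A S], IsSimpleModule A S → Finite S)
    (M : Type v) [AddCommGroup M] [Module A M] (h : IsArtinian A M) :
    FinitelyDiscriminable A M := by
  classical
  let T : Submodule A M := ⨆ P ∈ {P : Submodule A M | IsAtom P}, P
  have hT : IsSemisimpleModule A T := by
    refine isSemisimpleModule_biSup_of_isSemisimpleModule_submodule fun P hP => ?_
    have : IsSimpleModule A P := isSimpleModule_iff_isAtom.2 hP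
    infer_instance
  have hfl : IsFiniteLength A T := by
    have h1 := IsSemisimpleModule.finite_tfae (R := A) (M := T)
    have h2 : IsArtinian A T := inferInstance
    exact (h1.out 2 3).1 h2
  have hfin : Finite T := FD.finite_of_isFiniteLength hA T hfl
  have hs : {P : Submodule A M | IsAtom P}.Finite := by
    have h1 : (T : Set M).Finite := hfin
    refine Set.Finite.subset
      (h1.finite_subsets.preimage (f := fun P : Submodule A M => (P : Set M))
        SetLike.coe_injective.injOn) ?_
    intro P hP
    exact le_iSup₂ (f := fun (P : Submodule A M) (_ : P ∈ {P : Submodule A M | IsAtom P}) => P) P hP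
  refine ⟨hs.toFinset, fun N hN => (hs.mem_toFinset.1 hN).1, fun N hN => ?_⟩
  obtain hb | ⟨P, hP, hPN⟩ := eq_bot_or_exists_atom_le N
  · exact absurd hb hN
  · exact ⟨P, hs.mem_toFinset.2 hP, hPN⟩

theorem FD.finite_simple {A : Type*} [CommRing A] (S : Type*) [AddCommGroup S] [Module A S]
    [hS : IsSimpleModule A S] (h : FinitelyDiscriminable A (S × S)) : Finite S := by
  obtain ⟨s, hs0, hs⟩ := h
  have := IsSimpleModule.nontrivial A S
  obtain ⟨c, hc⟩ := exists_ne (0 : S)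
  have kill : ∀ (a : A) (u v : S), u ≠ 0 → a • u = 0 → a • v = 0 := by
    intro a u v hu hau
    have hv : v ∈ Submodule.span A {u} := by
      rw [IsSimpleModule.span_singleton_eq_top A hu]
      trivial
    obtain ⟨b, rfl⟩ := Submodule.mem_span_singleton.1 hv
    rw [smul_comm, hau, smul_zero]
  have hne : ∀ t : S, Submodule.span A {(c, t)} ≠ ⊥ := by
    intro t ht
    rw [Submodule.span_singleton_eq_bot] at ht
    exact hc (congrArg Prod.fst ht)
  choose P hP hPle using fun t => hs _ (hne t)
  refine Finite.of_injective (fun t => (⟨P t, hP t⟩ : s)) ?_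
  intro t t' htt
  have htt' : P t = P t' := congrArg Subtype.val htt
  by_contra hne'
  obtain ⟨z, hz, hz0⟩ := Submodule.exists_mem_ne_zero_of_ne_bot (hs0 _ (hP t))
  obtain ⟨a, ha⟩ := Submodule.mem_span_singleton.1 (hPle t hz)
  obtain ⟨b, hb⟩ := Submodule.mem_span_singleton.1 (hPle t' (htt' ▸ hz))
  have h1 : a • c = b • c := congrArg Prod.fst (ha.trans hb.symm)
  have h2 : a • t = b • t' := congrArg Prod.snd (ha.trans hb.symm)
  have h3 : (a - b) • t' = 0 := kill (a - b) c t' hc (by rw [sub_smul, h1, sub_self])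
  have h4 : a • (t - t') = 0 := by
    rw [sub_smul, sub_eq_zero] at h3
    rw [smul_sub, h2, h3, sub_self]
  have h5 := fun v => kill a (t - t') v (sub_ne_zero.2 hne') h4
  apply hz0
  rw [← ha]
  exact Prod.ext (h5 c) (h5 t)

/-- Over a noetherian commutative ring `A`, every finitely discriminable module is artinian;
moreover every artinian `A`-module is finitely discriminable if and only if every simple
`A`-module is finite. -/
theorem finitelyDiscriminable_iff_artinian
    (A : Type u) [CommRing A] [IsNoetherianRing A] :
    (∀ (M : Type v) [AddCommGroup M] [Module A M],
        FinitelyDiscriminable A M → IsArtinian A M) ∧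
    ((∀ (M : Type v) [AddCommGroup M] [Module A M],
        IsArtinian A M → FinitelyDiscriminable A M) ↔
      ∀ (S : Type v) [AddCommGroup S] [Module A S], IsSimpleModule A S → Finite S) := by
  refine ⟨fun M _ _ h => FD.artinian h, fun h S _ _ hS => ?_, fun h M _ _ hM => FD.of_artinian h M hM⟩
  exact FD.finite_simple (A := A) S (h (S × S) inferInstance)
end
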